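/- arXiv:0801.2259 — 6 statements merged into one kernel-verified Lean document; each statement's English description precedes it below -/
import Mathlib

section
/- Let A be a unital C*-algebra and let n ≥ 1 be a natural number. Suppose there exist elements v, s_1, …, s_n ∈ A satisfying: s_1* s_1 = s_i s_i* for all i; (s_i* s_i)(s_j* s_j) = 0 for all i ≠ j; v* v = 1_A − (s_1* s_1 + ⋯ + s_n* s_n); and v v* (s_1* s_1) = v v*. Then there exists a unital *-homomorphism from the dimension-drop algebra Z_{n,n+1} into A. -/
open scoped Kronecker

noncomputable section

lemma star_kronecker {p q : ℕ} (x : Matrix (Fin p) (Fin p) ℂ) (y : Matrix (Fin q) (Fin q) ℂ) :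
    star (x ⊗ₖ y) = (star x) ⊗ₖ (star y) := by
  ext ⟨i, k⟩ ⟨j, l⟩
  simp [Matrix.star_apply, Matrix.kroneckerMap_apply, star_mul', mul_comm]

/-- The dimension-drop algebra `Z_{p,q}`: continuous functions from `[0,1]` to
`M_p ⊗ M_q = M_{pq}` whose value at `0` lies in `M_p ⊗ ℂ1` and whose value at `1` lies in
`ℂ1 ⊗ M_q`. -/
def DimDrop (p q : ℕ) :
    StarSubalgebra ℂ C(unitInterval, Matrix (Fin p × Fin q) (Fin p × Fin q) ℂ) where
  carrier := {f | (∃ x : Matrix (Fin p) (Fin p) ℂ, f 0 = x ⊗ₖ (1 : Matrix (Fin q) (Fin q) ℂ)) ∧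
      (∃ y : Matrix (Fin q) (Fin q) ℂ, f 1 = (1 : Matrix (Fin p) (Fin p) ℂ) ⊗ₖ y)}
  mul_mem' := by
    rintro f g ⟨⟨x, hx⟩, ⟨y, hy⟩⟩ ⟨⟨x', hx'⟩, ⟨y', hy'⟩⟩
    refine ⟨⟨x * x', ?_⟩, ⟨y * y', ?_⟩⟩
    · rw [ContinuousMap.mul_apply, hx, hx', ← Matrix.mul_kronecker_mul, one_mul]
    · rw [ContinuousMap.mul_apply, hy, hy', ← Matrix.mul_kronecker_mul, one_mul]
  add_mem' := by
    rintro f g ⟨⟨x, hx⟩, ⟨y, hy⟩⟩ ⟨⟨x', hx'⟩, ⟨y', hy'⟩⟩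
    refine ⟨⟨x + x', ?_⟩, ⟨y + y', ?_⟩⟩
    · rw [ContinuousMap.add_apply, hx, hx', Matrix.add_kronecker]
    · rw [ContinuousMap.add_apply, hy, hy', Matrix.kronecker_add]
  algebraMap_mem' := fun c =>
    ⟨⟨c • 1, by rw [Algebra.algebraMap_eq_smul_one, ContinuousMap.smul_apply,
        ContinuousMap.one_apply, Matrix.smul_kronecker, Matrix.one_kronecker_one]⟩,
     ⟨c • 1, by rw [Algebra.algebraMap_eq_smul_one, ContinuousMap.smul_apply,
        ContinuousMap.one_apply, Matrix.kronecker_smul, Matrix.one_kronecker_one]⟩⟩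
  star_mem' := by
    rintro f ⟨⟨x, hx⟩, ⟨y, hy⟩⟩
    refine ⟨⟨star x, ?_⟩, ⟨star y, ?_⟩⟩
    · rw [ContinuousMap.star_apply, hx, star_kronecker, star_one]
    · rw [ContinuousMap.star_apply, hy, star_kronecker, star_one]

namespace DD


abbrev Rg := C(unitInterval, ℂ)

def idc : Rg := ⟨fun t => ((t : ℝ) : ℂ), by fun_prop⟩

theorem exists_pi {A : Type*} [CStarAlgebra A] (a : A) (ha : IsSelfAdjoint a)
    (hs : ∀ x ∈ spectrum ℝ a, 0 ≤ x ∧ x ≤ 1) :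
    ∃ π : Rg →⋆ₐ[ℂ] A, π idc = a := by
  have hn : IsStarNormal a := ha.isStarNormal
  have hz : ∀ x ∈ spectrum ℂ a, x = (x.re : ℂ) := fun x hx => ha.mem_spectrum_eq_re hx
  have hmem : ∀ x ∈ spectrum ℂ a, 0 ≤ x.re ∧ x.re ≤ 1 := by
    intro x hx
    apply hs
    have := hz x hx
    rw [this] at hx
    exact (spectrum.algebraMap_mem_iff ℂ (R := ℝ) (r := x.re)).mp hx
  let f : C(spectrum ℂ a, unitInterval) :=
    ⟨fun x => ⟨x.1.re, hmem x.1 x.2⟩, by fun_prop⟩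
  refine ⟨(cfcHom (R := ℂ) hn).comp (f.compStarAlgHom' ℂ ℂ), ?_⟩
  conv_rhs => rw [← cfcHom_id (R := ℂ) (a := a) hn]
  simp only [StarAlgHom.comp_apply]
  congr 1
  ext x
  simp [f, idc]
  exact (hz x.1 x.2).symm

theorem pi_ext {A : Type*} [CStarAlgebra A] (π π' : Rg →⋆ₐ[ℂ] A) (x : A)
    (h : π idc * x = x * π' idc) (f : Rg) : π f * x = x * π' f := by
  have hc : Continuous π := AddMonoidHomClass.continuous_of_bound π 1 (fun x => by simpa using NonUnitalStarAlgHom.norm_apply_le π x)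
  have hc' : Continuous π' := AddMonoidHomClass.continuous_of_bound π' 1 (fun x => by simpa using NonUnitalStarAlgHom.norm_apply_le π' x)
  have hid : star idc = idc := by ext t; simp [idc]
  have htop := ContinuousMap.starSubalgebra_topologicalClosure_eq_top_of_separatesPoints
    (𝕜 := ℂ) (StarAlgebra.adjoin ℂ {idc}) (by
      intro s t hst
      refine ⟨idc, ⟨idc, StarAlgebra.self_mem_adjoin_singleton ℂ idc, rfl⟩, ?_⟩
      simp [idc]
      exact fun h => hst (Subtype.ext h))
  have hf : f ∈ (StarAlgebra.adjoin ℂ {idc}).topologicalClosure := by rw [htop]; trivial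
  have hcl : IsClosed {f : Rg | π f * x = x * π' f} := isClosed_eq (by fun_prop) (by fun_prop)
  have : closure ((StarAlgebra.adjoin ℂ {idc} : StarSubalgebra ℂ Rg) : Set Rg) ⊆
      {f : Rg | π f * x = x * π' f} := by
    apply hcl.closure_subset_iff.mpr
    intro g hg
    change g ∈ StarAlgebra.adjoin ℂ {idc} at hg
    have hg' : g ∈ Algebra.adjoin ℂ {idc} := by
      rw [← StarSubalgebra.mem_toSubalgebra, StarAlgebra.adjoin_toSubalgebra] at hg
      simpa [Set.star_singleton, hid] using hg
    clear hg
    induction hg' using Algebra.adjoin_induction with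
    | mem g hg => rw [Set.mem_singleton_iff] at hg; subst hg; exact h
    | algebraMap r => 
      change π _ * x = x * π' _
      rw [AlgHomClass.commutes, AlgHomClass.commutes]
      exact Algebra.commutes r x
    | add g k _ _ hg hk => 
      have hg : π _ * x = x * π' _ := hg
      have hk : π _ * x = x * π' _ := hk
      change π _ * x = x * π' _
      rw [map_add, map_add, add_mul, mul_add, hg, hk]
    | mul g k _ _ hg hk => 
      have hg : π _ * x = x * π' _ := hg
      have hk : π _ * x = x * π' _ := hk
      change π _ * x = x * π' _
      rw [map_mul, map_mul, mul_assoc, hk, ← mul_assoc, hg, mul_assoc]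
  exact this hf

theorem range_of_order {A : Type*} [CStarAlgebra A] [PartialOrder A] [StarOrderedRing A] (a : A)
   (h0 : 0 ≤ a) (h1 : a ≤ 1) : ∀ x ∈ spectrum ℝ a, 0 ≤ x ∧ x ≤ 1 := by
  intro x hx
  refine ⟨spectrum_nonneg_of_nonneg h0 hx, ?_⟩
  have := (le_algebraMap_iff_spectrum_le (R := ℝ) (r := 1) (a := a)).mp (by simpa using h1)
  exact this x hx

/-- The base data extracted from the relations. -/
structure Sys (A : Type*) [CStarAlgebra A] (n : ℕ) where
  s : Fin n → A
  r : Fin (n + 1) → A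
  e : A
  a : A
  h : A
  z : A
  πz : Rg →⋆ₐ[ℂ] A
  πa : Rg →⋆ₐ[ℂ] A
  ss : ∀ i j, s i * star (s j) = if i = j then a else 0
  rr : ∀ k l, star (r k) * r l = if k = l then 1 - h else 0
  hh : h = ∑ i, star (s i) * s i
  zz : z = ∑ i, star (s i) * e * s i
  z1 : 1 - z = ∑ k, r k * star (r k)
  ea : e * a = a * e
  se : star e = e
  sa : star a = a
  sh : star h = h
  sz : star z = z
  rl1 : ∀ (m j l : Fin n), star (r m.castSucc) * (star (s j) * e * s l) =
    if m = j then h * star (r l.castSucc) else 0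
  rl2 : ∀ (j l : Fin n), star (r (Fin.last n)) * (star (s j) * e * s l) =
    star (s j) * (s l * star (r (Fin.last n)))
  pz : πz idc = z
  pa : πa idc = a

variable {A : Type*} [CStarAlgebra A] {n : ℕ}

abbrev Nn (n : ℕ) := Fin n × Fin (n + 1)

def sig (n : ℕ) (α : Nn n) : Nn n :=
  Fin.lastCases (motive := fun _ => Nn n) (α.1, Fin.last n) (fun k => (k, α.1.castSucc)) α.2

@[simp] theorem sig_last (i : Fin n) : sig n (i, Fin.last n) = (i, Fin.last n) := by
  simp [sig]
@[simp] theorem sig_cast (i k : Fin n) : sig n (i, k.castSucc) = (k, i.castSucc) := by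
  simp [sig]
theorem sig_sig (α : Nn n) : sig n (sig n α) = α := by
  obtain ⟨i, m⟩ := α
  induction m using Fin.lastCases <;> simp

def lam (x : Matrix (Fin n) (Fin n) ℂ) : Matrix (Nn n) (Nn n) ℂ :=
  (x ⊗ₖ (1 : Matrix (Fin (n + 1)) (Fin (n + 1)) ℂ)).submatrix (sig n) (sig n)

def rho (y : Matrix (Fin (n + 1)) (Fin (n + 1)) ℂ) : Matrix (Nn n) (Nn n) ℂ :=
  (1 : Matrix (Fin n) (Fin n) ℂ) ⊗ₖ y

def cst (M : Matrix (Nn n) (Nn n) ℂ) : Matrix (Nn n) (Nn n) Rg := M.map (algebraMap ℂ Rg)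

/-- Pointwise scaling of a matrix by a function. -/
def sm (f : Rg) (G : Matrix (Nn n) (Nn n) Rg) : Matrix (Nn n) (Nn n) Rg :=
  Matrix.of fun α β => f * G α β

theorem sm_apply (f : Rg) (G : Matrix (Nn n) (Nn n) Rg) (α β) : sm f G α β = f * G α β := rfl
theorem mul_sm (f : Rg) (G K : Matrix (Nn n) (Nn n) Rg) : G * sm f K = sm f (G * K) := by
  ext1 α β
  simp only [sm_apply, Matrix.mul_apply, Finset.mul_sum]
  exact Finset.sum_congr rfl fun _ _ => by ring
theorem sm_mul (f : Rg) (G K : Matrix (Nn n) (Nn n) Rg) : sm f G * K = sm f (G * K) := by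
  ext1 α β
  simp only [sm_apply, Matrix.mul_apply, Finset.mul_sum]
  exact Finset.sum_congr rfl fun _ _ => by ring
theorem sm_sm (f g : Rg) (G : Matrix (Nn n) (Nn n) Rg) : sm f (sm g G) = sm (f * g) G := by
  ext1 α β
  simp only [sm_apply]; ring
theorem sm_add (f : Rg) (G K : Matrix (Nn n) (Nn n) Rg) : sm f (G + K) = sm f G + sm f K := by
  ext1 α β
  simp only [sm_apply, Matrix.add_apply]; ring
theorem add_sm (f g : Rg) (G : Matrix (Nn n) (Nn n) Rg) : sm (f + g) G = sm f G + sm g G := by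
  ext1 α β
  simp only [sm_apply, Matrix.add_apply]; ring
theorem star_sm (f : Rg) (G : Matrix (Nn n) (Nn n) Rg) : star (sm f G) = sm (star f) (star G) := by
  ext1 α β
  simp only [sm_apply, Matrix.star_apply, star_mul]; ring
theorem sm_congr {κ : Rg} {G K : Matrix (Nn n) (Nn n) Rg} (h : sm κ G = sm κ K) (f g : Rg) :
    sm (κ * f * g) G = sm (κ * f * g) K := by
  rw [show κ * f * g = (f * g) * κ by ring, ← sm_sm, h, sm_sm]
theorem star_mm (G K : Matrix (Nn n) (Nn n) Rg) : star (G * K) = star K * star G := by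
  rw [Matrix.star_eq_conjTranspose, Matrix.star_eq_conjTranspose, Matrix.star_eq_conjTranspose,
    Matrix.conjTranspose_mul]
theorem star_idc : star idc = idc := by ext t; simp [idc]

theorem star_cst (M : Matrix (Nn n) (Nn n) ℂ) : star (cst M) = cst (star M) := by
  ext α β t
  simp [cst, Matrix.star_apply]
theorem cst_mul (M N : Matrix (Nn n) (Nn n) ℂ) : cst (M * N) = cst M * cst N := by
  simp [cst, Matrix.map_mul]
theorem star_lam (x : Matrix (Fin n) (Fin n) ℂ) : star (lam x) = lam (star x) := by
  ext α β
  simp [lam, Matrix.star_apply, Matrix.one_apply, eq_comm]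
  split_ifs <;> simp
theorem star_rho (x : Matrix (Fin (n + 1)) (Fin (n + 1)) ℂ) : star (rho x) = rho (star x) := by
  ext α β
  simp [rho, Matrix.star_apply, Matrix.one_apply, eq_comm]
  split_ifs <;> simp
theorem lam_one : lam (1 : Matrix (Fin n) (Fin n) ℂ) = 1 := by
  rw [lam, Matrix.one_kronecker_one]
  exact Matrix.submatrix_one _ (Function.LeftInverse.injective sig_sig)
theorem rho_one : rho (1 : Matrix (Fin (n + 1)) (Fin (n + 1)) ℂ) = (1 : Matrix (Nn n) (Nn n) ℂ) := by
  rw [rho, Matrix.one_kronecker_one]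

namespace Sys
variable (S : Sys A n)

theorem hs (i : Fin n) : S.h * star (S.s i) = star (S.s i) * S.a := by
  rw [S.hh, Finset.sum_mul]
  simp [mul_assoc, S.ss]

theorem sh' (i : Fin n) : S.s i * S.h = S.a * S.s i := by
  have := congrArg star (S.hs i)
  simpa [S.sh, S.sa] using this

theorem zs (i : Fin n) : S.z * star (S.s i) = star (S.s i) * (S.e * S.a) := by
  rw [S.zz, Finset.sum_mul]
  simp [mul_assoc, S.ss]

theorem zs' (i : Fin n) : S.s i * S.z = S.e * S.a * S.s i := by
  have := congrArg star (S.zs i)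
  simpa [S.sz, S.se, S.sa, S.ea] using this

theorem zr (k : Fin (n + 1)) : S.z * S.r k = S.r k * S.h := by
  have : (1 - S.z) * S.r k = S.r k * (1 - S.h) := by
    rw [S.z1, Finset.sum_mul]
    simp [mul_assoc, S.rr]
  simpa [sub_mul, mul_sub] using this

theorem zr' (k : Fin (n + 1)) : star (S.r k) * S.z = S.h * star (S.r k) := by
  have := congrArg star (S.zr k)
  simpa [S.sz, S.sh] using this

def T (α : Nn n) : A := S.s α.1 * star (S.r α.2)

theorem Tz (α : Nn n) : S.a * S.T α = S.T α * S.z := by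
  rw [T, mul_assoc, S.zr', ← mul_assoc, ← mul_assoc, S.sh']

theorem TT (α β : Nn n) : S.T α * star (S.T β) = if α = β then S.a * (1 - S.a) else 0 := by
  have : S.T α * star (S.T β) = S.s α.1 * (star (S.r α.2) * S.r β.2) * star (S.s β.1) := by
    simp [T, mul_assoc]
  rw [this, S.rr]
  have h2 : S.s α.1 * (1 - S.h) * star (S.s β.1) = if α.1 = β.1 then S.a * (1 - S.a) else 0 := by
    rw [mul_sub, S.sh', mul_one, sub_mul, mul_assoc, S.ss]
    split_ifs <;> simp [mul_sub]
  obtain ⟨i, k⟩ := α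
  obtain ⟨j, l⟩ := β
  simp only [Prod.mk.injEq] at *
  by_cases hk : k = l <;> simp [hk, h2]

def L (x : Matrix (Fin n) (Fin n) ℂ) : A :=
  ∑ i, ∑ j, x i j • (star (S.s i) * S.e * S.s j)
def R (y : Matrix (Fin (n + 1)) (Fin (n + 1)) ℂ) : A :=
  ∑ k, ∑ l, y k l • (S.r k * star (S.r l))
def II (G : Matrix (Nn n) (Nn n) Rg) : A :=
  ∑ α, ∑ β, star (S.T α) * S.πa (G α β) * S.T β

theorem II_mul (G K : Matrix (Nn n) (Nn n) Rg) (X : A)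
    (hX : ∀ β, S.T β * X = ∑ γ, S.πa (K β γ) * S.T γ) : S.II G * X = S.II (G * K) := by
  simp only [II, Finset.sum_mul, mul_assoc, hX, Matrix.mul_apply, map_sum, map_mul, Finset.mul_sum]
  refine Finset.sum_congr rfl fun α _ => ?_
  rw [Finset.sum_comm]

theorem star_II (G : Matrix (Nn n) (Nn n) Rg) : star (S.II G) = S.II (star G) := by
  simp only [II, star_sum, star_mul, star_star, mul_assoc, ← map_star, Matrix.star_apply]
  rw [Finset.sum_comm]

theorem II_add (G K : Matrix (Nn n) (Nn n) Rg) : S.II (G + K) = S.II G + S.II K := by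
  simp only [II, Matrix.add_apply, map_add, mul_add, add_mul, Finset.sum_add_distrib]

theorem II_smulC (c : ℂ) (G : Matrix (Nn n) (Nn n) Rg) : S.II (c • G) = c • S.II G := by
  simp [II, Finset.smul_sum]

theorem T_II (G : Matrix (Nn n) (Nn n) Rg) (β : Nn n) :
    S.T β * S.II G = ∑ γ, S.πa ((sm (idc * (1 - idc)) G) β γ) * S.T γ := by
  simp only [II, Finset.mul_sum, ← mul_assoc, S.TT]
  rw [Finset.sum_eq_single β]
  · simp [sm_apply, S.pa]
  · intro b _ hb; simp [hb.symm]
  · simp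

theorem II_II (G K : Matrix (Nn n) (Nn n) Rg) :
    S.II G * S.II K = S.II (sm (idc * (1 - idc)) (G * K)) := by
  rw [S.II_mul G _ _ (S.T_II K), mul_sm]

theorem II_pz (G : Matrix (Nn n) (Nn n) Rg) (f : Rg) : S.II G * S.πz f = S.II (sm f G) := by
  rw [S.II_mul G (sm f 1), mul_sm, mul_one]
  intro β
  rw [← pi_ext S.πa S.πz (S.T β) (by rw [S.pa, S.pz, S.Tz])]
  rw [Finset.sum_eq_single β]
  · simp [sm_apply]
  · intro b _ hb; simp [sm_apply, hb.symm]
  · simp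

theorem star_L (x) : star (S.L x) = S.L (star x) := by
  simp only [L, star_sum, star_smul, star_mul, star_star, S.se, mul_assoc, Matrix.star_apply]
  rw [Finset.sum_comm]

theorem star_R (y) : star (S.R y) = S.R (star y) := by
  simp only [R, star_sum, star_smul, star_mul, star_star, mul_assoc, Matrix.star_apply]
  rw [Finset.sum_comm]

theorem L_one : S.L 1 = S.z := by
  simp [L, S.zz, Matrix.one_apply, ite_smul]
theorem R_one : S.R 1 = 1 - S.z := by
  simp [R, S.z1, Matrix.one_apply, ite_smul]

theorem L_add (x y) : S.L (x + y) = S.L x + S.L y := by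
  simp [L, add_smul, Finset.sum_add_distrib]
theorem R_add (x y) : S.R (x + y) = S.R x + S.R y := by
  simp [R, add_smul, Finset.sum_add_distrib]
theorem L_smul (c : ℂ) (x) : S.L (c • x) = c • S.L x := by
  simp [L, Finset.smul_sum, smul_smul]
theorem R_smul (c : ℂ) (x) : S.R (c • x) = c • S.R x := by
  simp [R, Finset.smul_sum, smul_smul]

theorem z_L (x) : S.z * S.L x = S.L x * S.z := by
  simp only [L, Finset.mul_sum, Finset.sum_mul, mul_smul_comm, smul_mul_assoc]
  refine Finset.sum_congr rfl fun i _ => Finset.sum_congr rfl fun j _ => ?_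
  congr 1
  rw [← mul_assoc, ← mul_assoc, S.zs, mul_assoc _ _ S.z, S.zs']
  have hh : S.e * S.a * S.e = S.e * (S.e * S.a) := by rw [mul_assoc, ← S.ea]
  have h2 : star (S.s i) * (S.e * S.a) * S.e * S.s j = star (S.s i) * (S.e * S.a * S.e) * S.s j := by
    simp only [mul_assoc]
  rw [h2, hh]; simp only [mul_assoc]

theorem z_R (x) : S.z * S.R x = S.R x * S.z := by
  simp only [R, Finset.mul_sum, Finset.sum_mul, mul_smul_comm, smul_mul_assoc]
  refine Finset.sum_congr rfl fun i _ => Finset.sum_congr rfl fun j _ => ?_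
  congr 1
  rw [← mul_assoc, S.zr, mul_assoc _ _ S.z, S.zr', mul_assoc]

theorem pz_L (f x) : S.πz f * S.L x = S.L x * S.πz f :=
  pi_ext _ _ _ (by rw [S.pz, S.z_L]) f
theorem pz_R (f x) : S.πz f * S.R x = S.R x * S.πz f :=
  pi_ext _ _ _ (by rw [S.pz, S.z_R]) f

theorem s_L (j : Fin n) (x) : S.s j * S.L x = S.a * S.e * ∑ l, x j l • S.s l := by
  simp only [L, Finset.mul_sum, mul_smul_comm, ← mul_assoc, S.ss]
  rw [Finset.sum_eq_single j]
  · simp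
  · intro b _ hb; simp [hb.symm]
  · simp

theorem r_R (m : Fin (n + 1)) (y) : star (S.r m) * S.R y = (1 - S.h) * ∑ l, y m l • star (S.r l) := by
  simp only [R, Finset.mul_sum, mul_smul_comm, ← mul_assoc, S.rr]
  rw [Finset.sum_eq_single m]
  · simp
  · intro b _ hb; simp [hb.symm]
  · simp

theorem L_L (x x') : S.L x * S.L x' = S.z * S.L (x * x') := by
  have h1 : S.L x * S.L x' = ∑ i, ∑ j, x i j • (star (S.s i) * S.e * (S.s j * S.L x')) := by
    simp [L, Finset.sum_mul, mul_assoc]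
  have h2 : S.z * S.L (x * x') =
      ∑ i, ∑ l, (x * x') i l • (star (S.s i) * S.e * (S.a * S.e * S.s l)) := by
    simp only [L, Finset.mul_sum, mul_smul_comm]
    refine Finset.sum_congr rfl fun i _ => Finset.sum_congr rfl fun l _ => ?_
    congr 1
    rw [← mul_assoc, ← mul_assoc, S.zs]
    simp only [mul_assoc]
  rw [h1, h2]
  refine Finset.sum_congr rfl fun i _ => ?_
  simp only [S.s_L, Finset.mul_sum, mul_smul_comm, Finset.smul_sum, smul_smul, Matrix.mul_apply,
    Finset.sum_smul]
  rw [Finset.sum_comm]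

theorem R_R (x x') : S.R x * S.R x' = (1 - S.z) * S.R (x * x') := by
  have h1 : S.R x * S.R x' = ∑ i, ∑ j, x i j • (S.r i * (star (S.r j) * S.R x')) := by
    simp [R, Finset.sum_mul, mul_assoc]
  have h2 : (1 - S.z) * S.R (x * x') =
      ∑ i, ∑ l, (x * x') i l • (S.r i * ((1 - S.h) * star (S.r l))) := by
    simp only [R, Finset.mul_sum, mul_smul_comm]
    refine Finset.sum_congr rfl fun i _ => Finset.sum_congr rfl fun l _ => ?_
    congr 1
    rw [← mul_assoc, sub_mul, S.zr]
    simp only [mul_assoc, sub_mul, mul_sub, one_mul]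
  rw [h1, h2]
  refine Finset.sum_congr rfl fun i _ => ?_
  simp only [S.r_R, Finset.mul_sum, mul_smul_comm, Finset.smul_sum, smul_smul, Matrix.mul_apply,
    Finset.sum_smul]
  rw [Finset.sum_comm]

theorem r_L (m : Fin (n + 1)) (x) : star (S.r m) * S.L x =
    ∑ i, star (S.s i) * ∑ γ, lam x (i, m) γ • S.T γ := by
  induction m using Fin.lastCases with
  | last =>
    simp only [L, Finset.mul_sum, mul_smul_comm, S.rl2]
    simp [lam, Fintype.sum_prod_type, Fin.sum_univ_castSucc, Matrix.one_apply, T]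
    refine Finset.sum_congr rfl fun i _ => Finset.sum_congr rfl fun j _ => ?_
    rw [if_neg (Fin.castSucc_ne_last j).symm, zero_add]
  | cast m =>
    simp only [L, Finset.mul_sum, mul_smul_comm, S.rl1]
    simp [lam, Fintype.sum_prod_type, Fin.sum_univ_castSucc, Matrix.one_apply, T]
    rw [Finset.sum_comm]
    refine Finset.sum_congr rfl fun i _ => ?_
    rw [S.hh, Finset.sum_mul, Finset.smul_sum]
    simp only [mul_assoc]

theorem T_L (x) (β) : S.T β * S.L x = ∑ γ, S.πa ((sm idc (cst (lam x))) β γ) * S.T γ := by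
  rw [T, mul_assoc, S.r_L, Finset.mul_sum]
  simp only [← mul_assoc, S.ss]
  rw [Finset.sum_eq_single β.1]
  · simp [sm_apply, cst, S.pa, Finset.mul_sum, Algebra.algebraMap_eq_smul_one]
  · intro b _ hb; simp [hb.symm]
  · simp

theorem T_R (y) (β) : S.T β * S.R y = ∑ γ, S.πa ((sm (1 - idc) (cst (rho y))) β γ) * S.T γ := by
  rw [T, mul_assoc, S.r_R, ← mul_assoc, mul_sub, S.sh', Fintype.sum_prod_type]
  simp [sm_apply, cst, rho, S.pa, Finset.mul_sum, Algebra.algebraMap_eq_smul_one, Matrix.one_apply, T]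
  rw [Finset.sum_eq_single β.1]
  · refine Finset.sum_congr rfl fun l _ => ?_
    rw [if_pos rfl]
    simp [S.pa, sub_mul, mul_assoc]
  · intro b _ hb; simp [hb.symm]
  · simp

theorem II_L (G x) : S.II G * S.L x = S.II (sm idc (G * cst (lam x))) := by
  rw [S.II_mul G _ _ (S.T_L x), mul_sm]
theorem II_R (G y) : S.II G * S.R y = S.II (sm (1 - idc) (G * cst (rho y))) := by
  rw [S.II_mul G _ _ (S.T_R y), mul_sm]

theorem R_L (x y) : S.R y * S.L x = S.II (cst (rho y * lam x)) := by
  have : S.R y * S.L x = ∑ k, ∑ l, y k l • (S.r k * (star (S.r l) * S.L x)) := by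
    simp [R, Finset.sum_mul, mul_assoc]
  rw [this]
  simp only [S.r_L]
  have hT : S.II (cst (rho y * lam x)) = ∑ k, ∑ i, ∑ γ, ∑ l,
      (y k l * lam x (i, l) γ) • (S.r k * (star (S.s i) * S.T γ)) := by
    simp only [II]
    rw [Fintype.sum_prod_type, Finset.sum_comm]
    refine Finset.sum_congr rfl fun k _ => Finset.sum_congr rfl fun i _ =>
      Finset.sum_congr rfl fun γ _ => ?_
    have : (rho y * lam x) (i, k) γ = ∑ l, y k l * lam x (i, l) γ := by
      rw [Matrix.mul_apply, Fintype.sum_prod_type]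
      simp [rho, Matrix.one_apply]
    rw [← Finset.sum_smul, ← this]
    simp [cst, Algebra.algebraMap_eq_smul_one, T, mul_assoc]
  rw [hT]
  refine Finset.sum_congr rfl fun k _ => ?_
  simp only [Finset.mul_sum, Finset.smul_sum, mul_smul_comm, smul_smul]
  rw [Finset.sum_comm]
  refine Finset.sum_congr rfl fun i _ => ?_
  rw [Finset.sum_comm]

theorem L_R (x y) : S.L x * S.R y = S.II (cst (lam x * rho y)) := by
  have := congrArg star (S.R_L (star x) (star y))
  simpa [S.star_L, S.star_R, S.star_II, star_cst, star_lam, star_rho] using this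

theorem L_II (G x) : S.L x * S.II G = S.II (sm idc (cst (lam x) * G)) := by
  have := congrArg star (S.II_L (star G) (star x))
  simpa [S.star_L, S.star_II, star_sm, star_mm, star_cst, star_lam, star_idc] using this

theorem R_II (G x) : S.R x * S.II G = S.II (sm (1 - idc) (cst (rho x) * G)) := by
  have := congrArg star (S.II_R (star G) (star x))
  simpa [S.star_R, S.star_II, star_sm, star_mm, star_cst, star_rho, star_idc] using this

theorem pz_II (G) (f : Rg) : S.πz f * S.II G = S.II (sm f G) := by
  have := congrArg star (S.II_pz (star G) (star f))
  simpa [S.star_II, star_sm, ← map_star] using this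

/-- The glued map on triples. -/
def Psi (κ₁ κ₀ m : Rg) (x : Matrix (Fin n) (Fin n) ℂ) (y : Matrix (Fin (n + 1)) (Fin (n + 1)) ℂ)
    (H : Matrix (Nn n) (Nn n) Rg) : A :=
  S.πz κ₁ * S.L x + S.πz κ₀ * S.R y + S.II (sm m H)

theorem Psi_one (κ₁ κ₀ m : Rg)
    (h1 : idc * κ₁ + (1 - idc) * κ₀ + idc * (1 - idc) * m = 1) : S.Psi κ₁ κ₀ m 1 1 1 = 1 := by
  have hI : S.II (sm m 1) = S.πz (m * (idc * (1 - idc))) := by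
    rw [← S.pz_II, map_mul]
    have := S.L_R 1 1
    rw [lam_one, rho_one, mul_one, S.L_one, S.R_one] at this
    have hc : cst (1 : Matrix (Nn n) (Nn n) ℂ) = 1 := by simp [cst]
    rw [hc] at this
    rw [← this]
    simp [S.pz]
  rw [Psi, hI, S.L_one, S.R_one, ← S.pz]
  rw [← map_one S.πz, ← map_sub, ← map_mul, ← map_mul, ← map_add, ← map_add]
  congr 1
  linear_combination h1

theorem Psi_mul (κ₁ κ₀ m : Rg) (h1 : idc * κ₁ + (1 - idc) * κ₀ + idc * (1 - idc) * m = 1)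
    (h0 : κ₁ * κ₀ = 0) (x x' y y' H H')
    (hx : sm κ₁ H = sm κ₁ (cst (lam x))) (hx' : sm κ₁ H' = sm κ₁ (cst (lam x')))
    (hy : sm κ₀ H = sm κ₀ (cst (rho y))) (hy' : sm κ₀ H' = sm κ₀ (cst (rho y')))
    (hxx : sm κ₁ (H * H') = sm κ₁ (cst (lam (x * x'))))
    (hyy : sm κ₀ (H * H') = sm κ₀ (cst (rho (y * y')))) :
    S.Psi κ₁ κ₀ m x y H * S.Psi κ₁ κ₀ m x' y' H' = S.Psi κ₁ κ₀ m (x * x') (y * y') (H * H') := by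
  have hc1 : cst (1 : Matrix (Nn n) (Nn n) ℂ) = 1 := by simp [cst]
  have a1 : (S.πz κ₁ * S.L x) * (S.πz κ₁ * S.L x') = S.πz (κ₁ * κ₁ * idc) * S.L (x * x') := by
    rw [mul_assoc, ← mul_assoc (S.L x), ← S.pz_L, mul_assoc, S.L_L, ← S.pz]
    simp [mul_assoc]
  have a2 : (S.πz κ₀ * S.R y) * (S.πz κ₀ * S.R y') =
      S.πz (κ₀ * κ₀ * (1 - idc)) * S.R (y * y') := by
    rw [mul_assoc, ← mul_assoc (S.R y), ← S.pz_R, mul_assoc, S.R_R, ← S.pz]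
    simp [mul_assoc]
  have a3 : (S.πz κ₁ * S.L x) * (S.πz κ₀ * S.R y') = 0 := by
    rw [mul_assoc, ← mul_assoc (S.L x), ← S.pz_L, mul_assoc, ← mul_assoc, ← map_mul, h0]
    simp
  have a4 : (S.πz κ₀ * S.R y) * (S.πz κ₁ * S.L x') = 0 := by
    rw [mul_assoc, ← mul_assoc (S.R y), ← S.pz_R, mul_assoc, ← mul_assoc, ← map_mul,
      mul_comm κ₀, h0]
    simp
  have a5 : (S.πz κ₁ * S.L x) * S.II (sm m H') = S.II (sm (κ₁ * idc * m) (H * H')) := by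
    rw [mul_assoc, S.L_II, S.pz_II]
    congr 1
    rw [mul_sm, sm_sm, sm_sm, ← sm_mul, ← sm_mul, sm_congr hx]
  have a6 : (S.πz κ₀ * S.R y) * S.II (sm m H') = S.II (sm (κ₀ * (1 - idc) * m) (H * H')) := by
    rw [mul_assoc, S.R_II, S.pz_II]
    congr 1
    rw [mul_sm, sm_sm, sm_sm, ← sm_mul, ← sm_mul, sm_congr hy]
  have a7 : S.II (sm m H) * (S.πz κ₁ * S.L x') = S.II (sm (κ₁ * idc * m) (H * H')) := by
    rw [S.pz_L, ← mul_assoc, S.II_L, S.II_pz]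
    congr 1
    rw [sm_mul, sm_sm, sm_sm, ← mul_sm, ← mul_sm, sm_congr hx']
  have a8 : S.II (sm m H) * (S.πz κ₀ * S.R y') = S.II (sm (κ₀ * (1 - idc) * m) (H * H')) := by
    rw [S.pz_R, ← mul_assoc, S.II_R, S.II_pz]
    congr 1
    rw [sm_mul, sm_sm, sm_sm, ← mul_sm, ← mul_sm, sm_congr hy']
  have a9 : S.II (sm m H) * S.II (sm m H') = S.II (sm (idc * (1 - idc) * m * m) (H * H')) := by
    rw [S.II_II, sm_mul, mul_sm, sm_sm, sm_sm]
  have b1 : S.πz κ₁ * S.L (x * x') = S.πz (κ₁ * κ₁ * idc) * S.L (x * x') +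
      S.II (sm (κ₁ * idc * m) (H * H')) := by
    have e1 : κ₁ = κ₁ * κ₁ * idc + (κ₁ * idc * m) * (1 - idc) := by
      linear_combination (-κ₁) * h1 + (1 - idc) * h0
    have e2 : S.πz ((κ₁ * idc * m) * (1 - idc)) * S.L (x * x') =
        S.II (sm (κ₁ * idc * m) (H * H')) := by
      have := S.R_L (x * x') 1
      rw [rho_one, one_mul, S.R_one] at this
      rw [map_mul, map_sub, map_one, S.pz, mul_assoc, this, S.pz_II]
      congr 1
      rw [sm_congr hxx]
    rw [← e2, ← add_mul, ← map_add, ← e1]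
  have b2 : S.πz κ₀ * S.R (y * y') = S.πz (κ₀ * κ₀ * (1 - idc)) * S.R (y * y') +
      S.II (sm (κ₀ * (1 - idc) * m) (H * H')) := by
    have e1 : κ₀ = κ₀ * κ₀ * (1 - idc) + (κ₀ * (1 - idc) * m) * idc := by
      linear_combination (-κ₀) * h1 + idc * h0
    have e2 : S.πz ((κ₀ * (1 - idc) * m) * idc) * S.R (y * y') =
        S.II (sm (κ₀ * (1 - idc) * m) (H * H')) := by
      have := S.L_R 1 (y * y')
      rw [lam_one, one_mul, S.L_one] at this
      rw [map_mul, S.pz, mul_assoc, this, S.pz_II]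
      congr 1
      rw [sm_congr hyy]
    rw [← e2, ← add_mul, ← map_add, ← e1]
  have b3 : sm m (H * H') = sm (κ₁ * idc * m) (H * H') + sm (κ₀ * (1 - idc) * m) (H * H') +
      sm (idc * (1 - idc) * m * m) (H * H') := by
    rw [← add_sm, ← add_sm]
    congr 1
    linear_combination (-m) * h1
  simp only [Psi, add_mul, mul_add, a1, a2, a3, a4, a5, a6, a7, a8, a9]
  rw [b1, b2, b3, S.II_add, S.II_add]
  abel

theorem Psi_star (κ₁ κ₀ m : Rg) (h1 : star κ₁ = κ₁) (h2 : star κ₀ = κ₀) (h3 : star m = m) (x y H) :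
    star (S.Psi κ₁ κ₀ m x y H) = S.Psi κ₁ κ₀ m (star x) (star y) (star H) := by
  simp only [Psi, star_add, star_mul, S.star_L, S.star_R, S.star_II, star_sm, ← map_star, h1, h2, h3,
    S.pz_L, S.pz_R]

theorem Psi_add (κ₁ κ₀ m : Rg) (x y H x' y' H') :
    S.Psi κ₁ κ₀ m (x + x') (y + y') (H + H') = S.Psi κ₁ κ₀ m x y H + S.Psi κ₁ κ₀ m x' y' H' := by
  simp only [Psi, L_add, R_add, sm_add, II_add, mul_add]
  abel

theorem Psi_smul (κ₁ κ₀ m : Rg) (c : ℂ) (x y H) :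
    S.Psi κ₁ κ₀ m (c • x) (c • y) (c • H) = c • S.Psi κ₁ κ₀ m x y H := by
  have : sm m (c • H) = c • sm m H := by
    ext1 α β
    ext t
    simp [sm_apply]
    ring
  simp only [Psi, L_smul, R_smul, this, II_smulC, mul_smul_comm, smul_add]

end Sys

/-- The function `√(1 - t)`. -/
def sqf : Rg := ⟨fun t => ((Real.sqrt (1 - t) : ℝ) : ℂ), by fun_prop⟩

theorem sqf_mul : sqf * sqf = 1 - idc := by
  ext t
  have h : (0 : ℝ) ≤ 1 - t := by linarith [t.2.2]
  simp only [sqf, idc, ContinuousMap.mul_apply, ContinuousMap.coe_mk, ContinuousMap.sub_apply,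
    ContinuousMap.one_apply]
  rw [← Complex.ofReal_mul, Real.mul_self_sqrt h]
  simp

theorem star_sqf : star sqf = sqf := by ext t; simp [sqf]

theorem exists_sys {A : Type*} [CStarAlgebra A] (n : ℕ) (hn : 1 ≤ n)
    (v : A) (s : Fin n → A)
    (h₁ : ∀ i, star (s ⟨0, hn⟩) * s ⟨0, hn⟩ = s i * star (s i))
    (h₂ : ∀ i j, i ≠ j → (star (s i) * s i) * (star (s j) * s j) = 0)
    (h₃ : star v * v = 1 - ∑ i, star (s i) * s i)
    (h₄ : v * star v * (star (s ⟨0, hn⟩) * s ⟨0, hn⟩) = v * star v) :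
    Nonempty (Sys A n) := by
  let _ := CStarAlgebra.spectralOrder A
  haveI := CStarAlgebra.spectralOrderedRing A
  set a : A := star (s ⟨0, hn⟩) * s ⟨0, hn⟩ with ha
  set h : A := ∑ i, star (s i) * s i with hh
  have sa : star a = a := by simp [ha]
  have sh : star h = h := by simp [hh, star_sum]
  have ss : ∀ i j, s i * star (s j) = if i = j then a else 0 := by
    intro i j
    split_ifs with hij
    · subst hij; exact (h₁ i).symm
    · have e1 : s i * (star (s j) * s j) = 0 := by
        rw [← CStarRing.star_mul_self_eq_zero_iff]
        have : star (s i * (star (s j) * s j)) * (s i * (star (s j) * s j)) =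
          star (s j) * s j * ((star (s i) * s i) * (star (s j) * s j)) := by
          simp [mul_assoc]
        rw [this, h₂ i j hij, mul_zero]
      rw [← CStarRing.mul_star_self_eq_zero_iff]
      have : s i * star (s j) * star (s i * star (s j)) =
          s i * (star (s j) * s j) * star (s i) := by
        simp [mul_assoc]
      rw [this, e1, zero_mul]
  have hs : ∀ i, h * star (s i) = star (s i) * a := by
    intro i
    rw [hh, Finset.sum_mul]
    simp [mul_assoc, ss]
  have h₄' : a * (v * star v) = v * star v := by
    have := congrArg star h₄
    simpa [sa, mul_assoc] using this
  have av : a * v = v := by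
    rw [← sub_eq_zero, ← CStarRing.mul_star_self_eq_zero_iff]
    have : (a * v - v) * star (a * v - v) =
        a * (v * star v) * a - a * (v * star v) - (v * star v * a - v * star v) := by
      simp [sa, mul_sub, sub_mul, mul_assoc]
      abel
    rw [this, h₄', h₄]
    simp
  have va : star v * a = star v := by
    have := congrArg star av
    simpa [sa] using this
  have hpos : 0 ≤ h := Finset.sum_nonneg fun i _ => star_mul_self_nonneg (s i)
  have hle : h ≤ 1 := by
    rw [← sub_nonneg, ← h₃]; exact star_mul_self_nonneg v
  have apos : 0 ≤ a := star_mul_self_nonneg _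
  have ale : a ≤ 1 := le_trans
    (Finset.single_le_sum (f := fun i => star (s i) * s i) (fun i _ => star_mul_self_nonneg (s i))
      (Finset.mem_univ (⟨0, hn⟩ : Fin n))) hle
  have vle : star v * v ≤ 1 := by rw [h₃]; exact sub_le_self _ hpos
  have vle' : v * star v ≤ 1 := by
    rw [← CStarAlgebra.norm_le_one_iff_of_nonneg _ (mul_star_self_nonneg v)]
    rw [CStarRing.norm_self_mul_star, ← CStarRing.norm_star_mul_self]
    exact (CStarAlgebra.norm_le_one_iff_of_nonneg _ (star_mul_self_nonneg v)).mpr vle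
  obtain ⟨πa, pa⟩ := exists_pi a sa (range_of_order a apos ale)
  obtain ⟨πh, ph⟩ := exists_pi h sh (range_of_order h hpos hle)
  set g := πh sqf with hg
  set k := πa sqf with hk
  have sg : star g = g := by rw [hg, ← map_star, star_sqf]
  have sk : star k = k := by rw [hk, ← map_star, star_sqf]
  have gg : g * g = 1 - h := by rw [hg, ← map_mul, sqf_mul, map_sub, map_one, ph]
  have kk : k * k = 1 - a := by rw [hk, ← map_mul, sqf_mul, map_sub, map_one, pa]
  have gs : ∀ i, g * star (s i) = star (s i) * k := fun i =>
    pi_ext πh πa _ (by rw [ph, pa, hs]) sqf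
  have sg' : ∀ i, k * s i = s i * g := by
    intro i
    have := congrArg star (gs i)
    simpa [sg, sk] using this.symm
  have kv : k * v = 0 := by
    rw [← CStarRing.star_mul_self_eq_zero_iff]
    have : star (k * v) * (k * v) = star v * (k * k) * v := by simp [sk, mul_assoc]
    rw [this, kk, mul_assoc, sub_mul, av]
    simp
  have vk : star v * k = 0 := by
    have := congrArg star kv
    simpa [sk] using this
  set e : A := 1 - v * star v with he
  have se : star e = e := by simp [he]
  have epos : 0 ≤ e := sub_nonneg.mpr vle'
  let r : Fin (n + 1) → A := Fin.lastCases (motive := fun _ => A) g (fun i => star (s i) * v)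
  have r1 : ∀ i : Fin n, r i.castSucc = star (s i) * v := fun i => by simp [r]
  have r2 : r (Fin.last n) = g := by simp [r]
  set z : A := ∑ i, star (s i) * e * s i with hz
  have sz : star z = z := by simp [hz, star_sum, se, mul_assoc]
  have z1 : 1 - z = ∑ k, r k * star (r k) := by
    rw [Fin.sum_univ_castSucc]
    simp only [r1, r2, sg, gg, hz, he]
    simp [mul_sub, sub_mul, mul_assoc, Finset.sum_sub_distrib, hh]
    abel
  have zpos : 0 ≤ z := Finset.sum_nonneg fun i _ => star_left_conjugate_nonneg epos (s i)
  have zle : z ≤ 1 := by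
    rw [← sub_nonneg, z1]
    exact Finset.sum_nonneg fun i _ => mul_star_self_nonneg _
  obtain ⟨πz, pz⟩ := exists_pi z sz (range_of_order z zpos zle)
  have ve : star v * e = h * star v := by
    rw [he, mul_sub, ← mul_assoc, h₃, sub_mul]; simp
  have ke : k * e = k := by
    rw [he, mul_sub, ← mul_assoc, kv]; simp
  refine ⟨{ s := s,
            r := r,
            e := e,
            a := a,
            h := h,
            z := z,
            πz := πz,
            πa := πa,
            ss := ss,
            rr := ?_,
            hh := hh,
            zz := hz,
            z1 := z1,
            ea := ?_,
            se := se,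
            sa := sa,
            sh := sh,
            sz := sz,
            rl1 := ?_,
            rl2 := ?_,
            pz := pz,
            pa := pa }⟩
  · intro i j
    induction i using Fin.lastCases with
    | last =>
      induction j using Fin.lastCases with
      | last => simp [r2, sg, gg]
      | cast j =>
        rw [if_neg (Fin.castSucc_ne_last j).symm, r1, r2, sg, ← mul_assoc, gs, mul_assoc, kv,
          mul_zero]
    | cast i =>
      induction j using Fin.lastCases with
      | last =>
        rw [if_neg (Fin.castSucc_ne_last i), r1, r2, star_mul, star_star, mul_assoc, ← sg',
          ← mul_assoc, vk, zero_mul]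
      | cast j =>
        have : star (star (s i) * v) * (star (s j) * v) = star v * (s i * star (s j)) * v := by
          simp [mul_assoc]
        rw [r1, r1, this, ss]
        by_cases hij : i = j
        · simp [hij, va, h₃]
        · simp [hij]
  · rw [he, sub_mul, mul_sub, h₄, h₄', one_mul, mul_one]
  · intro m j l
    have : star (star (s m) * v) * (star (s j) * e * s l) =
        star v * (s m * star (s j)) * e * s l := by simp [mul_assoc]
    rw [r1, r1, this, ss]
    by_cases hij : m = j
    · simp [hij, va, ve, mul_assoc]
    · simp [hij]
  · intro j l
    rw [r2, sg, ← mul_assoc, ← mul_assoc, gs, mul_assoc _ k e, ke, mul_assoc, sg']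

theorem exists_cut : ∃ (κ₁ κ₀ m : Rg) (σ : C(unitInterval, unitInterval)),
    star κ₁ = κ₁ ∧ star κ₀ = κ₀ ∧ star m = m ∧
    idc * κ₁ + (1 - idc) * κ₀ + idc * (1 - idc) * m = 1 ∧ κ₁ * κ₀ = 0 ∧
    (∀ t, κ₁ t ≠ 0 → σ t = 0) ∧ (∀ t, κ₀ t ≠ 0 → σ t = 1) := by
  have hp : ∀ t : ℝ, 0 < max t (1 / 3) := fun t => lt_max_of_lt_right (by norm_num)
  let k1 : ℝ → ℝ := fun t => (1 - (1 - t) / max (1 - t) (1 / 3)) / max t (1 / 3)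
  let k0 : ℝ → ℝ := fun t => (1 - t / max t (1 / 3)) / max (1 - t) (1 / 3)
  let m : ℝ → ℝ := fun t => 1 / (max t (1 / 3) * max (1 - t) (1 / 3))
  have c1 : Continuous k1 := by
    refine Continuous.div (Continuous.sub continuous_const (Continuous.div (by fun_prop) (by fun_prop) fun t => (hp _).ne'))
      (by fun_prop) fun t => (hp _).ne'
  have c0 : Continuous k0 := by
    refine Continuous.div (Continuous.sub continuous_const (Continuous.div (by fun_prop) (by fun_prop) fun t => (hp _).ne'))
      (by fun_prop) fun t => (hp _).ne'
  have cm : Continuous m := by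
    refine Continuous.div (by fun_prop) (by fun_prop) fun t => (mul_pos (hp _) (hp _)).ne'
  have z1 : ∀ t : ℝ, t ≤ 2 / 3 → k1 t = 0 := by
    intro t ht
    simp only [k1]
    rw [max_eq_left (by linarith : (1 / 3 : ℝ) ≤ 1 - t), div_self (by linarith)]
    simp
  have z0 : ∀ t : ℝ, 1 / 3 ≤ t → k0 t = 0 := by
    intro t ht
    simp only [k0]
    rw [max_eq_left ht, div_self (by linarith)]
    simp
  let σ : C(unitInterval, unitInterval) :=
    ⟨fun t => Set.projIcc 0 1 zero_le_one (2 - 3 * (t : ℝ)), by fun_prop⟩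
  refine ⟨⟨fun t => (k1 t : ℂ), by fun_prop⟩, ⟨fun t => (k0 t : ℂ), by fun_prop⟩,
    ⟨fun t => (m t : ℂ), by fun_prop⟩, σ, ?_, ?_, ?_, ?_, ?_, ?_, ?_⟩
  · ext t; simp
  · ext t; simp
  · ext t; simp
  · ext t
    simp only [idc, ContinuousMap.mul_apply, ContinuousMap.coe_mk, ContinuousMap.sub_apply,
      ContinuousMap.one_apply, ContinuousMap.add_apply]
    have : (t : ℝ) * k1 t + (1 - t) * k0 t + t * (1 - t) * m t = 1 := by
      generalize (t : ℝ) = t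
      have hq : (max t (1 / 3) - t) * (max (1 - t) (1 / 3) - (1 - t)) = 0 := by
        rcases le_total (1 / 3) t with h | h
        · rw [max_eq_left h]; simp
        · rw [max_eq_left (by linarith : (1 / 3 : ℝ) ≤ 1 - t)]; simp
      simp only [k1, k0, m]
      have h1 := (hp t).ne'
      have h2 := (hp (1 - t)).ne'
      field_simp
      linear_combination (-1) * hq
    exact_mod_cast this
  · ext t
    simp only [ContinuousMap.mul_apply, ContinuousMap.coe_mk, ContinuousMap.zero_apply]
    rcases le_total (t : ℝ) (1 / 2) with h | h
    · rw [z1 _ (by linarith)]; simp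
    · rw [z0 _ (by linarith)]; simp
  · intro t ht
    have : 2 / 3 < (t : ℝ) := by
      by_contra hc
      exact ht (by simp [z1 _ (not_lt.mp hc)])
    exact Set.projIcc_of_le_left zero_le_one (by linarith)
  · intro t ht
    have : (t : ℝ) < 1 / 3 := by
      by_contra hc
      exact ht (by simp [z0 _ (not_lt.mp hc)])
    exact Set.projIcc_of_right_le zero_le_one (by linarith)

variable {n : ℕ}

/-- The flip as a permutation matrix. -/
def P (n : ℕ) : Matrix (Nn n) (Nn n) ℂ := Matrix.of fun α β => if sig n α = β then 1 else 0

theorem sig_eq_iff (α β : Nn n) : sig n α = β ↔ sig n β = α :=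
  ⟨fun h => by rw [← h, sig_sig], fun h => by rw [← h, sig_sig]⟩

theorem P_mul (M : Matrix (Nn n) (Nn n) ℂ) : P n * M = M.submatrix (sig n) id := by
  ext α β
  simp [P, Matrix.mul_apply]

theorem mul_P (M : Matrix (Nn n) (Nn n) ℂ) : M * P n = M.submatrix id (sig n) := by
  ext α β
  simp [P, Matrix.mul_apply]
  simp_rw [sig_eq_iff _ β]
  simp

theorem star_P : star (P n) = P n := by
  ext α β
  simp [P, Matrix.star_apply, sig_eq_iff α β]

theorem P_P : P n * P n = 1 := by
  rw [P_mul]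
  ext α β
  simp [P, sig_sig, Matrix.one_apply]

/-- The unitary path joining the flip to the identity. -/
def U (n : ℕ) (w : ℝ) : Matrix (Nn n) (Nn n) ℂ :=
  ((Real.sin (Real.pi / 2 * w) : ℝ) : ℂ) • 1 +
    (Complex.I * ((Real.cos (Real.pi / 2 * w) : ℝ) : ℂ)) • P n

theorem star_U (w : ℝ) : star (U n w) = ((Real.sin (Real.pi / 2 * w) : ℝ) : ℂ) • 1 -
    (Complex.I * ((Real.cos (Real.pi / 2 * w) : ℝ) : ℂ)) • P n := by
  rw [U, star_add, star_smul, star_smul, star_P, star_one]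
  simp only [star_mul', Complex.star_def, Complex.conj_I, Complex.conj_ofReal]
  rw [neg_mul, neg_smul, sub_eq_add_neg]

theorem U_unit (w : ℝ) : star (U n w) * U n w = 1 ∧ U n w * star (U n w) = 1 := by
  have h : ((Real.sin (Real.pi / 2 * w) : ℝ) : ℂ) * ((Real.sin (Real.pi / 2 * w) : ℝ) : ℂ) +
    ((Real.cos (Real.pi / 2 * w) : ℝ) : ℂ) * ((Real.cos (Real.pi / 2 * w) : ℝ) : ℂ) = 1 := by
    have := Real.sin_sq_add_cos_sq (Real.pi / 2 * w)
    rw [sq, sq] at this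
    exact_mod_cast this
  rw [star_U, U]
  generalize ((Real.sin (Real.pi / 2 * w) : ℝ) : ℂ) = p at *
  generalize ((Real.cos (Real.pi / 2 * w) : ℝ) : ℂ) = q at *
  have h' : p * p - (Complex.I * q) * (Complex.I * q) = 1 := by
    linear_combination h - q * q * Complex.I_mul_I
  generalize Complex.I * q = q' at *
  constructor
  · have : (p • 1 - q' • P n) * (p • 1 + q' • P n) = (p * p - q' * q') • 1 := by
      simp only [sub_mul, mul_add, smul_mul_smul_comm, P_P, one_mul, mul_one]
      rw [mul_comm q' p, sub_smul]; abel
    rw [this, h', one_smul]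
  · have : (p • 1 + q' • P n) * (p • 1 - q' • P n) = (p * p - q' * q') • 1 := by
      simp only [add_mul, mul_sub, smul_mul_smul_comm, P_P, one_mul, mul_one]
      rw [mul_comm q' p, sub_smul]; abel
    rw [this, h', one_smul]

theorem U_cont : Continuous (U n) := by
  unfold U
  fun_prop


/-- The conjugated matrix of functions attached to `F`. -/
def HH (σ : C(unitInterval, unitInterval))
    (F : C(unitInterval, Matrix (Nn n) (Nn n) ℂ)) : Matrix (Nn n) (Nn n) Rg :=
  Matrix.of fun α β => ⟨fun t => (U n (σ t) * F (σ t) * star (U n (σ t))) α β, by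
    have h1 : Continuous fun t : unitInterval => U n (σ t) :=
      U_cont.comp (continuous_subtype_val.comp σ.continuous)
    have h2 : Continuous fun t : unitInterval => F (σ t) := F.continuous.comp σ.continuous
    have h3 := (h1.mul h2).mul (continuous_star.comp h1)
    exact (continuous_apply β).comp ((continuous_apply α).comp h3)⟩

theorem HH_apply (σ : C(unitInterval, unitInterval))
    (F : C(unitInterval, Matrix (Nn n) (Nn n) ℂ)) (α β t) :
    HH σ F α β t = (U n (σ t) * F (σ t) * star (U n (σ t))) α β := rfl

theorem HH_one (σ : C(unitInterval, unitInterval)) : HH (n := n) σ 1 = 1 := by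
  ext1 α β
  ext t
  rw [HH_apply, ContinuousMap.one_apply, mul_one, (U_unit _).2]
  by_cases h : α = β
  · subst h; simp
  · simp [Matrix.one_apply_ne h]

theorem HH_add (σ : C(unitInterval, unitInterval))
    (F G : C(unitInterval, Matrix (Nn n) (Nn n) ℂ)) : HH σ (F + G) = HH σ F + HH σ G := by
  ext1 α β
  ext t
  rw [Matrix.add_apply, ContinuousMap.add_apply, HH_apply, HH_apply, HH_apply,
    ContinuousMap.add_apply, mul_add, add_mul, Matrix.add_apply]

theorem HH_smul (σ : C(unitInterval, unitInterval)) (c : ℂ)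
    (F : C(unitInterval, Matrix (Nn n) (Nn n) ℂ)) : HH σ (c • F) = c • HH σ F := by
  ext1 α β
  ext t
  rw [Matrix.smul_apply, ContinuousMap.smul_apply, HH_apply, HH_apply,
    ContinuousMap.smul_apply, mul_smul_comm, smul_mul_assoc, Matrix.smul_apply]

theorem HH_star (σ : C(unitInterval, unitInterval))
    (F : C(unitInterval, Matrix (Nn n) (Nn n) ℂ)) : HH σ (star F) = star (HH σ F) := by
  ext1 α β
  ext t
  rw [Matrix.star_apply, ContinuousMap.star_apply, HH_apply, HH_apply,
    ContinuousMap.star_apply, ← Matrix.star_apply, star_mul, star_mul, star_star, mul_assoc]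

theorem HH_mul (σ : C(unitInterval, unitInterval))
    (F G : C(unitInterval, Matrix (Nn n) (Nn n) ℂ)) : HH σ (F * G) = HH σ F * HH σ G := by
  ext1 α β
  ext t
  have h : U n (σ t) * (F * G) (σ t) * star (U n (σ t)) =
      (U n (σ t) * F (σ t) * star (U n (σ t))) * (U n (σ t) * G (σ t) * star (U n (σ t))) := by
    rw [ContinuousMap.mul_apply]
    calc U n (σ t) * (F (σ t) * G (σ t)) * star (U n (σ t))
        = U n (σ t) * F (σ t) * 1 * (G (σ t) * star (U n (σ t))) := by
          simp only [mul_assoc, mul_one, one_mul]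
      _ = _ := by
          rw [← (U_unit (n := n) (σ t)).1]
          simp only [mul_assoc]
  rw [HH_apply, h, Matrix.mul_apply, Matrix.mul_apply, ContinuousMap.sum_apply]
  rfl

theorem U_one : U n 1 = 1 := by
  simp [U]

theorem conj_U_zero (M : Matrix (Nn n) (Nn n) ℂ) :
    U n 0 * M * star (U n 0) = M.submatrix (sig n) (sig n) := by
  rw [star_U, U]
  simp only [mul_zero, Real.sin_zero, Real.cos_zero, Complex.ofReal_zero, Complex.ofReal_one,
    zero_smul, mul_one, zero_add, zero_sub]
  rw [mul_neg, smul_mul_assoc, smul_mul_smul_comm, Complex.I_mul_I, P_mul, mul_P]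
  simp

/-- The matrix at the left end point. -/
def xF (F : C(unitInterval, Matrix (Nn n) (Nn n) ℂ)) : Matrix (Fin n) (Fin n) ℂ :=
  Matrix.of fun i j => F 0 (i, 0) (j, 0)

/-- The matrix at the right end point. -/
def yF (hn : 1 ≤ n) (F : C(unitInterval, Matrix (Nn n) (Nn n) ℂ)) :
    Matrix (Fin (n + 1)) (Fin (n + 1)) ℂ :=
  Matrix.of fun i j => F 1 (⟨0, hn⟩, i) (⟨0, hn⟩, j)

theorem xF_eq {F : C(unitInterval, Matrix (Nn n) (Nn n) ℂ)} {x : Matrix (Fin n) (Fin n) ℂ}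
    (h : F 0 = x ⊗ₖ (1 : Matrix (Fin (n + 1)) (Fin (n + 1)) ℂ)) : xF F = x := by
  ext i j
  simp [xF, h]

theorem yF_eq (hn : 1 ≤ n) {F : C(unitInterval, Matrix (Nn n) (Nn n) ℂ)}
    {y : Matrix (Fin (n + 1)) (Fin (n + 1)) ℂ}
    (h : F 1 = (1 : Matrix (Fin n) (Fin n) ℂ) ⊗ₖ y) : yF hn F = y := by
  ext i j
  simp [yF, h]

theorem F_zero {F : C(unitInterval, Matrix (Nn n) (Nn n) ℂ)} (hF : F ∈ DimDrop n (n + 1)) :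
    F 0 = xF F ⊗ₖ (1 : Matrix (Fin (n + 1)) (Fin (n + 1)) ℂ) := by
  obtain ⟨⟨x, hx⟩, _⟩ := hF
  rw [xF_eq hx, hx]

theorem F_one (hn : 1 ≤ n) {F : C(unitInterval, Matrix (Nn n) (Nn n) ℂ)}
    (hF : F ∈ DimDrop n (n + 1)) :
    F 1 = (1 : Matrix (Fin n) (Fin n) ℂ) ⊗ₖ yF hn F := by
  obtain ⟨_, ⟨y, hy⟩⟩ := hF
  rw [yF_eq hn hy, hy]

theorem xF_mul {F G : C(unitInterval, Matrix (Nn n) (Nn n) ℂ)} (hF : F ∈ DimDrop n (n + 1))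
    (hG : G ∈ DimDrop n (n + 1)) : xF (F * G) = xF F * xF G := by
  apply xF_eq
  rw [ContinuousMap.mul_apply, F_zero hF, F_zero hG, ← Matrix.mul_kronecker_mul, one_mul]

theorem yF_mul (hn : 1 ≤ n) {F G : C(unitInterval, Matrix (Nn n) (Nn n) ℂ)}
    (hF : F ∈ DimDrop n (n + 1))
    (hG : G ∈ DimDrop n (n + 1)) : yF hn (F * G) = yF hn F * yF hn G := by
  apply yF_eq
  rw [ContinuousMap.mul_apply, F_one hn hF, F_one hn hG, ← Matrix.mul_kronecker_mul, one_mul]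

theorem sm_lam (κ : Rg) (σ : C(unitInterval, unitInterval)) (hσ : ∀ t, κ t ≠ 0 → σ t = 0)
    {F : C(unitInterval, Matrix (Nn n) (Nn n) ℂ)} (hF : F ∈ DimDrop n (n + 1)) :
    sm κ (HH σ F) = sm κ (cst (lam (xF F))) := by
  ext1 α β
  ext t
  rw [sm_apply, sm_apply, ContinuousMap.mul_apply, ContinuousMap.mul_apply]
  by_cases h : κ t = 0
  · rw [h, zero_mul, zero_mul]
  · rw [HH_apply, hσ t h, Set.Icc.coe_zero, conj_U_zero, F_zero hF]
    rfl

theorem sm_rho (hn : 1 ≤ n) (κ : Rg) (σ : C(unitInterval, unitInterval))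
    (hσ : ∀ t, κ t ≠ 0 → σ t = 1)
    {F : C(unitInterval, Matrix (Nn n) (Nn n) ℂ)} (hF : F ∈ DimDrop n (n + 1)) :
    sm κ (HH σ F) = sm κ (cst (rho (yF hn F))) := by
  ext1 α β
  ext t
  rw [sm_apply, sm_apply, ContinuousMap.mul_apply, ContinuousMap.mul_apply]
  by_cases h : κ t = 0
  · rw [h, zero_mul, zero_mul]
  · rw [HH_apply, hσ t h, Set.Icc.coe_one, U_one, star_one, one_mul, mul_one, F_one hn hF]
    rfl

theorem Sys.nonempty_hom {A : Type*} [CStarAlgebra A] (S : Sys A n) (hn : 1 ≤ n) :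
    Nonempty (DimDrop n (n + 1) →⋆ₐ[ℂ] A) := by
  obtain ⟨κ₁, κ₀, m, σ, s1, s0, sm', h1, h0, c1, c0⟩ := exists_cut
  let φ : C(unitInterval, Matrix (Nn n) (Nn n) ℂ) → A :=
    fun F => S.Psi κ₁ κ₀ m (xF F) (yF hn F) (HH σ F)
  have φ1 : φ 1 = 1 := by
    have e1 : xF (n := n) 1 = 1 := xF_eq (by simp)
    have e2 : yF hn 1 = 1 := yF_eq hn (by simp)
    simp only [φ, e1, e2, HH_one]
    exact S.Psi_one κ₁ κ₀ m h1
  have φadd : ∀ F G, φ (F + G) = φ F + φ G := by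
    intro F G
    simp only [φ, HH_add]
    rw [← S.Psi_add]
    rfl
  have φsmul : ∀ (c : ℂ) F, φ (c • F) = c • φ F := by
    intro c F
    simp only [φ, HH_smul]
    rw [← S.Psi_smul]
    rfl
  have φstar : ∀ F, φ (star F) = star (φ F) := by
    intro F
    simp only [φ, HH_star]
    rw [S.Psi_star κ₁ κ₀ m s1 s0 sm']
    rfl
  have φmul : ∀ F G, F ∈ DimDrop n (n + 1) → G ∈ DimDrop n (n + 1) → φ (F * G) = φ F * φ G := by
    intro F G hF hG
    simp only [φ]
    have hFG := mul_mem hF hG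
    have a1 := sm_lam κ₁ σ c1 hFG
    have a2 := sm_rho hn κ₀ σ c0 hFG
    rw [xF_mul hF hG, HH_mul] at a1
    rw [yF_mul hn hF hG, HH_mul] at a2
    rw [xF_mul hF hG, yF_mul hn hF hG, HH_mul]
    exact (S.Psi_mul κ₁ κ₀ m h1 h0 _ _ _ _ _ _ (sm_lam κ₁ σ c1 hF) (sm_lam κ₁ σ c1 hG)
      (sm_rho hn κ₀ σ c0 hF) (sm_rho hn κ₀ σ c0 hG) a1 a2).symm
  exact ⟨{ toFun := fun F => φ F.1,
           map_one' := φ1,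
           map_mul' := fun F G => φmul _ _ F.2 G.2,
           map_zero' := by
             have := φadd 0 0
             rw [add_zero] at this
             exact left_eq_add.mp this,
           map_add' := fun F G => φadd _ _,
           commutes' := fun c => by
             have := φsmul c 1
             rw [φ1, ← Algebra.algebraMap_eq_smul_one, ← Algebra.algebraMap_eq_smul_one] at this
             exact this,
           map_star' := fun F => φstar _ }⟩

end DD

variable {A : Type*}

/-- If a unital C*-algebra `A` contains elements `v, s 0, …, s (n-1)` satisfying the
dimension-drop relations, then there is a unital *-homomorphism `Z_{n,n+1} → A`. -/
theorem nonempty_dimDrop_hom_of_relations [CStarAlgebra A] (n : ℕ) (hn : 1 ≤ n)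
    (v : A) (s : Fin n → A)
    (h₁ : ∀ i, star (s ⟨0, hn⟩) * s ⟨0, hn⟩ = s i * star (s i))
    (h₂ : ∀ i j, i ≠ j → (star (s i) * s i) * (star (s j) * s j) = 0)
    (h₃ : star v * v = 1 - ∑ i, star (s i) * s i)
    (h₄ : v * star v * (star (s ⟨0, hn⟩) * s ⟨0, hn⟩) = v * star v) :
    Nonempty (DimDrop n (n + 1) →⋆ₐ[ℂ] A) := by
  obtain ⟨S⟩ := DD.exists_sys n hn v s h₁ h₂ h₃ h₄
  exact S.nonempty_hom hn
end
end

section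
/- Let A be a unital C*-algebra and let n ≥ 1 be a natural number. If there exists a unital *-homomorphism from the dimension-drop algebra Z_{n,n+1} into A, then there exist k ≥ 1 and a positive element d ∈ M_k(A) such that d^{⊕n} ≾ 1_A and 1_A ≾ d^{⊕(n+1)}. -/
open scoped Kronecker

noncomputable section

open Filter Topology

variable {A : Type*}

/-- A positive element of a matrix algebra over a C*-algebra: an element of the form `z* z`. -/
def IsPos [NonUnitalCStarAlgebra A] {ι : Type*} [Fintype ι] (a : Matrix ι ι A) : Prop :=
  ∃ z : Matrix ι ι A, a = z.conjTranspose * z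

/-- Cuntz subequivalence `a ≾ b` of elements of matrix algebras over a C*-algebra. -/
def CuntzLE [NonUnitalCStarAlgebra A] {ι κ : Type*} [Fintype ι] [Fintype κ]
    (a : Matrix ι ι A) (b : Matrix κ κ A) : Prop :=
  ∃ x : ℕ → Matrix ι κ A,
    Tendsto (fun k => x k * b * (x k).conjTranspose) atTop (nhds a)

/-- The `n`-fold direct sum `d ⊕ ⋯ ⊕ d` of a square matrix `d`. -/
def dpow [NonUnitalCStarAlgebra A] {ι : Type*} (d : Matrix ι ι A) (n : ℕ) :
    Matrix (ι × Fin n) (ι × Fin n) A :=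
  Matrix.blockDiagonal fun _ : Fin n => d

/-- An element of `A` viewed as a `1 × 1` matrix over `A`. -/
def m1 [NonUnitalCStarAlgebra A] (a : A) : Matrix (Fin 1) (Fin 1) A :=
  Matrix.of fun _ _ => a

namespace DD

variable {n : ℕ}

abbrev Idx (n : ℕ) := Fin n × Fin (n + 1)
abbrev MM (n : ℕ) := Matrix (Idx n) (Idx n) ℂ

/-- The partial flip on index pairs. -/
def sg (a : Idx n) : Idx n :=
  Fin.lastCases (motive := fun _ => Idx n) (a.1, Fin.last n) (fun k => (k, a.1.castSucc)) a.2

@[simp] lemma sg_last (i : Fin n) : sg (i, Fin.last n) = (i, Fin.last n) := by simp [sg]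
@[simp] lemma sg_cast (i k : Fin n) : sg (i, k.castSucc) = (k, i.castSucc) := by simp [sg]

lemma sg_sg (a : Idx n) : sg (sg a) = a := by
  obtain ⟨i, k⟩ := a
  induction k using Fin.lastCases <;> simp

/-- The flip matrix. -/
def F (n : ℕ) : MM n := Matrix.of fun a b => if sg a = b then 1 else 0

lemma F_mul_apply (M : MM n) (a b : Idx n) : (F n * M) a b = M (sg a) b := by
  simp [F, Matrix.mul_apply]

lemma sg_eq_iff (a b : Idx n) : sg a = b ↔ a = sg b :=
  ⟨fun h => by rw [← h, sg_sg], fun h => by rw [h, sg_sg]⟩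

lemma mul_F_apply (M : MM n) (a b : Idx n) : (M * F n) a b = M a (sg b) := by
  simp [F, Matrix.mul_apply, sg_eq_iff]

lemma F_F : F n * F n = 1 := by
  ext a b
  rw [F_mul_apply]
  simp [F, sg_sg, Matrix.one_apply]

lemma star_F : star (F n) = F n := by
  ext a b
  rw [Matrix.star_apply]
  have h : sg b = a ↔ sg a = b := by rw [sg_eq_iff, eq_comm]
  simp only [F, Matrix.of_apply, h]
  split_ifs <;> simp

def gv (g : ℂ) : Fin (n + 1) → ℂ := Fin.lastCases g (fun _ => 1)

@[simp] lemma gv_last (g : ℂ) : gv g (Fin.last n) = g := by simp [gv]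
@[simp] lemma gv_cast (g : ℂ) (k : Fin n) : gv g k.castSucc = 1 := by simp [gv]

def E (i j : Fin n) (g : ℂ) : MM n :=
  Matrix.single i j (1 : ℂ) ⊗ₖ Matrix.diagonal (gv g)

lemma gv_mul (g g' : ℂ) (k : Fin (n + 1)) : gv g k * gv g' k = gv (g * g') k := by
  induction k using Fin.lastCases <;> simp

lemma E_mul_same (i j l : Fin n) (g g' : ℂ) : E i j g * E j l g' = E i l (g * g') := by
  simp [E, ← Matrix.mul_kronecker_mul, gv_mul]

lemma E_mul_ne (i j k l : Fin n) (h : j ≠ k) (g g' : ℂ) : E i j g * E k l g' = 0 := by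
  simp [E, ← Matrix.mul_kronecker_mul, h]

lemma E_star (i j : Fin n) (g : ℝ) : star (E i j (g : ℂ)) = E j i (g : ℂ) := by
  rw [E, star_kronecker, E]
  congr 1
  · simp [Matrix.star_eq_conjTranspose]
  · rw [Matrix.star_eq_conjTranspose, Matrix.diagonal_conjTranspose]
    congr 1
    ext k
    induction k using Fin.lastCases <;> simp

lemma E_one (i j : Fin n) : E i j 1 = Matrix.single i j (1 : ℂ) ⊗ₖ 1 := by
  rw [E]; congr 1
  rw [← Matrix.diagonal_one]; congr 1
  ext k
  induction k using Fin.lastCases <;> simp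

lemma F_E_F (i j : Fin n) : F n * E i j 0 * F n =
    1 ⊗ₖ Matrix.single i.castSucc j.castSucc (1 : ℂ) := by
  ext ⟨a, b⟩ ⟨c, d⟩
  rw [mul_F_apply, F_mul_apply]
  induction b using Fin.lastCases <;> induction d using Fin.lastCases <;>
    simp [E, Matrix.kroneckerMap_apply, Matrix.single_apply, Matrix.diagonal_apply,
      Matrix.one_apply, Fin.castSucc_ne_last, (Fin.castSucc_ne_last _).symm] <;> grind

def Q (n : ℕ) : MM n := 1 ⊗ₖ Matrix.single (Fin.last n) (Fin.last n) (1 : ℂ)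

lemma F_Q : F n * Q n = Q n := by
  ext ⟨a, b⟩ ⟨c, d⟩
  rw [F_mul_apply]
  induction b using Fin.lastCases <;> induction d using Fin.lastCases <;>
    simp [Q, Matrix.kroneckerMap_apply, Matrix.single_apply,
      Matrix.one_apply, Fin.castSucc_ne_last, (Fin.castSucc_ne_last _).symm]

lemma Q_F : Q n * F n = Q n := by
  have := congrArg star (F_Q (n := n))
  rw [star_mul, star_F] at this
  have h : star (Q n) = Q n := by
    rw [Q, star_kronecker]; simp [Matrix.star_eq_conjTranspose]
  rwa [h] at this

lemma sum_E (g s : ℂ) (h : g + s = 1) : ∑ j : Fin n, E j j g + s • Q n = 1 := by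
  ext ⟨a, b⟩ ⟨c, d⟩
  rw [Matrix.add_apply, Matrix.sum_apply]
  induction b using Fin.lastCases <;> induction d using Fin.lastCases <;>
    simp [E, Q, Matrix.kroneckerMap_apply, Matrix.single_apply, Matrix.diagonal_apply,
      Matrix.one_apply, Fin.castSucc_ne_last, (Fin.castSucc_ne_last _).symm, ite_and] <;> grind

def V (i₀ : Fin n) : MM n :=
  Matrix.of fun a b => if a.2 = Fin.last n ∧ b = (i₀, a.1.castSucc) then 1 else 0

lemma V_mul_apply (i₀ : Fin n) (M : MM n) (a b : Idx n) :
    (V i₀ * M) a b = if a.2 = Fin.last n then M (i₀, a.1.castSucc) b else 0 := by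
  simp [V, Matrix.mul_apply, ite_and]

lemma V_F (i₀ : Fin n) : V i₀ * F n = 1 ⊗ₖ Matrix.single (Fin.last n) i₀.castSucc (1 : ℂ) := by
  ext ⟨a, b⟩ ⟨c, d⟩
  rw [V_mul_apply]
  simp [F, Matrix.kroneckerMap_apply, Matrix.single_apply, Matrix.one_apply]
  grind

lemma V_E_V (i₀ : Fin n) (g : ℂ) : V i₀ * E i₀ i₀ g * star (V i₀) = Q n := by
  ext ⟨a, b⟩ ⟨c, d⟩
  rw [mul_assoc, V_mul_apply]
  simp [Matrix.mul_apply, Matrix.star_apply, V, E, Q, Matrix.kroneckerMap_apply,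
    Matrix.single_apply, Matrix.one_apply, Matrix.diagonal_apply, ite_and, apply_ite]
  grind

/-- The path of unitaries. -/
def W (n : ℕ) (t : ℝ) : MM n :=
  (Real.cos (Real.pi / 2 * t) : ℂ) • (1 : MM n) +
    (Complex.I * (Real.sin (Real.pi / 2 * t) : ℂ)) • F n

lemma star_W (t : ℝ) : star (W n t) = (Real.cos (Real.pi / 2 * t) : ℂ) • (1 : MM n) -
    (Complex.I * (Real.sin (Real.pi / 2 * t) : ℂ)) • F n := by
  simp only [W, star_add, star_smul, star_F, star_one]
  simp [Complex.conj_ofReal, -Complex.ofReal_cos, -Complex.ofReal_sin, sub_eq_add_neg]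

lemma cs (t : ℝ) : (Real.cos t : ℂ) * Real.cos t + Real.sin t * Real.sin t = 1 := by
  have := Real.cos_sq_add_sin_sq t
  exact_mod_cast (by nlinarith : Real.cos t * Real.cos t + Real.sin t * Real.sin t = 1)

lemma W_star (t : ℝ) : W n t * star (W n t) = 1 := by
  rw [star_W, W]
  simp only [add_mul, mul_sub, smul_mul_smul_comm, one_mul, mul_one, F_F]
  have h := cs (Real.pi / 2 * t)
  generalize (Real.cos (Real.pi / 2 * t) : ℂ) = c at *
  generalize (Real.sin (Real.pi / 2 * t) : ℂ) = s at *
  have e : Complex.I * s * (Complex.I * s) = - (s * s) := by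
    linear_combination (s * s) * Complex.I_mul_I
  rw [e, mul_comm c (Complex.I * s)]
  have e2 : (1 : MM n) = (c * c + s * s) • (1 : MM n) := by rw [h, one_smul]
  conv_rhs => rw [e2]
  module

lemma star_W_W (t : ℝ) : star (W n t) * W n t = 1 := mul_eq_one_comm.mp (W_star t)

lemma W_Q (t : ℝ) : W n t * Q n * star (W n t) = Q n := by
  have h : W n t * Q n = Q n * W n t := by
    simp [W, add_mul, mul_add, F_Q, Q_F]
  rw [h, mul_assoc, W_star, mul_one]

lemma W_zero : W n 0 = 1 := by simp [W]
lemma W_one : W n 1 = Complex.I • F n := by simp [W]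
lemma star_W_one : star (W n 1) = -(Complex.I • F n) := by
  rw [star_W]; simp

lemma W_cont : Continuous (W n) := by unfold W; fun_prop

def Phi (i j : Fin n) (t : ℝ) : MM n := W n t * E i j ((1 - t : ℝ) : ℂ) * star (W n t)

def sq (t : ℝ) : ℝ := Real.sqrt (1 - (1 - t) ^ 4)

def Vp (i₀ : Fin n) (t : ℝ) : MM n := ((sq t : ℝ) : ℂ) • (V i₀ * star (W n t))

lemma E_cont (i j : Fin n) : Continuous (fun t : ℝ => E i j ((1 - t : ℝ) : ℂ)) := by
  refine continuous_matrix fun ⟨a, b⟩ ⟨c, d⟩ => ?_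
  simp only [E, Matrix.kroneckerMap_apply, Matrix.diagonal_apply]
  refine continuous_const.mul ?_
  split_ifs
  · induction b using Fin.lastCases <;> simp <;> fun_prop
  · fun_prop

lemma Phi_cont (i j : Fin n) : Continuous (Phi i j) :=
  (W_cont.mul (E_cont i j)).mul W_cont.star

lemma Vp_cont (i₀ : Fin n) : Continuous (Vp i₀) := by
  have h : Continuous sq := by unfold sq; fun_prop
  exact (Complex.continuous_ofReal.comp h).smul (continuous_const.mul W_cont.star)

lemma Phi_conj (i j k l : Fin n) (t : ℝ) : Phi i j t * Phi k l t =
    W n t * (E i j ((1 - t : ℝ) : ℂ) * E k l ((1 - t : ℝ) : ℂ)) * star (W n t) := by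
  have := star_W_W (n := n) t
  unfold Phi
  generalize E i j _ = X
  generalize E k l _ = Y
  calc _ = W n t * X * (star (W n t) * W n t) * Y * star (W n t) := by noncomm_ring
    _ = _ := by rw [this]; noncomm_ring

lemma Phi_star (i j : Fin n) (t : ℝ) : star (Phi i j t) = Phi j i t := by
  simp only [Phi, star_mul, star_star, E_star, mul_assoc]

lemma Phi_mul_ne (i j k l : Fin n) (h : j ≠ k) (t : ℝ) : Phi i j t * Phi k l t = 0 := by
  rw [Phi_conj, E_mul_ne _ _ _ _ h]; simp

lemma Phi_mul_same (i j k l : Fin n) (t : ℝ) :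
    Phi i j t * Phi j l t = Phi i k t * Phi k l t := by
  rw [Phi_conj, Phi_conj, E_mul_same, E_mul_same]

lemma key (i₀ : Fin n) (t : unitInterval) :
    ∑ j : Fin n, Phi j i₀ t * (Phi i₀ i₀ t * Phi i₀ i₀ t) * Phi i₀ j t +
      Vp i₀ t * (Phi i₀ i₀ t * Phi i₀ i₀ t) * star (Vp i₀ t) = 1 := by
  obtain ⟨t, h0, h1⟩ := t
  simp only
  have hs : sq t * sq t = 1 - (1 - t) ^ 4 := by
    apply Real.mul_self_sqrt
    have : (1 - t) ^ 4 ≤ 1 := pow_le_one₀ (by linarith) (by linarith)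
    linarith
  have hW := star_W_W (n := n) t
  have e1 : Vp i₀ t * (Phi i₀ i₀ t * Phi i₀ i₀ t) * star (Vp i₀ t)
      = ((1 - (1 - t) ^ 4 : ℝ) : ℂ) • Q n := by
    rw [Phi_conj, E_mul_same, Vp, star_smul, star_mul, star_star]
    simp only [smul_mul_assoc, mul_smul_comm, smul_smul]
    have : V i₀ * star (W n t) * (W n t * E i₀ i₀ (((1 - t : ℝ) : ℂ) * ((1 - t : ℝ) : ℂ))
        * star (W n t)) * (W n t * star (V i₀)) = Q n := by
      rw [← V_E_V i₀ (((1 - t : ℝ) : ℂ) * ((1 - t : ℝ) : ℂ))]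
      generalize E i₀ i₀ _ = X
      calc _ = V i₀ * (star (W n t) * W n t) * X * (star (W n t) * W n t) * star (V i₀) := by
            noncomm_ring
        _ = _ := by rw [hW]; noncomm_ring
    rw [this, ← hs]
    simp
  have e2 : ∀ j : Fin n, Phi j i₀ t * (Phi i₀ i₀ t * Phi i₀ i₀ t) * Phi i₀ j t =
      W n t * E j j (((1 - t) ^ 4 : ℝ) : ℂ) * star (W n t) := by
    intro j
    rw [mul_assoc, mul_assoc, Phi_conj i₀ i₀ i₀ j, E_mul_same]
    have e3 : ∀ (i j k : Fin n) (g g' : ℂ), (W n t * E i j g * star (W n t)) *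
      (W n t * E j k g' * star (W n t)) = W n t * E i k (g * g') * star (W n t) := by
      intro i j k g g'
      rw [← E_mul_same i j k]
      generalize E i j _ = X
      generalize E j k _ = Y
      calc _ = W n t * X * (star (W n t) * W n t) * Y * star (W n t) := by noncomm_ring
        _ = _ := by rw [hW]; noncomm_ring
    rw [Phi, Phi, e3, e3]
    congr 3
    push_cast; ring
  simp only [e2]
  rw [e1, ← Finset.sum_mul, ← Finset.mul_sum]
  conv_lhs => rw [← W_Q t]
  rw [← smul_mul_assoc, ← mul_smul_comm, ← add_mul, ← mul_add, sum_E, mul_one, W_star]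
  push_cast; ring

def cPhi (i j : Fin n) : DimDrop n (n + 1) :=
  ⟨⟨fun t => Phi i j t, (Phi_cont i j).comp continuous_subtype_val⟩, by
    refine ⟨⟨Matrix.single i j 1, ?_⟩, ⟨Matrix.single i.castSucc j.castSucc 1, ?_⟩⟩
    · simp [Phi, W_zero, E_one]
    · simp only [ContinuousMap.coe_mk, Phi, Set.Icc.coe_one, W_one, star_W_one, ← F_E_F]
      simp [smul_smul, star_F]⟩

def cV (i₀ : Fin n) : DimDrop n (n + 1) :=
  ⟨⟨fun t => Vp i₀ t, (Vp_cont i₀).comp continuous_subtype_val⟩, by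
    refine ⟨⟨0, ?_⟩, ⟨-(Complex.I • Matrix.single (Fin.last n) i₀.castSucc 1), ?_⟩⟩
    · simp [Vp, sq]
    · simp only [ContinuousMap.coe_mk, Vp, Set.Icc.coe_one, star_W_one]
      simp only [mul_neg, mul_smul_comm, V_F, sq, ← neg_smul, Matrix.kronecker_smul]
      simp⟩

lemma cPhi_star (i j : Fin n) : star (cPhi i j) = cPhi j i := by
  apply Subtype.ext; ext1 t; exact Phi_star i j t

lemma cPhi_mul_ne (i j k l : Fin n) (h : j ≠ k) : cPhi i j * cPhi k l = 0 := by
  apply Subtype.ext; ext1 t; exact Phi_mul_ne i j k l h t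

lemma cPhi_mul_same (i j k l : Fin n) : cPhi i j * cPhi j l = cPhi i k * cPhi k l := by
  apply Subtype.ext; ext1 t; exact Phi_mul_same i j k l t

lemma ckey (i₀ : Fin n) :
    ∑ j : Fin n, cPhi j i₀ * (cPhi i₀ i₀ * cPhi i₀ i₀) * cPhi i₀ j +
      cV i₀ * (cPhi i₀ i₀ * cPhi i₀ i₀) * star (cV i₀) = 1 := by
  apply Subtype.ext; ext1 t
  have := key i₀ t
  simp only [AddMemClass.coe_add, AddSubmonoidClass.coe_finset_sum, MulMemClass.coe_mul,
    StarMemClass.coe_star, OneMemClass.coe_one, ContinuousMap.add_apply, ContinuousMap.sum_apply,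
    ContinuousMap.mul_apply, ContinuousMap.star_apply, ContinuousMap.one_apply]
  exact this

end DD

/-- If there is a unital *-homomorphism `Z_{n,n+1} → A`, then there is a positive matrix `d`
over `A` with `d^{⊕n} ≾ 1` and `1 ≾ d^{⊕(n+1)}`. -/
theorem exists_divisibility_of_dimDrop_hom [CStarAlgebra A] (n : ℕ) (hn : 1 ≤ n)
    (h : Nonempty (DimDrop n (n + 1) →⋆ₐ[ℂ] A)) :
    ∃ k : ℕ, 1 ≤ k ∧ ∃ d : Matrix (Fin k) (Fin k) A, IsPos d ∧
      CuntzLE (dpow d n) (m1 (1 : A)) ∧ CuntzLE (m1 (1 : A)) (dpow d (n + 1)) := by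
  obtain ⟨ψ⟩ := h
  let i₀ : Fin n := ⟨0, hn⟩
  let p : Fin n → Fin n → A := fun i j => ψ (DD.cPhi i j)
  let v : A := ψ (DD.cV i₀)
  have hstar : ∀ i j, star (p i j) = p j i := fun i j => by
    simp only [p, ← map_star, DD.cPhi_star]
  have hne : ∀ i j k l, j ≠ k → p i j * p k l = 0 := fun i j k l h => by
    simp only [p, ← map_mul, DD.cPhi_mul_ne i j k l h, map_zero]
  have hsame : ∀ i j k l, p i j * p j l = p i k * p k l := fun i j k l => by
    simp only [p, ← map_mul, DD.cPhi_mul_same i j k l]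
  have hkey : ∑ j, p j i₀ * (p i₀ i₀ * p i₀ i₀) * p i₀ j + v * (p i₀ i₀ * p i₀ i₀) * star v = 1 := by
    have := congrArg ψ (DD.ckey i₀)
    simpa only [map_add, map_sum, map_mul, map_star, map_one] using this
  refine ⟨1, le_rfl, m1 (p i₀ i₀ * p i₀ i₀), ⟨m1 (p i₀ i₀), ?_⟩, ⟨fun _ => Matrix.of fun a _ => p i₀ a.2, ?_⟩,
    ⟨fun _ => Matrix.of fun _ a => Fin.lastCases (motive := fun _ => A) v (fun j => p j i₀) a.2, ?_⟩⟩
  · ext a b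
    simp [m1, Matrix.mul_apply, hstar]
  · refine tendsto_const_nhds.congr fun _ => ?_
    ext ⟨a, i⟩ ⟨b, j⟩
    simp only [m1, dpow, Matrix.mul_apply, Matrix.blockDiagonal_apply, Matrix.of_apply,
      Matrix.conjTranspose_apply, hstar, Fin.sum_univ_one, mul_one]
    split_ifs with h
    · subst h; exact hsame _ _ _ _
    · exact (hne _ _ _ _ h).symm
  · refine tendsto_const_nhds.congr fun _ => ?_
    ext a b
    simp only [m1, dpow, Matrix.mul_apply, Matrix.blockDiagonal_apply, Matrix.of_apply,
      Matrix.conjTranspose_apply, Fintype.sum_prod_type, Fin.sum_univ_one]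
    simp only [mul_ite, mul_zero, Finset.sum_ite_eq', Finset.mem_univ, if_true]
    rw [Fin.sum_univ_castSucc]
    simp only [Fin.lastCases_castSucc, Fin.lastCases_last, hstar]
    exact hkey.symm
end
end

section
/- Let A be a unital C*-algebra whose dimension as a complex vector space is at least 2, and let τ be a faithful tracial state on A. Then there exist a real number λ with 0 < λ < 1 and positive elements e, f ∈ A with e f = 0, d_τ(e) = λ, and d_τ(f) = 1 − λ. -/
open scoped ComplexOrder

noncomputable section

variable {A : Type*}

/-- `f_ε(a)`, where `f_ε(t) = min(t/ε, 1)`, via the continuous functional calculus. -/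
def fEps [CStarAlgebra A] (ε : ℝ) (a : A) : A :=
  cfc (fun t : ℝ => (t / ε) ⊓ 1) a

/-- The dimension function `d_τ(a) = sup_{ε > 0} τ(f_ε(a))` induced by a tracial state `τ`. -/
def dTau [CStarAlgebra A] (τ : A →ₗ[ℂ] ℂ) (a : A) : ℝ :=
  sSup {x : ℝ | ∃ ε : ℝ, 0 < ε ∧ x = (τ (fEps ε a)).re}

def phi [CStarAlgebra A] (τ : A →ₗ[ℂ] ℂ) (a : A) (h : ℝ → ℝ) : ℝ := (τ (cfc h a)).re

section aux
variable [CStarAlgebra A] [PartialOrder A] [StarOrderedRing A]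

lemma tau_nonneg (τ : A →ₗ[ℂ] ℂ) (hτ_pos : ∀ a : A, 0 ≤ τ (star a * a)) (x : A) (hx : 0 ≤ x) :
    0 ≤ τ x := by
  obtain ⟨y, rfl⟩ := CStarAlgebra.nonneg_iff_eq_star_mul_self.mp hx
  exact hτ_pos y

lemma phi_mono (τ : A →ₗ[ℂ] ℂ) (hτ_pos : ∀ a : A, 0 ≤ τ (star a * a)) (a : A)
    (h k : ℝ → ℝ) (hh : Continuous h) (hk : Continuous k) (hle : ∀ t, h t ≤ k t) :
    phi τ a h ≤ phi τ a k := by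
  have h1 : cfc h a ≤ cfc k a := cfc_mono (fun t _ => hle t) hh.continuousOn hk.continuousOn
  have h2 := tau_nonneg τ hτ_pos _ (sub_nonneg.mpr h1)
  rw [map_sub] at h2
  have := (Complex.le_def.mp h2).1
  simp only [Complex.zero_re, Complex.sub_re] at this
  unfold phi
  linarith

lemma phi_add (τ : A →ₗ[ℂ] ℂ) (a : A)
    (h k : ℝ → ℝ) (hh : Continuous h) (hk : Continuous k) :
    phi τ a (fun t => h t + k t) = phi τ a h + phi τ a k := by
  unfold phi
  rw [cfc_add a h k hh.continuousOn hk.continuousOn, map_add, Complex.add_re]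

lemma phi_one (τ : A →ₗ[ℂ] ℂ) (hτ_one : τ 1 = 1) (a : A) (ha : IsSelfAdjoint a) :
    phi τ a (fun _ => 1) = 1 := by
  unfold phi
  rw [cfc_const_one ℝ a, hτ_one, Complex.one_re]

lemma phi_pos (τ : A →ₗ[ℂ] ℂ) (hτ_pos : ∀ a : A, 0 ≤ τ (star a * a))
    (hτ_faithful : ∀ a : A, τ (star a * a) = 0 → a = 0) (a : A) (ha : IsSelfAdjoint a)
    (h : ℝ → ℝ) (hh : Continuous h) (h0 : ∀ t, 0 ≤ h t) (s : ℝ) (hs : s ∈ spectrum ℝ a)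
    (hpos : 0 < h s) : 0 < phi τ a h := by
  have hx : 0 ≤ cfc h a := cfc_nonneg (fun t _ => h0 t)
  have h1 := tau_nonneg τ hτ_pos _ hx
  have h2 := Complex.le_def.mp h1
  refine lt_of_le_of_ne h2.1 fun h3 => ?_
  have h4 : τ (cfc h a) = 0 := Complex.ext h3.symm h2.2.symm
  have h5 : cfc h a = 0 := by
    obtain ⟨y, hy⟩ := CStarAlgebra.nonneg_iff_eq_star_mul_self.mp hx
    rw [hy] at h4
    rw [hy, hτ_faithful y h4, mul_zero]
  have h6 : h s ∈ spectrum ℝ (cfc h a) := by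
    rw [cfc_map_spectrum h a ha hh.continuousOn]
    exact ⟨s, hs, rfl⟩
  rw [h5] at h6
  have : Nontrivial A := by
    by_contra hn
    rw [not_nontrivial_iff_subsingleton] at hn
    rw [spectrum.of_subsingleton] at hs
    exact hs
  rw [spectrum.zero_eq] at h6
  exact hpos.ne' h6

lemma fEps_cfc (a : A) (ha : IsSelfAdjoint a) (ε : ℝ) (h : ℝ → ℝ) (hh : Continuous h) :
    fEps ε (cfc h a) = cfc (fun t => (h t / ε) ⊓ 1) a := by
  unfold fEps
  rw [← cfc_comp' (fun t : ℝ => (t / ε) ⊓ 1) h a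
    (by fun_prop) hh.continuousOn ha]

lemma dTau_bdd (τ : A →ₗ[ℂ] ℂ) (hτ_pos : ∀ a : A, 0 ≤ τ (star a * a)) (hτ_one : τ 1 = 1)
    (a : A) (ha : IsSelfAdjoint a) (h : ℝ → ℝ) (hh : Continuous h) :
    BddAbove {x : ℝ | ∃ ε : ℝ, 0 < ε ∧ x = (τ (fEps ε (cfc h a))).re} := by
  refine ⟨1, ?_⟩
  rintro x ⟨ε, hε, rfl⟩
  rw [fEps_cfc a ha ε h hh]
  refine le_trans ?_ (phi_one τ hτ_one a ha).le
  exact phi_mono τ hτ_pos a _ _ (by fun_prop) (by fun_prop) (fun t => inf_le_right)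

lemma le_dTau (τ : A →ₗ[ℂ] ℂ) (hτ_pos : ∀ a : A, 0 ≤ τ (star a * a)) (hτ_one : τ 1 = 1)
    (a : A) (ha : IsSelfAdjoint a) (h : ℝ → ℝ) (hh : Continuous h) (ε : ℝ) (hε : 0 < ε) :
    phi τ a (fun t => (h t / ε) ⊓ 1) ≤ dTau τ (cfc h a) :=
  le_csSup (dTau_bdd τ hτ_pos hτ_one a ha h hh) ⟨ε, hε, by rw [fEps_cfc a ha ε h hh]; rfl⟩

lemma dTau_le (τ : A →ₗ[ℂ] ℂ)
    (a : A) (ha : IsSelfAdjoint a) (h : ℝ → ℝ) (hh : Continuous h) (B : ℝ)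
    (hB : ∀ ε > 0, phi τ a (fun t => (h t / ε) ⊓ 1) ≤ B) : dTau τ (cfc h a) ≤ B := by
  refine csSup_le ⟨_, 1, one_pos, rfl⟩ ?_
  rintro x ⟨ε, hε, rfl⟩
  rw [fEps_cfc a ha ε h hh]
  exact hB ε hε

lemma exists_sa (hdim : 2 ≤ Module.rank ℂ A) :
    ∃ a : A, IsSelfAdjoint a ∧ ∃ s ∈ spectrum ℝ a, ∃ t ∈ spectrum ℝ a, s < t := by
  by_contra! hcon
  have hsc : ∀ a : A, IsSelfAdjoint a → ∃ r : ℝ, a = algebraMap ℝ A r := by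
    intro a ha
    by_cases hne : (spectrum ℝ a).Nonempty
    · obtain ⟨r, hr⟩ := hne
      refine ⟨r, ?_⟩
      rw [← cfc_const r a, ← cfc_id ℝ a]
      conv_rhs => rw [cfc_id ℝ a]
      exact cfc_congr fun t ht => le_antisymm (hcon a ha r hr t ht) (hcon a ha t ht r hr)
    · refine ⟨0, ?_⟩
      rw [← cfc_const (0 : ℝ) a, ← cfc_id ℝ a]
      conv_rhs => rw [cfc_id ℝ a]
      exact cfc_congr fun t ht => (hne ⟨t, ht⟩).elim
  have : Module.rank ℂ A ≤ 1 := by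
    rw [rank_le_one_iff]
    refine ⟨1, fun v => ?_⟩
    obtain ⟨r, hr⟩ := hsc (realPart v : A) (realPart v).2
    obtain ⟨i, hi⟩ := hsc (imaginaryPart v : A) (imaginaryPart v).2
    refine ⟨r + Complex.I * i, ?_⟩
    conv_rhs => rw [← realPart_add_I_smul_imaginaryPart v, hr, hi]
    simp [Algebra.algebraMap_eq_smul_one, add_smul, mul_smul]
  have h2 := hdim.trans this
  norm_num at h2

end aux

theorem exists_orthogonal_splitting_of_faithful_trace [CStarAlgebra A]
    [PartialOrder A] [StarOrderedRing A] (hdim : 2 ≤ Module.rank ℂ A)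
    (τ : A →ₗ[ℂ] ℂ)
    (hτ_pos : ∀ a : A, 0 ≤ τ (star a * a))
    (hτ_one : τ 1 = 1)
    (hτ_tr : ∀ a b : A, τ (a * b) = τ (b * a))
    (hτ_faithful : ∀ a : A, τ (star a * a) = 0 → a = 0) :
    ∃ lam : ℝ, 0 < lam ∧ lam < 1 ∧ ∃ e f : A,
      0 ≤ e ∧ 0 ≤ f ∧ e * f = 0 ∧ dTau τ e = lam ∧ dTau τ f = 1 - lam := by
  obtain ⟨a, ha, s, hs, t, ht, hst⟩ := exists_sa hdim
  let p : ℝ → ℝ → ℝ := fun c x => max (x - c) 0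
  let m : ℝ → ℝ → ℝ := fun c x => max (c - x) 0
  have hp : ∀ c, Continuous (p c) := fun c => by fun_prop
  have hm : ∀ c, Continuous (m c) := fun c => by fun_prop
  let g : ℝ → ℝ := fun c => dTau τ (cfc (p c) a)
  have hg : Antitone g := by
    intro c d hcd
    refine dTau_le τ a ha _ (hp d) _ fun ε hε => ?_
    refine le_trans ?_ (le_dTau τ hτ_pos hτ_one a ha _ (hp c) ε hε)
    refine phi_mono τ hτ_pos a _ _ (by fun_prop) (by fun_prop) fun x => ?_
    have : p d x ≤ p c x := max_le_max (by linarith) le_rfl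
    gcongr
  obtain ⟨c, hc, hcs, hct⟩ : ∃ c, ContinuousAt g c ∧ s < c ∧ c < t := by
    have h1 := (hg.countable_not_continuousAt).dense_compl ℝ
    obtain ⟨c, hc, h2⟩ := h1.exists_between hst
    exact ⟨c, by simpa using hc, h2.1, h2.2⟩
  have hlow : ∀ c' < c, 1 ≤ g c' + dTau τ (cfc (m c) a) := by
    intro c' hc'
    have hε : 0 < (c - c') / 2 := by linarith
    have h1 := le_dTau τ hτ_pos hτ_one a ha _ (hp c') _ hε
    have h2 := le_dTau τ hτ_pos hτ_one a ha _ (hm c) _ hε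
    refine le_trans ?_ (add_le_add h1 h2)
    rw [← phi_add τ a _ _ (by fun_prop) (by fun_prop)]
    refine le_trans (phi_one τ hτ_one a ha).ge ?_
    refine phi_mono τ hτ_pos a _ _ (by fun_prop) (by fun_prop) fun x => ?_
    have n1 : 0 ≤ (p c' x / ((c - c') / 2)) ⊓ 1 :=
      le_inf (div_nonneg (le_max_right _ _) hε.le) zero_le_one
    have n2 : 0 ≤ (m c x / ((c - c') / 2)) ⊓ 1 :=
      le_inf (div_nonneg (le_max_right _ _) hε.le) zero_le_one
    rcases le_total ((c + c') / 2) x with hx | hx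
    · have : 1 ≤ (p c' x / ((c - c') / 2)) ⊓ 1 := by
        refine le_inf ?_ le_rfl
        rw [le_div_iff₀ hε]
        exact le_trans (by linarith) (le_max_left _ _)
      linarith
    · have : 1 ≤ (m c x / ((c - c') / 2)) ⊓ 1 := by
        refine le_inf ?_ le_rfl
        rw [le_div_iff₀ hε]
        exact le_trans (by linarith) (le_max_left _ _)
      linarith
  have hge : 1 ≤ g c + dTau τ (cfc (m c) a) := by
    have h1 : Filter.Tendsto (fun c' => g c' + dTau τ (cfc (m c) a)) (nhdsWithin c (Set.Iio c))
        (nhds (g c + dTau τ (cfc (m c) a))) :=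
      (hc.tendsto.mono_left nhdsWithin_le_nhds).add_const _
    exact ge_of_tendsto h1 (Filter.eventually_of_mem self_mem_nhdsWithin hlow)
  have hle : g c + dTau τ (cfc (m c) a) ≤ 1 := by
    rw [← le_sub_iff_add_le]
    refine dTau_le τ a ha _ (hp c) _ fun ε hε => ?_
    rw [le_sub_comm]
    refine dTau_le τ a ha _ (hm c) _ fun δ hδ => ?_
    rw [le_sub_iff_add_le, ← phi_add τ a _ _ (by fun_prop) (by fun_prop)]
    refine le_trans ?_ (phi_one τ hτ_one a ha).le
    refine phi_mono τ hτ_pos a _ _ (by fun_prop) (by fun_prop) fun x => ?_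
    rcases le_total c x with hx | hx
    · have : m c x = 0 := max_eq_right (by linarith)
      simp [this]
    · have : p c x = 0 := max_eq_right (by linarith)
      simp [this]
  have hgpos : 0 < g c := by
    refine lt_of_lt_of_le ?_ (le_dTau τ hτ_pos hτ_one a ha _ (hp c) 1 one_pos)
    refine phi_pos τ hτ_pos hτ_faithful a ha _ (by fun_prop)
      (fun x => le_inf (div_nonneg (le_max_right _ _) zero_le_one) zero_le_one) t ht ?_
    exact lt_inf_iff.mpr ⟨div_pos (lt_max_of_lt_left (by linarith)) one_pos, one_pos⟩
  have hfpos : 0 < dTau τ (cfc (m c) a) := by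
    refine lt_of_lt_of_le ?_ (le_dTau τ hτ_pos hτ_one a ha _ (hm c) 1 one_pos)
    refine phi_pos τ hτ_pos hτ_faithful a ha _ (by fun_prop)
      (fun x => le_inf (div_nonneg (le_max_right _ _) zero_le_one) zero_le_one) s hs ?_
    exact lt_inf_iff.mpr ⟨div_pos (lt_max_of_lt_left (by linarith)) one_pos, one_pos⟩
  refine ⟨g c, hgpos, by linarith, cfc (p c) a, cfc (m c) a,
    cfc_nonneg fun x _ => le_max_right _ _, cfc_nonneg fun x _ => le_max_right _ _, ?_, rfl,
    by linarith⟩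
  rw [← cfc_mul (p c) (m c) a (hp c).continuousOn (hm c).continuousOn, ← cfc_zero ℝ a]
  refine cfc_congr fun x _ => ?_
  rcases le_total c x with hx | hx
  · have : m c x = 0 := max_eq_right (by linarith)
    simp [this]
  · have : p c x = 0 := max_eq_right (by linarith)
    simp [this]
end
end

section
/- Let A be a C*-algebra containing an increasing sequence (A_n) of closed *-subalgebras whose union is dense in A, let τ be a tracial positive bounded linear functional on A, let r ≥ 1, let b be a positive element of M_r(A), and let ε > 0. Then there exist a natural number k and a positive element a ∈ M_r(A_k) ⊆ M_r(A) such that a ≾ b and d_{τ_r}(a) ≥ d_{τ_r}(b) − ε. -/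
open Filter Topology
open scoped ComplexOrder

noncomputable section

variable {A : Type*}

/-- The dimension function `d_{τ_r}(a) = sup_{ε>0} τ_r(f_ε(a))` on positive elements of
`M_r(A)` induced by a tracial positive functional `τ`, where `f_ε(t) = min(t/ε, 1)`.
Here `f_ε(a) = ε⁻¹·(a - (a-ε)₊)` is expressed via the cut-down `(a-ε)₊`, which in turn is
characterized, inside matrices over the unitization of `A`, as the positive part of the
unique decomposition of `a - ε·1` into a difference of orthogonal positive elements. -/
def dTauMat [NonUnitalCStarAlgebra A] (τ : A →L[ℂ] ℂ) {r : ℕ}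
    (a : Matrix (Fin r) (Fin r) A) : ℝ :=
  sSup {x : ℝ | ∃ ε : ℝ, 0 < ε ∧
    ∃ cut : Matrix (Fin r) (Fin r) (Unitization ℂ A),
      (∃ z, cut = z.conjTranspose * z) ∧
      (∃ y : Matrix (Fin r) (Fin r) (Unitization ℂ A),
        (∃ w, y = w.conjTranspose * w) ∧ cut * y = 0 ∧
        cut - y = a.map (Unitization.inr : A → Unitization ℂ A) -
          ε • (1 : Matrix (Fin r) (Fin r) (Unitization ℂ A))) ∧
      x = ε⁻¹ * ∑ i, (τ (a i i - (cut i i).snd)).re}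

lemma cuntz_aux {M : Type*} [CStarAlgebra M] [PartialOrder M] [StarOrderedRing M]
    (s d : M) (hs : IsSelfAdjoint s) (hd : 0 ≤ d) (h : s * s ≤ d) :
    ∃ g : ℕ → M, Tendsto (fun n => (s * g n) * d * star (s * g n)) atTop (𝓝 (s * s)) := by
  have hdsa : IsSelfAdjoint d := hd.isSelfAdjoint
  have hpos : ∀ n : ℕ, (0:ℝ) < 1 / ((n:ℝ) + 1) := fun n => by positivity
  have hne : ∀ (n : ℕ) (t : ℝ), |t| + 1 / ((n:ℝ) + 1) ≠ 0 := fun n t => by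
    have := hpos n; have := abs_nonneg t; positivity
  let g : ℕ → ℝ → ℝ := fun n t => √t / (|t| + 1 / ((n:ℝ) + 1))
  let k : ℕ → ℝ → ℝ := fun n t => t / (|t| + 1 / ((n:ℝ) + 1))
  let l : ℕ → ℝ → ℝ := fun n t => 1 - k n t
  have hgc : ∀ n, Continuous (g n) := fun n =>
    Real.continuous_sqrt.div (by fun_prop) (hne n)
  have hkc : ∀ n, Continuous (k n) := fun n => continuous_id.div (by fun_prop) (hne n)
  have hlc : ∀ n, Continuous (l n) := fun n => continuous_const.sub (hkc n)
  have hspec : ∀ t ∈ spectrum ℝ d, 0 ≤ t := fun t ht => spectrum_nonneg_of_nonneg hd ht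
  have hgsa : ∀ n, IsSelfAdjoint (cfc (g n) d) := fun n => cfc_predicate _ _
  have hksa : ∀ n, IsSelfAdjoint (cfc (k n) d) := fun n => cfc_predicate _ _
  have hlsa : ∀ n, IsSelfAdjoint (cfc (l n) d) := fun n => cfc_predicate _ _
  refine ⟨fun n => cfc (g n) d, ?_⟩
  have key : ∀ n, cfc (g n) d * d * cfc (g n) d = cfc (k n) d * cfc (k n) d := by
    intro n
    have h1 : cfc (g n) d * d * cfc (g n) d = cfc (fun t => g n t * t * g n t) d := by
      conv_lhs => enter [1, 2]; rw [← cfc_id ℝ d]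
      rw [← cfc_mul (g n) id d (hgc n).continuousOn continuousOn_id,
        ← cfc_mul (fun t => g n t * id t) (g n) d ((hgc n).mul continuous_id).continuousOn
          (hgc n).continuousOn]
      rfl
    rw [h1, ← cfc_mul (k n) (k n) d (hkc n).continuousOn (hkc n).continuousOn]
    apply cfc_congr
    intro t ht
    have ht := hspec t ht
    have := hne n t
    simp only [g, k]
    have hsq := Real.mul_self_sqrt ht
    field_simp
    rw [sq, hsq]; ring
  have hl : ∀ n, cfc (l n) d = 1 - cfc (k n) d := by
    intro n
    rw [show l n = fun t => 1 - k n t from rfl, cfc_sub (fun _ => (1:ℝ)) (k n) d (by fun_prop) (hkc n).continuousOn,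
      cfc_const_one ℝ d]
  have hnorm : ∀ n, ‖s * cfc (k n) d - s‖ * ‖s * cfc (k n) d - s‖ ≤ 1 / ((n:ℝ)+1) := by
    intro n
    have e1 : s * cfc (k n) d - s = - (s * cfc (l n) d) := by rw [hl]; noncomm_ring
    rw [e1, norm_neg, ← CStarRing.norm_star_mul_self, star_mul, hs.star_eq, (hlsa n).star_eq]
    have h2 : cfc (l n) d * (s * s) * cfc (l n) d ≤ cfc (l n) d * d * cfc (l n) d := by
      exact (hlsa n).conjugate_le_conjugate h
    have h0 : 0 ≤ cfc (l n) d * (s * s) * cfc (l n) d := by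
      have := star_mul_self_nonneg (s * cfc (l n) d)
      rw [star_mul, hs.star_eq, (hlsa n).star_eq] at this
      simpa [mul_assoc] using this
    have h1 : cfc (l n) d * d * cfc (l n) d = cfc (fun t => l n t * t * l n t) d := by
      conv_lhs => enter [1, 2]; rw [← cfc_id ℝ d]
      rw [← cfc_mul (l n) id d (hlc n).continuousOn continuousOn_id,
        ← cfc_mul (fun t => l n t * id t) (l n) d ((hlc n).mul continuous_id).continuousOn
          (hlc n).continuousOn]
      rfl
    calc _ = ‖cfc (l n) d * (s * s) * cfc (l n) d‖ := by congr 1; noncomm_ring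
      _ ≤ ‖cfc (l n) d * d * cfc (l n) d‖ := CStarAlgebra.norm_le_norm_of_nonneg_of_le h0 h2
      _ ≤ _ := by
        rw [h1]
        refine norm_cfc_le (hpos n).le ?_
        intro t ht
        have ht := hspec t ht
        have hδ := hpos n
        simp only [l, k, abs_of_nonneg ht]
        set δ : ℝ := 1 / ((n:ℝ)+1)
        have e : 1 - t / (t + δ) = δ / (t + δ) := by field_simp; ring
        rw [e, Real.norm_eq_abs, abs_of_nonneg (by positivity)]
        have : δ / (t + δ) * t * (δ / (t + δ)) = δ * (δ * t) / (t + δ)^2 := by field_simp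
        rw [this, div_le_iff₀ (by positivity)]
        apply mul_le_mul_of_nonneg_left _ hδ.le
        nlinarith [mul_nonneg hδ.le ht, sq_nonneg t, sq_nonneg δ]
  have hlim : Tendsto (fun n => s * cfc (k n) d) atTop (𝓝 s) := by
    rw [tendsto_iff_norm_sub_tendsto_zero]
    have : Tendsto (fun n : ℕ => √(1 / ((n:ℝ)+1))) atTop (𝓝 0) := by
      have := (Real.continuous_sqrt.tendsto 0).comp (tendsto_one_div_add_atTop_nhds_zero_nat (𝕜 := ℝ))
      rw [Real.sqrt_zero] at this
      exact this
    refine squeeze_zero (fun _ => norm_nonneg _) (fun n => ?_) this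
    apply Real.le_sqrt_of_sq_le
    rw [sq]; exact hnorm n
  have := hlim.mul hlim.star
  rw [hs.star_eq] at this
  refine this.congr fun n => ?_
  rw [star_mul, star_mul, hs.star_eq, (hksa n).star_eq, (hgsa n).star_eq]
  calc _ = s * (cfc (k n) d * cfc (k n) d) * s := by noncomm_ring
    _ = _ := by rw [← key]; noncomm_ring

/-- The cut-down function. -/
noncomputable def cutF (κ t : ℝ) : ℝ := max (t - 2 * κ) 0

lemma rordam_aux {M : Type*} [CStarAlgebra M] [PartialOrder M] [StarOrderedRing M]
    (b c : M) (hb : 0 ≤ b) (hc : 0 ≤ c) (κ : ℝ) (hκ : 0 < κ) (h : ‖c - b‖ ≤ κ) :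
    ∃ g : ℕ → M, Tendsto (fun n => (cfcₙ (fun t => √(cutF κ t)) c * g n) * b *
      star (cfcₙ (fun t => √(cutF κ t)) c * g n)) atTop (𝓝 (cfcₙ (cutF κ) c)) := by
  have hcsa : IsSelfAdjoint c := hc.isSelfAdjoint
  have hfc : Continuous (cutF κ) := by unfold cutF; fun_prop
  have hf0 : cutF κ 0 = 0 := by simp [cutF, hκ.le]
  have hfn : ∀ t, 0 ≤ cutF κ t := fun t => le_max_right _ _
  rw [cfcₙ_eq_cfc hfc.continuousOn hf0,
    cfcₙ_eq_cfc (f := fun t => √(cutF κ t)) (by fun_prop) (by simp [hf0])]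
  let m : ℝ → ℝ := fun t => √(cutF κ t / max (t - κ) κ)
  have hm : Continuous m := by
    refine Real.continuous_sqrt.comp (hfc.div (by fun_prop) fun t => ?_)
    exact (lt_of_lt_of_le hκ (le_max_right _ _)).ne'
  have hmsa : IsSelfAdjoint (cfc m c) := cfc_predicate _ _
  set s := cfc (fun t => √(cutF κ t)) c with hsdef
  have hs : IsSelfAdjoint s := cfc_predicate _ _
  have hss : s * s = cfc (cutF κ) c := by
    rw [hsdef, ← cfc_mul _ _ c (by fun_prop) (by fun_prop)]
    congr 1; ext t; exact Real.mul_self_sqrt (hfn t)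
  have hcut : cfc m c * (c - algebraMap ℝ M κ) * cfc m c = cfc (cutF κ) c := by
    have e1 : c - algebraMap ℝ M κ = cfc (fun t => t - κ) c := by
      rw [cfc_sub (fun t => t) (fun _ => κ) c (by fun_prop) (by fun_prop), cfc_const κ c, cfc_id' ℝ c]
    rw [e1, ← cfc_mul m _ c hm.continuousOn (by fun_prop), ← cfc_mul _ m c (by fun_prop) hm.continuousOn]
    congr 1; ext t
    have hp : 0 < max (t - κ) κ := lt_of_lt_of_le hκ (le_max_right _ _)
    have hsq : m t * m t = cutF κ t / max (t - κ) κ := Real.mul_self_sqrt (div_nonneg (hfn t) hp.le)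
    rw [mul_right_comm, hsq]
    rcases le_or_gt t (2 * κ) with h | h
    · have : cutF κ t = 0 := by simp [cutF, h]
      simp [this]
    · rw [max_eq_left (by linarith)]
      have : t - κ ≠ 0 := by linarith
      field_simp
  have hle : c - algebraMap ℝ M κ ≤ b := by
    have h1 : c - b ≤ algebraMap ℝ M ‖c - b‖ := IsSelfAdjoint.le_algebraMap_norm_self (hcsa.sub hb.isSelfAdjoint)
    have h2 : algebraMap ℝ M ‖c - b‖ ≤ algebraMap ℝ M κ := algebraMap_mono M h
    have := h1.trans h2
    rw [sub_le_comm] at this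
    exact this
  have hd : 0 ≤ cfc m c * b * cfc m c := hmsa.conjugate_nonneg hb
  obtain ⟨g, hg⟩ := cuntz_aux s (cfc m c * b * cfc m c) hs hd (by
    rw [hss, ← hcut]; exact hmsa.conjugate_le_conjugate hle)
  refine ⟨fun n => g n * cfc m c, ?_⟩
  rw [hss] at hg
  refine hg.congr fun n => ?_
  simp only [star_mul, hs.star_eq, hmsa.star_eq]
  noncomm_ring

lemma norm_cut_sub_le {M : Type*} [CStarAlgebra M] [PartialOrder M] [StarOrderedRing M]
    (c : M) (hc : 0 ≤ c) (κ : ℝ) (hκ : 0 < κ) : ‖cfcₙ (cutF κ) c - c‖ ≤ 2 * κ := by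
  have hcsa : IsSelfAdjoint c := hc.isSelfAdjoint
  have hfc : Continuous (cutF κ) := by unfold cutF; fun_prop
  have hf0 : cutF κ 0 = 0 := by simp [cutF, hκ.le]
  rw [cfcₙ_eq_cfc hfc.continuousOn hf0]
  nth_rw 2 [← cfc_id' ℝ c]
  rw [← cfc_sub _ _ c (by fun_prop) (by fun_prop)]
  refine norm_cfc_le (by positivity) fun t ht => ?_
  have ht := spectrum_nonneg_of_nonneg hc ht
  rw [Real.norm_eq_abs, abs_le]
  unfold cutF
  rcases max_cases (t - 2 * κ) 0 with h | h <;> constructor <;> linarith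

lemma norm_negPart_le {M : Type*} [CStarAlgebra M] [PartialOrder M] [StarOrderedRing M]
    (c : M) (hc : 0 ≤ c) (δ : ℝ) (hδ : 0 < δ) : ‖(c - δ • (1:M))⁻‖ ≤ δ := by
  have hcsa : IsSelfAdjoint c := hc.isSelfAdjoint
  have h1 : IsSelfAdjoint (c - δ • (1:M)) := hcsa.sub (by
    rw [← Algebra.algebraMap_eq_smul_one]; exact IsSelfAdjoint.algebraMap _ (.all _))
  rw [CFC.negPart_def]
  refine norm_cfcₙ_le fun t ht => ?_
  rw [quasispectrum_eq_spectrum_union_zero] at ht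
  rcases ht with ht | ht
  · rw [← Algebra.algebraMap_eq_smul_one, ← spectrum.sub_singleton_eq] at ht
    obtain ⟨u, hu, v, hv, rfl⟩ := ht
    have hu := spectrum_nonneg_of_nonneg hc hu
    rw [Set.mem_singleton_iff] at hv
    subst hv
    rw [Real.norm_eq_abs, abs_of_nonneg (negPart_nonneg _), negPart_def]
    exact sup_le (by linarith) hδ.le
  · rw [Set.mem_singleton_iff] at ht
    subst ht
    simpa using hδ.le

lemma quasispectrum_subset_ball {M : Type*} [CStarAlgebra M] (a : M) (C : ℝ) (h : ‖a‖ ≤ C) :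
    quasispectrum ℝ a ⊆ Metric.closedBall 0 C := by
  intro t ht
  rw [mem_closedBall_zero_iff]
  have hC : 0 ≤ C := (norm_nonneg a).trans h
  rw [quasispectrum_eq_spectrum_union_zero] at ht
  rcases ht with ht | ht
  · rcases subsingleton_or_nontrivial M with hM | hM
    · simp [spectrum.of_subsingleton] at ht
    · exact (spectrum.norm_le_norm_of_mem ht).trans h
  · rw [Set.mem_singleton_iff] at ht
    subst ht
    simpa using hC

lemma tendsto_posPart {M : Type*} [CStarAlgebra M] [PartialOrder M] [StarOrderedRing M]
    (a : ℕ → M) (b : M) (ha : ∀ n, IsSelfAdjoint (a n)) (hb : IsSelfAdjoint b)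
    (h : Tendsto a atTop (𝓝 b)) : Tendsto (fun n => (a n)⁺) atTop (𝓝 b⁺) := by
  simp only [CFC.posPart_def]
  refine h.cfcₙ (s := Metric.closedBall 0 (‖b‖ + 1)) (isCompact_closedBall _ _) _ ?_
    (.of_forall ha) ?_ hb
  · have := h.norm.eventually (gt_mem_nhds (lt_add_one ‖b‖))
    filter_upwards [this] with n hn
    exact quasispectrum_subset_ball _ _ hn.le
  · exact quasispectrum_subset_ball _ _ (by linarith)

/-- Matrices over the unitization, as a C*-algebra. -/
def MU (r : ℕ) (A : Type*) [NonUnitalCStarAlgebra A] : Type _ :=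
  CStarMatrix (Fin r) (Fin r) (Unitization ℂ A)

instance instMU (r : ℕ) (A : Type*) [NonUnitalCStarAlgebra A] : CStarAlgebra (MU r A) :=
  letI : PartialOrder (Unitization ℂ A) := CStarAlgebra.spectralOrder _
  haveI : StarOrderedRing (Unitization ℂ A) := CStarAlgebra.spectralOrderedRing _
  inferInstanceAs (CStarAlgebra (CStarMatrix (Fin r) (Fin r) (Unitization ℂ A)))

instance instMUOrder (r : ℕ) (A : Type*) [NonUnitalCStarAlgebra A] : PartialOrder (MU r A) :=
  CStarAlgebra.spectralOrder _

instance instMUStarOrdered (r : ℕ) (A : Type*) [NonUnitalCStarAlgebra A] :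
    StarOrderedRing (MU r A) :=
  CStarAlgebra.spectralOrderedRing _

lemma MU.ext [NonUnitalCStarAlgebra A] {r : ℕ} {a b : MU r A} (h : ∀ i j, a i j = b i j) : a = b :=
  funext fun i => funext fun j => h i j

lemma MU.add_apply [NonUnitalCStarAlgebra A] {r : ℕ} (a b : MU r A) (i j : Fin r) :
    (a + b) i j = a i j + b i j := rfl

lemma MU.sub_apply [NonUnitalCStarAlgebra A] {r : ℕ} (a b : MU r A) (i j : Fin r) :
    (a - b) i j = a i j - b i j := rfl

lemma MU.zero_apply [NonUnitalCStarAlgebra A] {r : ℕ} (i j : Fin r) :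
    (0 : MU r A) i j = 0 := rfl

lemma MU.mul_apply [NonUnitalCStarAlgebra A] {r : ℕ} (a b : MU r A) (i j : Fin r) :
    (a * b) i j = ∑ k, a i k * b k j := rfl

lemma MU.star_apply [NonUnitalCStarAlgebra A] {r : ℕ} (a : MU r A) (i j : Fin r) :
    (star a) i j = star (a j i) := rfl

lemma MU.smul_apply [NonUnitalCStarAlgebra A] {r : ℕ} (c : ℂ) (a : MU r A) (i j : Fin r) :
    (c • a) i j = c • a i j := rfl

lemma MU.real_smul_apply [NonUnitalCStarAlgebra A] {r : ℕ} (c : ℝ) (a : MU r A) (i j : Fin r) :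
    (c • a) i j = (c : ℂ) • a i j := rfl

/-- `M_r(S)` inside `M_r(A⁺)`. -/
def matSub [NonUnitalCStarAlgebra A] (r : ℕ) (S : NonUnitalStarSubalgebra ℂ A) :
    NonUnitalStarSubalgebra ℂ (MU r A) where
  carrier := {m | ∀ i j, (m i j).fst = 0 ∧ (m i j).snd ∈ S}
  add_mem' := by
    intro a b ha hb i j
    exact ⟨by simp [MU.add_apply, (ha i j).1, (hb i j).1], by simpa [MU.add_apply] using add_mem (ha i j).2 (hb i j).2⟩
  zero_mem' := by
    intro i j
    exact ⟨by simp [MU.zero_apply], by simp [MU.zero_apply]⟩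
  mul_mem' := by
    intro a b ha hb i j
    have h : ∀ k, (a i k * b k j) = Unitization.inr ((a i k).snd * (b k j).snd) := by
      intro k
      ext <;> simp [(ha i k).1, (hb k j).1]
    have e : (a * b) i j = Unitization.inr (∑ k, (a i k).snd * (b k j).snd) := by
      rw [MU.mul_apply, Finset.sum_congr rfl fun k _ => h k]
      exact (map_sum (Unitization.inrNonUnitalAlgHom ℂ A) _ _).symm
    rw [e]
    exact ⟨by simp, by simpa using sum_mem fun k _ => mul_mem (ha i k).2 (hb k j).2⟩
  smul_mem' := by
    intro c a ha i j
    exact ⟨by simp [MU.smul_apply, (ha i j).1], by simpa [MU.smul_apply] using SMulMemClass.smul_mem c (ha i j).2⟩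
  star_mem' := by
    intro a ha i j
    rw [MU.star_apply]
    exact ⟨by simp [(ha j i).1], by simpa using star_mem (ha j i).2⟩

lemma continuous_entry [NonUnitalCStarAlgebra A] {r : ℕ} (i j : Fin r) :
    Continuous (fun m : MU r A => m i j) := by
  exact (continuous_apply j).comp (continuous_apply (A := fun _ => Fin r → Unitization ℂ A) i)

lemma isClosed_matSub [NonUnitalCStarAlgebra A] {r : ℕ} (S : NonUnitalStarSubalgebra ℂ A) (hS : IsClosed (S : Set A)) :
    IsClosed (matSub r S : Set (MU r A)) := by
  have : (matSub r S : Set (MU r A)) = ⋂ i, ⋂ j, ({m : MU r A | (m i j).fst = 0} ∩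
      {m : MU r A | (m i j).snd ∈ (S : Set A)}) := by
    ext m
    simp only [Set.mem_iInter]
    rfl
  rw [this]
  refine isClosed_iInter fun i => isClosed_iInter fun j => IsClosed.inter ?_ ?_
  · exact isClosed_singleton.preimage (Unitization.continuous_fst.comp (continuous_entry i j))
  · exact hS.preimage (Unitization.continuous_snd.comp (continuous_entry i j))

/-- The embedding of `M_r(A)` into `M_r(A⁺)`. -/
def emb [NonUnitalCStarAlgebra A] {r : ℕ} (a : Matrix (Fin r) (Fin r) A) : MU r A :=
  CStarMatrix.ofMatrix (a.map (Unitization.inr : A → Unitization ℂ A))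

lemma emb_apply [NonUnitalCStarAlgebra A] {r : ℕ} (a : Matrix (Fin r) (Fin r) A) (i j : Fin r) :
    emb a i j = (Unitization.inr (a i j) : Unitization ℂ A) := rfl

lemma emb_mul [NonUnitalCStarAlgebra A] {r : ℕ} (a b : Matrix (Fin r) (Fin r) A) :
    emb (a * b) = emb a * emb b := by
  refine MU.ext fun i j => ?_
  rw [MU.mul_apply, emb_apply, Matrix.mul_apply]
  simp only [emb_apply, ← Unitization.inr_mul]
  exact map_sum (Unitization.inrNonUnitalAlgHom ℂ A) _ _

lemma emb_star [NonUnitalCStarAlgebra A] {r : ℕ} (a : Matrix (Fin r) (Fin r) A) :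
    emb a.conjTranspose = star (emb a) := by
  refine MU.ext fun i j => ?_
  rw [MU.star_apply, emb_apply, emb_apply, Matrix.conjTranspose_apply, Unitization.inr_star]

/-- The coordinate projection `M_r(A⁺) → M_r(A)`. -/
def proj [NonUnitalCStarAlgebra A] {r : ℕ} (m : MU r A) : Matrix (Fin r) (Fin r) A :=
  fun i j => (m i j).snd

lemma proj_emb [NonUnitalCStarAlgebra A] {r : ℕ} (a : Matrix (Fin r) (Fin r) A) :
    proj (emb a) = a := by
  ext i j
  simp [proj, emb_apply]

lemma emb_proj [NonUnitalCStarAlgebra A] {r : ℕ} (m : MU r A) (h : ∀ i j, (m i j).fst = 0) :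
    emb (proj m) = m := by
  refine MU.ext fun i j => ?_
  rw [emb_apply]
  ext <;> simp [proj, h]

lemma continuous_proj [NonUnitalCStarAlgebra A] {r : ℕ} :
    Continuous (proj : MU r A → Matrix (Fin r) (Fin r) A) :=
  continuous_pi fun i => continuous_pi fun j =>
    Unitization.continuous_snd.comp (continuous_entry i j)

lemma continuous_emb [NonUnitalCStarAlgebra A] {r : ℕ} :
    Continuous (emb : Matrix (Fin r) (Fin r) A → MU r A) :=
  continuous_pi fun i => continuous_pi fun j =>
    Unitization.continuous_inr.comp (continuous_apply_apply i j)

lemma mul_fst_zero [NonUnitalCStarAlgebra A] {r : ℕ} (m g : MU r A)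
    (h : ∀ i j, (m i j).fst = 0) (i j : Fin r) : ((m * g) i j).fst = 0 := by
  rw [MU.mul_apply]
  have : (∑ k, m i k * g k j).fst = ∑ k, (m i k * g k j).fst :=
    map_sum (Unitization.fstHom ℂ A) _ _
  rw [this]
  simp [h]

/-- The functional. -/
def trF [NonUnitalCStarAlgebra A] {r : ℕ} (τ : A →L[ℂ] ℂ) : MU r A →L[ℝ] ℝ where
  toFun m := ∑ i, (τ ((m i i).snd)).re
  map_add' x y := by simp [MU.add_apply, Finset.sum_add_distrib]
  map_smul' c x := by
    simp [MU.real_smul_apply, Finset.mul_sum]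
  cont := continuous_finsetSum _ fun i _ => Complex.continuous_re.comp
    (τ.continuous.comp (Unitization.continuous_snd.comp (continuous_entry i i)))

lemma trF_apply [NonUnitalCStarAlgebra A] {r : ℕ} (τ : A →L[ℂ] ℂ) (m : MU r A) :
    trF τ m = ∑ i, (τ ((m i i).snd)).re := rfl

lemma emb_sub_smul [NonUnitalCStarAlgebra A] {r : ℕ} (a : Matrix (Fin r) (Fin r) A) (ε : ℝ) :
    (emb a - ε • (1 : MU r A)) = (show MU r A from a.map (Unitization.inr : A → Unitization ℂ A) -
          ε • (1 : Matrix (Fin r) (Fin r) (Unitization ℂ A))) := by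
  refine MU.ext fun i j => ?_
  rw [MU.sub_apply, MU.real_smul_apply]
  change _ = _ - ε • ((1 : Matrix (Fin r) (Fin r) (Unitization ℂ A)) i j)
  congr 1

/-- Membership in the set defining `dTauMat`. -/
lemma mem_iff [NonUnitalCStarAlgebra A] {r : ℕ} (τ : A →L[ℂ] ℂ) (a : Matrix (Fin r) (Fin r) A) (x : ℝ) :
    (∃ ε : ℝ, 0 < ε ∧
    ∃ cut : Matrix (Fin r) (Fin r) (Unitization ℂ A),
      (∃ z, cut = z.conjTranspose * z) ∧
      (∃ y : Matrix (Fin r) (Fin r) (Unitization ℂ A),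
        (∃ w, y = w.conjTranspose * w) ∧ cut * y = 0 ∧
        cut - y = a.map (Unitization.inr : A → Unitization ℂ A) -
          ε • (1 : Matrix (Fin r) (Fin r) (Unitization ℂ A))) ∧
      x = ε⁻¹ * ∑ i, (τ (a i i - (cut i i).snd)).re) ↔
    ∃ ε : ℝ, 0 < ε ∧ IsSelfAdjoint (emb a) ∧
      x = ε⁻¹ * trF τ (emb a - (emb a - ε • (1 : MU r A))⁺) := by
  constructor
  · rintro ⟨ε, hε, cut, ⟨z, hz⟩, ⟨y, ⟨w, hw⟩, hcy, hsub⟩, hx⟩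
    have h1 : 0 ≤ (show MU r A from cut) := by
      rw [CStarAlgebra.nonneg_iff_eq_star_mul_self]
      exact ⟨z, hz⟩
    have h2 : 0 ≤ (show MU r A from y) := by
      rw [CStarAlgebra.nonneg_iff_eq_star_mul_self]
      exact ⟨w, hw⟩
    have hs : emb a - ε • (1 : MU r A) = (show MU r A from cut) - (show MU r A from y) :=
      (emb_sub_smul a ε).trans hsub.symm
    have hu := (CFC.posPart_negPart_unique hs hcy h1 h2).1
    refine ⟨ε, hε, ?_, ?_⟩
    · have h3 : emb a = (show MU r A from cut) - (show MU r A from y) + ε • (1 : MU r A) := by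
        rw [← hs]; abel
      rw [h3, ← Algebra.algebraMap_eq_smul_one]
      exact (h1.isSelfAdjoint.sub h2.isSelfAdjoint).add (IsSelfAdjoint.algebraMap _ (.all _))
    · rw [hu, hx, trF_apply]
      rfl
  · rintro ⟨ε, hε, hsa, hx⟩
    have h1 : IsSelfAdjoint (emb a - ε • (1 : MU r A)) := hsa.sub (by
      rw [← Algebra.algebraMap_eq_smul_one]; exact IsSelfAdjoint.algebraMap _ (.all _))
    obtain ⟨z, hz⟩ := CStarAlgebra.nonneg_iff_eq_star_mul_self.1
      (CFC.posPart_nonneg (emb a - ε • (1 : MU r A)))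
    obtain ⟨w, hw⟩ := CStarAlgebra.nonneg_iff_eq_star_mul_self.1
      (CFC.negPart_nonneg (emb a - ε • (1 : MU r A)))
    have hpm := CFC.posPart_mul_negPart (emb a - ε • (1 : MU r A))
    have hps := (CFC.posPart_sub_negPart _ h1).trans (emb_sub_smul a ε)
    refine ⟨ε, hε, show MU r A from (emb a - ε • (1 : MU r A))⁺, ⟨z, hz⟩,
      ⟨show MU r A from (emb a - ε • (1 : MU r A))⁻, ⟨w, hw⟩, hpm, hps⟩, ?_⟩
    rw [hx, trF_apply]
    rfl

lemma dTauMat_eq [NonUnitalCStarAlgebra A] {r : ℕ} (τ : A →L[ℂ] ℂ) (a : Matrix (Fin r) (Fin r) A) :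
    dTauMat τ a = sSup {x : ℝ | ∃ ε : ℝ, 0 < ε ∧ IsSelfAdjoint (emb a) ∧
      x = ε⁻¹ * trF τ (emb a - (emb a - ε • (1 : MU r A))⁺)} := by
  unfold dTauMat
  congr 1
  ext x
  exact mem_iff τ a x

lemma bdd_aux [NonUnitalCStarAlgebra A] {r : ℕ} (τ : A →L[ℂ] ℂ) (a : Matrix (Fin r) (Fin r) A) (ha : 0 ≤ emb a) :
    BddAbove {x : ℝ | ∃ ε : ℝ, 0 < ε ∧ IsSelfAdjoint (emb a) ∧
      x = ε⁻¹ * trF τ (emb a - (emb a - ε • (1 : MU r A))⁺)} := by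
  refine ⟨‖(trF τ : MU r A →L[ℝ] ℝ)‖ * (‖(1 : MU r A)‖ + 1), ?_⟩
  rintro x ⟨δ, hδ, hsa, rfl⟩
  have h1 : IsSelfAdjoint (emb a - δ • (1 : MU r A)) := hsa.sub (by
      rw [← Algebra.algebraMap_eq_smul_one]; exact IsSelfAdjoint.algebraMap _ (.all _))
  have h2 := CFC.posPart_sub_negPart _ h1
  have h3 : emb a - (emb a - δ • (1 : MU r A))⁺ = δ • (1 : MU r A) - (emb a - δ • (1 : MU r A))⁻ := by
    have : emb a = (emb a - δ • (1 : MU r A))⁺ - (emb a - δ • (1 : MU r A))⁻ + δ • (1 : MU r A) := by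
      rw [h2]; abel
    nth_rw 1 [this]
    abel
  have h4 : ‖δ • (1 : MU r A) - (emb a - δ • (1 : MU r A))⁻‖ ≤ δ * (‖(1 : MU r A)‖ + 1) := by
    refine (norm_sub_le _ _).trans ?_
    have := norm_negPart_le (emb a) ha δ hδ
    rw [norm_smul, Real.norm_of_nonneg hδ.le]
    linarith
  rw [h3, inv_mul_le_iff₀ hδ]
  refine (le_abs_self _).trans (((trF τ : MU r A →L[ℝ] ℝ).le_opNorm _).trans ?_)
  calc _ ≤ ‖(trF τ : MU r A →L[ℝ] ℝ)‖ * (δ * (‖(1 : MU r A)‖ + 1)) := by gcongr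
    _ = _ := by ring

lemma exists_approx_seq [NonUnitalCStarAlgebra A] {r : ℕ}
    (S : ℕ → NonUnitalStarSubalgebra ℂ A) (hS_mono : Monotone S)
    (hS_dense : Dense (⋃ n, (S n : Set A))) (z : Matrix (Fin r) (Fin r) A) :
    ∃ (k : ℕ → ℕ) (w : ℕ → Matrix (Fin r) (Fin r) A), (∀ n i j, w n i j ∈ S (k n)) ∧
      Tendsto w atTop (𝓝 z) := by
  have h : ∀ a : A, ∃ u : ℕ → A, (∀ n, u n ∈ ⋃ n, (S n : Set A)) ∧ Tendsto u atTop (𝓝 a) :=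
    fun a => mem_closure_iff_seq_limit.1 (hS_dense a)
  choose u hu hul using h
  simp only [Set.mem_iUnion] at hu
  choose κ hκ using hu
  refine ⟨fun n => Finset.univ.sup fun p : Fin r × Fin r => κ (z p.1 p.2) n,
    fun n i j => u (z i j) n, fun n i j => ?_, ?_⟩
  · refine hS_mono ?_ (hκ (z i j) n)
    exact Finset.le_sup (f := fun p : Fin r × Fin r => κ (z p.1 p.2) n) (Finset.mem_univ (i, j))
  · exact tendsto_pi_nhds.2 fun i => tendsto_pi_nhds.2 fun j => hul (z i j)

/-- Let `A` be a C*-algebra containing an increasing sequence of closed *-subalgebras with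
dense union, let `τ` be a tracial positive bounded functional on `A`, let `b ∈ M_r(A)` be
positive and `ε > 0`.  Then there are `k` and a positive `a ∈ M_r(A_k)` with `a ≾ b` and
`d_{τ_r}(a) ≥ d_{τ_r}(b) - ε`. -/
theorem exists_approximant_in_subalgebra [NonUnitalCStarAlgebra A]
    (S : ℕ → NonUnitalStarSubalgebra ℂ A) (hS_mono : Monotone S)
    (hS_closed : ∀ n, IsClosed (S n : Set A))
    (hS_dense : Dense (⋃ n, (S n : Set A)))
    (τ : A →L[ℂ] ℂ)
    (hτ_pos : ∀ a : A, 0 ≤ τ (star a * a))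
    (hτ_tr : ∀ a b : A, τ (a * b) = τ (b * a))
    {r : ℕ} (hr : 1 ≤ r) (b : Matrix (Fin r) (Fin r) A) (hb : IsPos b)
    (ε : ℝ) (hε : 0 < ε) :
    ∃ (k : ℕ) (a : Matrix (Fin r) (Fin r) A),
      (∀ i j, a i j ∈ S k) ∧ IsPos a ∧ CuntzLE a b ∧
      dTauMat τ b - ε ≤ dTauMat τ a := by
  obtain ⟨z, hbdef⟩ := hb
  have hbe : emb b = star (emb z) * emb z := by rw [hbdef, emb_mul, emb_star]
  have hb0 : 0 ≤ emb b := by rw [hbe]; exact star_mul_self_nonneg _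
  have hbsa : IsSelfAdjoint (emb b) := hb0.isSelfAdjoint
  -- pick a good value in the supremum defining `d(b)`
  obtain ⟨x, ⟨δ, hδ, -, hx⟩, hxlt⟩ : ∃ x ∈ {x : ℝ | ∃ ε : ℝ, 0 < ε ∧ IsSelfAdjoint (emb b) ∧
      x = ε⁻¹ * trF τ (emb b - (emb b - ε • (1 : MU r A))⁺)}, dTauMat τ b - ε < x := by
    refine exists_lt_of_lt_csSup ⟨1⁻¹ * trF τ (emb b - (emb b - (1 : ℝ) • (1 : MU r A))⁺),
      1, one_pos, hbsa, rfl⟩ ?_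
    rw [← dTauMat_eq]
    linarith
  -- approximate
  obtain ⟨k, w, hw, hwlim⟩ := exists_approx_seq S hS_mono hS_dense z
  let c : ℕ → MU r A := fun n => star (emb (w n)) * emb (w n)
  have hc0 : ∀ n, 0 ≤ c n := fun n => star_mul_self_nonneg _
  have hclim : Tendsto c atTop (𝓝 (emb b)) := by
    rw [hbe]
    have := (continuous_emb.tendsto z).comp hwlim
    exact this.star.mul this
  let κ : ℕ → ℝ := fun n => ‖c n - emb b‖ + 1 / ((n : ℝ) + 1)
  have hκ : ∀ n, 0 < κ n := fun n => by positivity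
  have hκlim : Tendsto κ atTop (𝓝 0) := by
    have h1 := tendsto_iff_norm_sub_tendsto_zero.1 hclim
    have h2 := h1.add (tendsto_one_div_add_atTop_nhds_zero_nat (𝕜 := ℝ))
    rw [add_zero] at h2
    exact h2
  let a : ℕ → MU r A := fun n => cfcₙ (cutF (κ n)) (c n)
  have hasa : ∀ n, IsSelfAdjoint (a n) := fun n => cfcₙ_predicate _ _
  have halim : Tendsto a atTop (𝓝 (emb b)) := by
    have h1 : Tendsto (fun n => a n - c n) atTop (𝓝 0) := by
      apply squeeze_zero_norm (fun n => norm_cut_sub_le (c n) (hc0 n) (κ n) (hκ n))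
      simpa using hκlim.const_mul 2
    simpa using h1.add hclim
  have h1sa : IsSelfAdjoint (δ • (1 : MU r A)) := by
    rw [← Algebra.algebraMap_eq_smul_one]; exact IsSelfAdjoint.algebraMap _ (.all _)
  have hval : Tendsto (fun n => δ⁻¹ * trF τ (a n - (a n - δ • (1 : MU r A))⁺)) atTop (𝓝 x) := by
    rw [hx]
    refine Tendsto.const_mul _ (((trF τ : MU r A →L[ℝ] ℝ).continuous.tendsto _).comp ?_)
    exact halim.sub (tendsto_posPart _ _ (fun n => (hasa n).sub h1sa) (hbsa.sub h1sa)
      (halim.sub_const _))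
  obtain ⟨n, hn⟩ := (hval.eventually (lt_mem_nhds hxlt)).exists
  -- membership
  have := isClosed_matSub (r := r) (S (k n)) (hS_closed (k n))
  have hwm : emb (w n) ∈ matSub r (S (k n)) := fun i j => by
    rw [emb_apply]
    exact ⟨by simp, by simpa using hw n i j⟩
  have hcm : c n ∈ matSub r (S (k n)) := mul_mem (star_mem hwm) hwm
  have ham : a n ∈ matSub r (S (k n)) := cfcₙ_mem (𝕜' := ℂ) _ hcm
  let s : MU r A := cfcₙ (fun t => √(cutF (κ n) t)) (c n)
  have hsm : s ∈ matSub r (S (k n)) := cfcₙ_mem (𝕜' := ℂ) _ hcm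
  have hsa : IsSelfAdjoint s := cfcₙ_predicate _ _
  have hfc : Continuous (cutF (κ n)) := by unfold cutF; fun_prop
  have hf0 : cutF (κ n) 0 = 0 := by simp [cutF, (hκ n).le]
  have hss : star s * s = a n := by
    rw [hsa.star_eq]
    change cfcₙ _ _ * cfcₙ _ _ = cfcₙ _ _
    rw [← cfcₙ_mul _ _ (c n) (by fun_prop) (by simp [hf0]) (by fun_prop) (by simp [hf0])]
    congr 1; ext t; exact Real.mul_self_sqrt (le_max_right _ _)
  have hea : emb (proj (a n)) = a n := emb_proj _ fun i j => (ham i j).1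
  have hes : emb (proj s) = s := emb_proj _ fun i j => (hsm i j).1
  refine ⟨k n, proj (a n), fun i j => (ham i j).2, ⟨proj s, ?_⟩, ?_, ?_⟩
  · rw [← proj_emb ((proj s).conjTranspose * proj s), emb_mul, emb_star, hes, hss]
  · obtain ⟨g, hg⟩ := rordam_aux (emb b) (c n) hb0 (hc0 n) (κ n) (hκ n)
      (le_add_of_nonneg_right (by positivity))
    refine ⟨fun m => proj (s * g m), ?_⟩
    refine ((continuous_proj.tendsto _).comp hg).congr fun m => ?_
    have he : emb (proj (s * g m)) = s * g m :=
      emb_proj _ (mul_fst_zero _ _ fun i j => (hsm i j).1)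
    rw [← proj_emb (proj (s * g m) * b * (proj (s * g m)).conjTranspose), emb_mul, emb_mul,
      emb_star, he]
    rfl
  · refine hn.le.trans ?_
    rw [dTauMat_eq]
    refine le_csSup (bdd_aux τ _ ?_) ⟨δ, hδ, ?_, ?_⟩
    · rw [hea, ← hss]; exact star_mul_self_nonneg _
    · rw [hea]; exact hasa n
    · rw [hea]
end
end

section
/- Let A be a C*-algebra, let a, b be positive elements of A with a ≾ b, and let ε > 0. Then there exist positive elements a_0 and c, both lying in the hereditary subalgebra of A generated by b (the closure of bAb), such that a_0 c = 0, a_0 ∼ (a − 2ε)₊, and b ≾ (a − ε)₊ ⊕ c. -/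
open Filter Topology

noncomputable section

variable {A : Type*}

/-- The block-diagonal direct sum `a ⊕ b` of two square matrices. -/
def dsum [NonUnitalCStarAlgebra A] {ι κ : Type*} (a : Matrix ι ι A) (b : Matrix κ κ A) :
    Matrix (ι ⊕ κ) (ι ⊕ κ) A :=
  Matrix.fromBlocks a 0 0 b

/-- Equivalence of positive elements: `a = x* x` and `b = x x*`. -/
def EquivPos [NonUnitalCStarAlgebra A] (a b : A) : Prop :=
  ∃ x : A, a = star x * x ∧ b = x * star x

/-- `(a - ε)₊`, via the (non-unital) continuous functional calculus. -/
def cutPlusN [NonUnitalCStarAlgebra A] (ε : ℝ) (a : A) : A :=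
  cfcₙ (fun t : ℝ => (t - ε) ⊔ 0) a

/-- The hereditary subalgebra of a C*-algebra generated by a positive element `b`:
the closure of `b A b`. -/
def Hered [NonUnitalCStarAlgebra A] (b : A) : Set A :=
  closure {x : A | ∃ y : A, x = b * y * b}

section Aux

/-- `t / (t + δ)`. -/
def hFun (δ t : ℝ) : ℝ := t / (|t| + δ)

/-- `√t / (t + δ)`. -/
def thFun (δ t : ℝ) : ℝ := Real.sqrt t / (|t| + δ)

lemma hFun_cont {δ : ℝ} (hδ : 0 < δ) : Continuous (hFun δ) := by
  unfold hFun
  refine Continuous.div (by fun_prop) (by fun_prop) (fun t => ?_)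
  positivity

lemma thFun_cont {δ : ℝ} (hδ : 0 < δ) : Continuous (thFun δ) := by
  unfold thFun
  refine Continuous.div (by fun_prop) (by fun_prop) (fun t => ?_)
  positivity

lemma hFun_zero (δ : ℝ) : hFun δ 0 = 0 := by simp [hFun]

lemma thFun_zero (δ : ℝ) : thFun δ 0 = 0 := by simp [thFun]

variable [NonUnitalCStarAlgebra A] [PartialOrder A] [StarOrderedRing A]

lemma cfc_mul' (q : A) {f g k : ℝ → ℝ} (hq : 0 ≤ q) (hf : Continuous f) (hg : Continuous g)
    (hf0 : f 0 = 0) (hg0 : g 0 = 0) (h : ∀ t, 0 ≤ t → f t * g t = k t) :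
    cfcₙ f q * cfcₙ g q = cfcₙ k q := by
  rw [← cfcₙ_mul f g q hf.continuousOn hf0 hg.continuousOn hg0]
  exact cfcₙ_congr fun t ht => h t (quasispectrum_nonneg_of_nonneg q hq t ht)

lemma cfc_mul_id (q : A) {f k : ℝ → ℝ} (hq : 0 ≤ q) (hf : Continuous f)
    (hf0 : f 0 = 0) (h : ∀ t, 0 ≤ t → f t * t = k t) :
    cfcₙ f q * q = cfcₙ k q := by
  have := cfc_mul' q (g := id) hq hf continuous_id hf0 rfl h
  rwa [cfcₙ_id ℝ q (IsSelfAdjoint.of_nonneg hq)] at this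

lemma id_mul_cfc (q : A) {f k : ℝ → ℝ} (hq : 0 ≤ q) (hf : Continuous f)
    (hf0 : f 0 = 0) (h : ∀ t, 0 ≤ t → t * f t = k t) :
    q * cfcₙ f q = cfcₙ k q := by
  have := cfc_mul' q (f := id) hq continuous_id hf rfl hf0 h
  rwa [cfcₙ_id ℝ q (IsSelfAdjoint.of_nonneg hq)] at this

lemma star_cfc (q : A) (f : ℝ → ℝ) : star (cfcₙ f q) = cfcₙ f q :=
  (IsSelfAdjoint.cfcₙ : IsSelfAdjoint (cfcₙ f q))

/-- the square root used throughout -/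
def rt (q : A) : A := cfcₙ Real.sqrt q

lemma star_rt (q : A) : star (rt q) = rt q := star_cfc q _

lemma rt_mul_rt (q : A) (hq : 0 ≤ q) : rt q * rt q = q := by
  have := cfc_mul' q (k := id) hq Real.continuous_sqrt Real.continuous_sqrt
    Real.sqrt_zero Real.sqrt_zero (fun t ht => Real.mul_self_sqrt ht)
  rwa [cfcₙ_id ℝ q (IsSelfAdjoint.of_nonneg hq)] at this

lemma th_q_th (q : A) (hq : 0 ≤ q) {δ η : ℝ} (hδ : 0 < δ) (hη : 0 < η) :
    cfcₙ (thFun δ) q * q * cfcₙ (thFun η) q = cfcₙ (hFun δ) q * cfcₙ (hFun η) q := by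
  have e1 : cfcₙ (thFun δ) q * q = cfcₙ (hFun δ) q * rt q := by
    rw [cfc_mul_id q (k := fun t => thFun δ t * t) hq (thFun_cont hδ) (thFun_zero δ)
      (fun t _ => rfl), rt]
    symm
    refine cfc_mul' q hq (hFun_cont hδ) Real.continuous_sqrt (hFun_zero δ) Real.sqrt_zero ?_
    intro t _
    simp only [hFun, thFun]; ring
  have e2 : rt q * cfcₙ (thFun η) q = cfcₙ (hFun η) q := by
    refine cfc_mul' q hq Real.continuous_sqrt (thFun_cont hη) Real.sqrt_zero (thFun_zero η) ?_
    intro t ht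
    simp only [hFun, thFun]
    rw [← mul_div_assoc, Real.mul_self_sqrt ht]
  rw [e1, mul_assoc, e2]

lemma norm_q_sub (q : A) (hq : 0 ≤ q) {δ : ℝ} (hδ : 0 < δ) :
    ‖q - cfcₙ (hFun δ) q * q - q * cfcₙ (hFun δ) q
      + cfcₙ (hFun δ) q * q * cfcₙ (hFun δ) q‖ ≤ δ := by
  have hc := hFun_cont hδ
  have h0 := hFun_zero δ
  have e0 : q = cfcₙ (fun t : ℝ => t) q :=
    (cfcₙ_id ℝ q (IsSelfAdjoint.of_nonneg hq)).symm
  have e1 : cfcₙ (hFun δ) q * q = cfcₙ (fun t => hFun δ t * t) q :=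
    cfc_mul_id q hq hc h0 fun t _ => rfl
  have e2 : q * cfcₙ (hFun δ) q = cfcₙ (fun t => t * hFun δ t) q :=
    id_mul_cfc q hq hc h0 fun t _ => rfl
  have e3 : cfcₙ (hFun δ) q * q * cfcₙ (hFun δ) q = cfcₙ (fun t => hFun δ t * t * hFun δ t) q := by
    rw [e1]
    exact cfc_mul' q hq (by fun_prop) hc (by simp) h0 fun t _ => rfl
  have key : q - cfcₙ (hFun δ) q * q - q * cfcₙ (hFun δ) q
      + cfcₙ (hFun δ) q * q * cfcₙ (hFun δ) q =
      cfcₙ (fun t => t - hFun δ t * t - t * hFun δ t + hFun δ t * t * hFun δ t) q := by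
    rw [cfcₙ_add (a := q) (fun t => t - hFun δ t * t - t * hFun δ t)
        (fun t => hFun δ t * t * hFun δ t)
        (by fun_prop) (by simp) (by fun_prop) (by simp),
      cfcₙ_sub (a := q) (fun t => t - hFun δ t * t) (fun t => t * hFun δ t)
        (by fun_prop) (by simp) (by fun_prop) (by simp),
      cfcₙ_sub (a := q) (fun t => t) (fun t => hFun δ t * t)
        (by fun_prop) (by simp) (by fun_prop) (by simp), ← e0, ← e1, ← e2, ← e3]
  rw [key]
  refine norm_cfcₙ_le fun t ht => ?_
  have ht : 0 ≤ t := quasispectrum_nonneg_of_nonneg q hq t ht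
  have : t - hFun δ t * t - t * hFun δ t + hFun δ t * t * hFun δ t
      = t * δ ^ 2 / (t + δ) ^ 2 := by
    simp only [hFun, abs_of_nonneg ht]
    field_simp
    ring
  rw [this, Real.norm_of_nonneg (by positivity), div_le_iff₀ (by positivity)]
  nlinarith [mul_nonneg ht hδ.le, mul_nonneg (mul_nonneg ht hδ.le) hδ.le,
    mul_nonneg (mul_nonneg ht ht) hδ.le, pow_pos hδ 3]

lemma norm_P_sub (q P : A) (hP : star P = P) (hPq : P * P ≤ q) {δ : ℝ} (hδ : 0 < δ) :
    ‖P - cfcₙ (hFun δ) q * P‖ ≤ Real.sqrt δ := by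
  have hPP : 0 ≤ P * P := by
    have := star_mul_self_nonneg P
    rwa [hP] at this
  have hq : 0 ≤ q := hPP.trans hPq
  set h := cfcₙ (hFun δ) q with hh
  have hs : star h = h := star_cfc q _
  have e1 : (P - h * P) * star (P - h * P)
      = P * P - h * (P * P) - P * P * h + h * (P * P) * h := by
    rw [star_sub, star_mul, hP, hs]; noncomm_ring
  have hle : P * P - h * (P * P) - P * P * h + h * (P * P) * h
      ≤ q - h * q - q * h + h * q * h := by
    set r := rt (q - P * P) with hr
    have hrr : r * r = q - P * P := rt_mul_rt _ (sub_nonneg.2 hPq)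
    have hrs : star r = r := star_rt _
    have h1 := mul_star_self_nonneg (r - h * r)
    have h2 : (r - h * r) * star (r - h * r)
        = (q - P * P) - h * (q - P * P) - (q - P * P) * h + h * (q - P * P) * h := by
      rw [star_sub, star_mul, hrs, hs, ← hrr]; noncomm_ring
    rw [h2] at h1
    rw [← sub_nonneg]
    convert h1 using 1
    noncomm_ring
  have h3 : ‖P - h * P‖ * ‖P - h * P‖ ≤ δ := by
    rw [← CStarRing.norm_self_mul_star]
    refine (CStarAlgebra.norm_le_norm_of_nonneg_of_le (mul_star_self_nonneg _)
      (e1.trans_le hle)).trans (norm_q_sub q hq hδ)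
  refine Real.le_sqrt_of_sq_le ?_
  rwa [pow_two]

/-- the sequence `1/(n+1)` -/
def dl (n : ℕ) : ℝ := 1 / ((n : ℝ) + 1)

lemma dl_pos (n : ℕ) : 0 < dl n := by unfold dl; positivity

lemma tendsto_hP (q P : A) (hP : star P = P) (hPq : P * P ≤ q) :
    Tendsto (fun n => cfcₙ (hFun (dl n)) q * P) atTop (𝓝 P) := by
  rw [tendsto_iff_norm_sub_tendsto_zero]
  have h1 : Tendsto (fun n => Real.sqrt (dl n)) atTop (𝓝 0) := by
    have := (Real.continuous_sqrt.tendsto 0).comp tendsto_one_div_add_atTop_nhds_zero_nat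
    rw [Real.sqrt_zero] at this
    exact this
  refine squeeze_zero (fun _ => norm_nonneg _) (fun n => ?_) h1
  rw [norm_sub_rev]
  exact norm_P_sub q P hP hPq (dl_pos n)

/-- `p ≤ q` implies `d_n q d_n* → p`. -/
lemma tendsto_of_le (p q : A) (hp : 0 ≤ p) (hpq : p ≤ q) :
    ∃ d : ℕ → A, Tendsto (fun n => d n * q * star (d n)) atTop (𝓝 p) := by
  have hs := star_rt p
  have hss := rt_mul_rt p hp
  have ht := tendsto_hP q (rt p) hs (hss.trans_le hpq)
  refine ⟨fun n => rt p * cfcₙ (thFun (dl n)) q, ?_⟩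
  have h2 := ht.star.mul ht
  rw [hs, hss] at h2
  refine h2.congr fun n => ?_
  have := th_q_th q (hp.trans hpq) (dl_pos n) (dl_pos n)
  rw [star_mul, star_mul, hs, star_cfc, star_cfc]
  calc _ = rt p * (cfcₙ (hFun (dl n)) q * cfcₙ (hFun (dl n)) q) * rt p := by noncomm_ring
    _ = _ := by rw [← this]; noncomm_ring

/-- `p ≤ Y* Y` implies `p = w* w` with `w` a limit of elements `Y z`. -/
lemma exists_w (p Y : A) (hp : 0 ≤ p) (hpY : p ≤ star Y * Y) :
    ∃ w : A, star w * w = p ∧ w ∈ closure {x : A | ∃ z, x = Y * z} := by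
  set q := star Y * Y with hq
  have hs := star_rt p
  have hss := rt_mul_rt p hp
  have ht := tendsto_hP q (rt p) hs (hss.trans_le hpY)
  have hq0 := hp.trans hpY
  set W : ℕ → A := fun n => Y * (cfcₙ (thFun (dl n)) q * rt p) with hW
  have prod : ∀ n m, star (W n) * W m
      = star (cfcₙ (hFun (dl n)) q * rt p) * (cfcₙ (hFun (dl m)) q * rt p) := by
    intro n m
    have := th_q_th q hq0 (dl_pos n) (dl_pos m)
    simp only [hW]
    rw [star_mul, star_mul, star_mul, hs, star_cfc, star_cfc]
    calc _ = rt p * (cfcₙ (thFun (dl n)) q * (star Y * Y) * cfcₙ (thFun (dl m)) q) * rt p := by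
          noncomm_ring
      _ = _ := by rw [← hq, this]; noncomm_ring
  have ndist : ∀ n m, dist (W n) (W m)
      = dist (cfcₙ (hFun (dl n)) q * rt p) (cfcₙ (hFun (dl m)) q * rt p) := by
    intro n m
    rw [dist_eq_norm, dist_eq_norm, ← mul_self_inj (norm_nonneg _) (norm_nonneg _),
      ← CStarRing.norm_star_mul_self, ← CStarRing.norm_star_mul_self]
    congr 1
    simp only [star_sub, mul_sub, sub_mul, prod]
  have hC : CauchySeq W := by
    have h1 := ht.cauchySeq
    rw [Metric.cauchySeq_iff] at h1 ⊢
    simpa only [ndist] using h1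
  obtain ⟨w, hw⟩ := cauchySeq_tendsto_of_complete hC
  refine ⟨w, ?_, mem_closure_of_tendsto hw (Eventually.of_forall fun n => ⟨_, rfl⟩)⟩
  have h1 := hw.star.mul hw
  have h2 := ht.star.mul ht
  rw [hs, hss] at h2
  refine tendsto_nhds_unique h1 (h2.congr fun n => (prod n n).symm)

/-- closed right ideal generated by `b` -/
def RI (b : A) : Set A := closure {x : A | ∃ z, x = b * z}

lemma RI_mul (b u z : A) (hu : u ∈ RI b) : u * z ∈ RI b :=
  map_mem_closure (f := fun x => x * z) (by fun_prop) hu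
    (by rintro _ ⟨y, rfl⟩; exact ⟨y * z, mul_assoc _ _ _⟩)

lemma RI_sub (b u v : A) (hu : u ∈ RI b) (hv : v ∈ RI b) : u - v ∈ RI b :=
  map_mem_closure₂ (f := fun x y => x - y) (by fun_prop) hu hv
    (by rintro _ ⟨y, rfl⟩ _ ⟨z, rfl⟩; exact ⟨y - z, (mul_sub _ _ _).symm⟩)

lemma RI_trans (b Y w : A) (hY : Y ∈ RI b) (hw : w ∈ RI Y) : w ∈ RI b := by
  refine closure_minimal ?_ isClosed_closure hw
  rintro _ ⟨z, rfl⟩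
  exact RI_mul b Y z hY

lemma rt_mem_RI (b : A) (hb : 0 ≤ b) : rt b ∈ RI b := by
  have ht := tendsto_hP b (rt b) (star_rt b) (rt_mul_rt b hb).le
  refine mem_closure_of_tendsto ht (Eventually.of_forall fun n => ⟨cfcₙ (thFun (dl n)) b, ?_⟩)
  rw [id_mul_cfc b (k := fun t => t * thFun (dl n) t) hb (thFun_cont (dl_pos n)) (thFun_zero _)
      (fun t _ => rfl), rt]
  refine cfc_mul' b hb (hFun_cont (dl_pos n)) Real.continuous_sqrt (hFun_zero _)
    Real.sqrt_zero ?_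
  intro t _
  simp only [hFun, thFun]; ring

lemma RI_hered (b u : A) (hb : 0 ≤ b) (hu : u ∈ RI b) : u * star u ∈ Hered b := by
  refine map_mem_closure₂ (f := fun x y => x * star y) (by fun_prop) hu hu ?_
  rintro _ ⟨y, rfl⟩ _ ⟨z, rfl⟩
  refine ⟨y * star z, ?_⟩
  rw [star_mul, (IsSelfAdjoint.of_nonneg hb).star_eq]
  noncomm_ring

/-- `(a-ε)₊ ≤ f (x b x*) f` -/
lemma exists_f (a z : A) (ha : 0 ≤ a) (hz : IsSelfAdjoint z) (ε : ℝ) (hε : 0 < ε)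
    (h : ‖a - z‖ ≤ ε / 2) :
    ∃ f : A, star f = f ∧ cutPlusN ε a ≤ f * z * f := by
  set F : ℝ → ℝ := fun t => Real.sqrt (((t - ε) ⊔ 0) / ((t - ε / 2) ⊔ (ε / 2))) with hF
  have hpos : ∀ t : ℝ, 0 < (t - ε / 2) ⊔ (ε / 2) := fun t => lt_sup_of_lt_right (by linarith)
  have hFc : Continuous F := by
    refine Real.continuous_sqrt.comp (Continuous.div (by fun_prop) (by fun_prop) ?_)
    exact fun t => (hpos t).ne'
  have hF0 : F 0 = 0 := by
    have : (0 - ε) ⊔ 0 = 0 := sup_eq_right.2 (by linarith)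
    simp only [hF, this]; simp
  set f := cfcₙ F a with hf
  have hfs : star f = f := star_cfc a F
  refine ⟨f, hfs, ?_⟩
  have hle : f * (a - z) * f ≤ (ε / 2) • (f * f) := by
    have h1 := CStarAlgebra.star_right_conjugate_le_norm_smul (a := f) (b := a - z)
      ((IsSelfAdjoint.of_nonneg ha).sub hz)
    rw [hfs] at h1
    refine h1.trans ?_
    have h2 : 0 ≤ f * f := by
      have := star_mul_self_nonneg f
      rwa [hfs] at this
    exact smul_le_smul_of_nonneg_right h h2
  have e1 : f * f = cfcₙ (fun t => F t * F t) a :=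
    cfc_mul' a ha hFc hFc hF0 hF0 fun t _ => rfl
  have e2 : f * a * f = cfcₙ (fun t => F t * t * F t) a := by
    rw [hf, cfc_mul_id a (k := fun t => F t * t) ha hFc hF0 fun t _ => rfl]
    exact cfc_mul' a ha (by fun_prop) hFc (by simp) hF0 fun t _ => rfl
  have e3 : cutPlusN ε a = f * a * f - (ε / 2) • (f * f) := by
    rw [e1, e2, ← cfcₙ_smul (ε / 2) (fun t => F t * F t) a (by fun_prop) (by simp [hF0]),
      ← cfcₙ_sub (a := a) _ _ (by fun_prop) (by simp) (by fun_prop) (by simp [hF0]), cutPlusN]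
    refine cfcₙ_congr fun t _ => ?_
    have hsq : F t * F t = ((t - ε) ⊔ 0) / ((t - ε / 2) ⊔ (ε / 2)) :=
      Real.mul_self_sqrt (div_nonneg le_sup_right (hpos t).le)
    have : F t * t * F t - (ε / 2) • (F t * F t) = (F t * F t) * (t - ε / 2) := by
      rw [smul_eq_mul]; ring
    refine Eq.trans ?_ this.symm
    rw [hsq]
    show (t - ε) ⊔ 0 = _
    rcases le_total t ε with h | h
    · rw [sup_eq_right.2 (by linarith : t - ε ≤ 0)]; simp
    · rw [sup_eq_left.2 (by linarith : ε / 2 ≤ t - ε / 2)]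
      rw [div_mul_cancel₀]
      linarith
  have e4 : f * z * f = f * a * f - f * (a - z) * f := by noncomm_ring
  rw [e3, e4]
  exact sub_le_sub_left hle _

end Aux

/-- If `a ≾ b` in a C*-algebra `A` and `ε > 0`, then there are orthogonal positive elements
`a₀, c` in the hereditary subalgebra generated by `b` with `a₀ ∼ (a - 2ε)₊` and
`b ≾ (a - ε)₊ ⊕ c`. -/
theorem exists_almost_complement [NonUnitalCStarAlgebra A]
    [PartialOrder A] [StarOrderedRing A]
    (a b : A) (ha : 0 ≤ a) (hb : 0 ≤ b) (hab : CuntzLE (m1 a) (m1 b))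
    (ε : ℝ) (hε : 0 < ε) :
    ∃ a₀ c : A, 0 ≤ a₀ ∧ 0 ≤ c ∧ a₀ ∈ Hered b ∧ c ∈ Hered b ∧ a₀ * c = 0 ∧
      EquivPos a₀ (cutPlusN (2 * ε) a) ∧
      CuntzLE (m1 b) (dsum (m1 (cutPlusN ε a)) (m1 c)) := by
  obtain ⟨x, hx⟩ : ∃ x : A, ‖a - x * b * star x‖ ≤ ε / 2 := by
    obtain ⟨X, hX⟩ := hab
    have h1 : Tendsto (fun k => X k 0 0 * b * star (X k 0 0)) atTop (𝓝 a) := by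
      have h2 := (tendsto_pi_nhds.1 (tendsto_pi_nhds.1 hX 0)) 0
      simpa [Matrix.mul_apply, m1] using h2
    obtain ⟨k, hk⟩ := (Metric.tendsto_nhds.1 h1 (ε / 2) (by linarith)).exists
    refine ⟨X k 0 0, ?_⟩
    rw [dist_comm, dist_eq_norm] at hk
    exact hk.le
  have hbs : star b = b := (IsSelfAdjoint.of_nonneg hb).star_eq
  have hz : IsSelfAdjoint (x * b * star x) := by
    rw [isSelfAdjoint_iff]; simp only [star_mul, star_star, hbs, mul_assoc]
  obtain ⟨f, hfs, hf⟩ := exists_f a _ ha hz ε hε hx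
  set s := rt b with hs
  have hss : s * s = b := rt_mul_rt b hb
  have hsstar : star s = s := star_rt b
  have hsR : s ∈ RI b := rt_mem_RI b hb
  set p := cutPlusN ε a with hp
  have hp0 : 0 ≤ p := cfcₙ_nonneg fun t _ => le_sup_right
  have hYY : f * (x * b * star x) * f = star (s * (star x * f)) * (s * (star x * f)) := by
    simp only [star_mul, star_star, hfs, hsstar, ← hss, mul_assoc]
  rw [hYY] at hf
  obtain ⟨w, hwp, hwY⟩ := exists_w p _ hp0 hf
  have hwR : w ∈ RI b := RI_trans b _ w (RI_mul b s _ hsR) hwY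
  -- functions of a
  set Ps : ℝ → ℝ := fun t => Real.sqrt (((t - 2 * ε) ⊔ 0) / ((t - ε) ⊔ ε)) with hPs
  set Gf : ℝ → ℝ := fun t => ((t - ε) ⊔ 0) / ((t - ε) ⊔ ε) ^ 2 with hGf
  have hpos : ∀ t : ℝ, 0 < (t - ε) ⊔ ε := fun t => lt_sup_of_lt_right hε
  have hPc : Continuous Ps := by
    refine Real.continuous_sqrt.comp (Continuous.div (by fun_prop) (by fun_prop) ?_)
    exact fun t => (hpos t).ne'
  have hGc : Continuous Gf := by
    refine Continuous.div (by fun_prop) (by fun_prop) ?_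
    exact fun t => pow_ne_zero _ (hpos t).ne'
  have hP0 : Ps 0 = 0 := by
    have : (0 - 2 * ε) ⊔ 0 = 0 := sup_eq_right.2 (by linarith)
    simp only [hPs, this]; simp
  have hq0 : ((0 : ℝ) - ε) ⊔ 0 = 0 := sup_eq_right.2 (by linarith)
  have hG0 : Gf 0 = 0 := by
    simp only [hGf, hq0]; simp
  have hpc : Continuous (fun t : ℝ => (t - ε) ⊔ 0) := by fun_prop
  set φ := cfcₙ Ps a with hφ
  set g := cfcₙ Gf a with hg
  have hφs : star φ = φ := star_cfc a _
  have hgs : star g = g := star_cfc a _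
  have hφp : φ * p * φ = cutPlusN (2 * ε) a := by
    have e : φ * p = cfcₙ (fun t => Ps t * ((t - ε) ⊔ 0)) a :=
      cfc_mul' a ha hPc hpc hP0 hq0 fun t _ => rfl
    rw [e]
    refine cfc_mul' a ha (by fun_prop) hPc (by simp [hP0]) hP0 fun t _ => ?_
    have hsq : Ps t * Ps t = ((t - 2 * ε) ⊔ 0) / ((t - ε) ⊔ ε) :=
      Real.mul_self_sqrt (div_nonneg le_sup_right (hpos t).le)
    have : Ps t * ((t - ε) ⊔ 0) * Ps t = (Ps t * Ps t) * ((t - ε) ⊔ 0) := by ring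
    rw [this, hsq]
    rcases le_total t (2 * ε) with h | h
    · rw [sup_eq_right.2 (by linarith : t - 2 * ε ≤ 0)]; simp
    · rw [sup_eq_left.2 (by linarith : ε ≤ t - ε), sup_eq_left.2 (by linarith : 0 ≤ t - ε)]
      rw [div_mul_cancel₀]
      linarith
  have hφg : φ * p * g = φ := by
    have e : φ * p = cfcₙ (fun t => Ps t * ((t - ε) ⊔ 0)) a :=
      cfc_mul' a ha hPc hpc hP0 hq0 fun t _ => rfl
    rw [e]
    refine cfc_mul' a ha (by fun_prop) hGc (by simp [hP0]) hG0 fun t _ => ?_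
    rcases le_total t (2 * ε) with h | h
    · have : Ps t = 0 := by
        simp only [hPs]
        rw [sup_eq_right.2 (by linarith : t - 2 * ε ≤ 0)]; simp
      simp [this]
    · simp only [hGf]
      rw [sup_eq_left.2 (by linarith : ε ≤ t - ε), sup_eq_left.2 (by linarith : 0 ≤ t - ε)]
      have : t - ε ≠ 0 := by linarith
      field_simp
  set G := w * g * star w with hG
  have hGs : star G = G := by simp only [hG, star_mul, star_star, hgs, mul_assoc]
  set y := s - G * s with hy
  have hyR : y ∈ RI b := by
    refine RI_sub b _ _ hsR ?_
    have : G * s = w * (g * star w * s) := by simp only [hG, mul_assoc]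
    rw [this]
    exact RI_mul b w _ hwR
  have hyy : y * star y = b - G * b - b * G + G * b * G := by
    rw [hy, star_sub, star_mul, hGs, hsstar, ← hss]; noncomm_ring
  refine ⟨(w * φ) * star (w * φ), y * star y, mul_star_self_nonneg _, mul_star_self_nonneg _,
    RI_hered b _ hb (RI_mul b w φ hwR), RI_hered b _ hb hyR, ?_, ?_, ?_⟩
  · have h1 : star (w * φ) * y = 0 := by
      have : star (w * φ) * (G * s) = φ * (star w * w) * g * (star w * s) := by
        simp only [hG, star_mul, hφs, mul_assoc]
      rw [hy, mul_sub, this, hwp, hφg, star_mul, hφs, mul_assoc, sub_self]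
    rw [mul_assoc, ← mul_assoc (star (w * φ)), h1]; simp
  · refine ⟨star (w * φ), by rw [star_star], ?_⟩
    rw [star_star, star_mul, hφs, ← hφp, ← hwp]; simp only [mul_assoc]
  · set c := y * star y with hc
    set q := (2 : ℝ) • (‖b‖ • (w * g * p * g * star w) + c) with hq
    have hbq : b ≤ q := by
      have h1 : b ≤ (2 : ℝ) • (G * b * G + c) := by
        rw [← sub_nonneg]
        have h2 := mul_star_self_nonneg (s - (2 : ℝ) • (G * s))
        have h3 : (s - (2 : ℝ) • (G * s)) * star (s - (2 : ℝ) • (G * s))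
            = (2 : ℝ) • (G * b * G + c) - b := by
          rw [hyy, ← hss]
          simp only [two_smul, star_sub, star_add, star_mul, hGs, hsstar]
          noncomm_ring
        rwa [h3] at h2
      refine h1.trans ?_
      have h4 : G * b * G ≤ ‖b‖ • (w * g * p * g * star w) := by
        have h5 := CStarAlgebra.star_right_conjugate_le_norm_smul (a := G) (b := b)
          (IsSelfAdjoint.of_nonneg hb)
        rw [hGs] at h5
        have h6 : G * G = w * g * p * g * star w := by
          rw [← hwp]; simp only [hG, mul_assoc]
        rwa [h6] at h5
      rw [hq, two_smul, two_smul]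
      exact add_le_add (add_le_add_left h4 _) (add_le_add_left h4 _)
    obtain ⟨d, hd⟩ := tendsto_of_le b q hb hbq
    refine ⟨fun n => Matrix.of fun _ j => Sum.elim
      (fun _ => Real.sqrt (2 * ‖b‖) • (d n * w * g)) (fun _ => Real.sqrt 2 • d n) j, ?_⟩
    refine tendsto_pi_nhds.2 fun i => tendsto_pi_nhds.2 fun j => ?_
    refine hd.congr fun n => ?_
    have hb2 : Real.sqrt (2 * ‖b‖) * Real.sqrt (2 * ‖b‖) = 2 * ‖b‖ :=
      Real.mul_self_sqrt (by positivity)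
    have h22 : Real.sqrt 2 * Real.sqrt 2 = 2 := Real.mul_self_sqrt (by norm_num)
    simp only [Matrix.mul_apply, dsum, m1, Fintype.sum_sum_type, Finset.univ_unique,
      Finset.sum_singleton, Matrix.of_apply, Matrix.conjTranspose_apply, Matrix.fromBlocks_apply₁₁,
      Matrix.fromBlocks_apply₁₂, Matrix.fromBlocks_apply₂₁, Matrix.fromBlocks_apply₂₂,
      Sum.elim_inl, Sum.elim_inr, Matrix.zero_apply, mul_zero, add_zero, zero_add]
    rw [hq]
    simp only [star_smul, star_trivial, star_mul, hgs, smul_mul_assoc, mul_smul_comm, smul_smul,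
      hb2, h22, mul_add, add_mul, smul_add, mul_assoc]
end
end

section
/- Let A be a C*-algebra, let a, b be positive elements of A with a ≾ b, let d be a lower semicontinuous dimension function on A, and let δ > 0. Then there exists ε₀ > 0 such that for every ε with 0 < ε ≤ ε₀ there exist positive elements a_0 and c in the closure of bAb with a_0 c = 0, a_0 ∼ (a − 2ε)₊, b ≾ (a − ε)₊ ⊕ c, and d(b) − d(a) ≤ d(c) ≤ d(b) − d(a) + δ. -/
open Filter Topology

noncomputable section

variable {A : Type*}

/-- The block-diagonal direct sum, reindexed so that `Mₙ(A) ⊕ Mₘ(A) ⊆ M_{n+m}(A)`. -/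
def dsumF [NonUnitalCStarAlgebra A] {n m : ℕ} (a : Matrix (Fin n) (Fin n) A)
    (b : Matrix (Fin m) (Fin m) A) : Matrix (Fin (n + m)) (Fin (n + m)) A :=
  Matrix.reindex finSumFinEquiv finSumFinEquiv (dsum a b)

/-- A dimension function on a C*-algebra `A`: an additive, order preserving assignment of
nonnegative reals to the positive elements of all matrix algebras over `A`. -/
structure DimensionFunction (A : Type*) [NonUnitalCStarAlgebra A] where
  d : ∀ n : ℕ, Matrix (Fin n) (Fin n) A → ℝ
  nonneg : ∀ (n : ℕ) (a : Matrix (Fin n) (Fin n) A), IsPos a → 0 ≤ d n a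
  add : ∀ (n m : ℕ) (a : Matrix (Fin n) (Fin n) A) (b : Matrix (Fin m) (Fin m) A),
    IsPos a → IsPos b → d (n + m) (dsumF a b) = d n a + d m b
  mono : ∀ (n m : ℕ) (a : Matrix (Fin n) (Fin n) A) (b : Matrix (Fin m) (Fin m) A),
    IsPos a → IsPos b → CuntzLE a b → d n a ≤ d m b

/-- Lower semicontinuity of a dimension function: `d(aₙ) → d(a)` for every monotone increasing
sequence of positive elements converging in norm to `a`. -/
def DimensionFunction.IsLSC [NonUnitalCStarAlgebra A] (D : DimensionFunction A) : Prop :=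
  ∀ (n : ℕ) (s : ℕ → Matrix (Fin n) (Fin n) A) (l : Matrix (Fin n) (Fin n) A),
    (∀ k, IsPos (s k)) → (∀ k, IsPos (s (k + 1) - s k)) →
    Tendsto s atTop (nhds l) →
    Tendsto (fun k => D.d n (s k)) atTop (nhds (D.d n l))

section Helpers

theorem fmul [NonUnitalCStarAlgebra A] {f g : ℝ → ℝ} (q : A)
    (hf : Continuous f ∧ f 0 = 0) (hg : Continuous g ∧ g 0 = 0) :
    cfcₙ f q * cfcₙ g q = cfcₙ (fun t => f t * g t) q :=
  (cfcₙ_mul f g q hf.1.continuousOn hf.2 hg.1.continuousOn hg.2).symm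

theorem fsub [NonUnitalCStarAlgebra A] {f g : ℝ → ℝ} (q : A)
    (hf : Continuous f ∧ f 0 = 0) (hg : Continuous g ∧ g 0 = 0) :
    cfcₙ f q - cfcₙ g q = cfcₙ (fun t => f t - g t) q :=
  (cfcₙ_sub f g q hf.1.continuousOn hf.2 hg.1.continuousOn hg.2).symm

theorem fadd [NonUnitalCStarAlgebra A] {f g : ℝ → ℝ} (q : A)
    (hf : Continuous f ∧ f 0 = 0) (hg : Continuous g ∧ g 0 = 0) :
    cfcₙ f q + cfcₙ g q = cfcₙ (fun t => f t + g t) q :=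
  (cfcₙ_add f g q hf.1.continuousOn hf.2 hg.1.continuousOn hg.2).symm

theorem fsa [NonUnitalCStarAlgebra A] (f : ℝ → ℝ) (q : A) :
    star (cfcₙ f q) = cfcₙ f q :=
  (cfcₙ_predicate (R := ℝ) (p := IsSelfAdjoint) f q).star_eq

theorem vid : Continuous (fun t : ℝ => t) ∧ (fun t : ℝ => t) 0 = 0 := ⟨continuous_id, rfl⟩

theorem vmul {f g : ℝ → ℝ} (hf : Continuous f ∧ f 0 = 0) (hg : Continuous g ∧ g 0 = 0) :
    Continuous (fun t => f t * g t) ∧ (fun t => f t * g t) 0 = 0 :=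
  ⟨hf.1.mul hg.1, by simp [hf.2]⟩

theorem vsub {f g : ℝ → ℝ} (hf : Continuous f ∧ f 0 = 0) (hg : Continuous g ∧ g 0 = 0) :
    Continuous (fun t => f t - g t) ∧ (fun t => f t - g t) 0 = 0 :=
  ⟨hf.1.sub hg.1, by simp [hf.2, hg.2]⟩

theorem vadd' {f g : ℝ → ℝ} (hf : Continuous f ∧ f 0 = 0) (hg : Continuous g ∧ g 0 = 0) :
    Continuous (fun t => f t + g t) ∧ (fun t => f t + g t) 0 = 0 :=
  ⟨hf.1.add hg.1, by simp [hf.2, hg.2]⟩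

theorem vsqrt : Continuous Real.sqrt ∧ Real.sqrt 0 = 0 := ⟨Real.continuous_sqrt, by simp⟩

/-- The regularised inverse square root. -/
def kf (η t : ℝ) : ℝ := Real.sqrt t / (|t| + η)

theorem vkf {η : ℝ} (h : 0 < η) : Continuous (kf η) ∧ kf η 0 = 0 := by
  refine ⟨?_, by simp [kf]⟩
  unfold kf
  exact Real.continuous_sqrt.div (by fun_prop) (fun t => by positivity)

theorem tkk {η t : ℝ} (ht : 0 ≤ t) : kf η t * t * kf η t = t ^ 2 / (t + η) ^ 2 := by
  unfold kf
  rw [abs_of_nonneg ht]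
  have := Real.mul_self_sqrt ht
  rw [div_mul_eq_mul_div, div_mul_div_comm, sq, sq]
  congr 1
  nlinarith

theorem bound1 {η t : ℝ} (h : 0 < η) (ht : 0 ≤ t) :
    t * (1 - t ^ 2 / (t + η) ^ 2) ^ 2 ≤ η := by
  have h1 : 1 - t ^ 2 / (t + η) ^ 2 = η * (2 * t + η) / (t + η) ^ 2 := by
    field_simp; ring
  have h2 : η * (2 * t + η) / (t + η) ^ 2 ≤ 2 * η / (t + η) := by
    rw [div_le_div_iff₀ (by positivity) (by positivity)]
    nlinarith [mul_nonneg (mul_nonneg h.le h.le) (by positivity : 0 ≤ t + η)]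
  rw [h1]
  calc _ ≤ t * (2 * η / (t + η)) ^ 2 := by gcongr
    _ = (4 * t * η / (t + η) ^ 2) * η := by field_simp; ring
    _ ≤ 1 * η := by
      gcongr
      rw [div_le_one (by positivity)]
      nlinarith [sq_nonneg (t - η)]
    _ = η := one_mul _

theorem bound2a {η t : ℝ} (h : 0 < η) (ht : 0 ≤ t) :
    0 ≤ Real.sqrt t - t * kf η t ∧ (Real.sqrt t - t * kf η t) ^ 2 ≤ η := by
  unfold kf
  rw [abs_of_nonneg ht]
  have h1 : Real.sqrt t - t * (Real.sqrt t / (t + η)) = Real.sqrt t * (η / (t + η)) := by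
    field_simp; ring
  rw [h1]
  refine ⟨by positivity, ?_⟩
  rw [mul_pow, Real.sq_sqrt ht, div_pow, ← mul_div_assoc, div_le_iff₀ (by positivity)]
  nlinarith [mul_nonneg h.le (sq_nonneg t), mul_nonneg ht (sq_nonneg η), pow_pos h 3]

theorem bound2 {η θ t : ℝ} (h : 0 < η) (h' : 0 < θ) (ht : 0 ≤ t) :
    (t * (kf η t - kf θ t)) ^ 2 ≤ η + θ := by
  obtain ⟨a1, a2⟩ := bound2a h ht
  obtain ⟨b1, b2⟩ := bound2a h' ht
  nlinarith [mul_nonneg a1 b1]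

/-- Approximate unit-like element `q^2/(q+η)^2`. -/
def Mq [NonUnitalCStarAlgebra A] (η : ℝ) (q : A) : A := cfcₙ (kf η) q * q * cfcₙ (kf η) q

theorem Mq_eq [NonUnitalCStarAlgebra A] [PartialOrder A] [StarOrderedRing A] {η : ℝ} (h : 0 < η)
    (q : A) (hq : 0 ≤ q) :
    Mq η q = cfcₙ (fun t => kf η t * t * kf η t) q := by
  have hid : cfcₙ (fun t : ℝ => t) q = q := cfcₙ_id' ℝ q
  unfold Mq
  conv_lhs => enter [1, 2]; rw [← hid]
  rw [fmul q (vkf h) vid, fmul q (vmul (vkf h) vid) (vkf h)]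

theorem Mq_sa [NonUnitalCStarAlgebra A] [PartialOrder A] [StarOrderedRing A] {η : ℝ} 
    (q : A) (hq : 0 ≤ q) : star (Mq η q) = Mq η q := by
  unfold Mq
  simp [fsa, (IsSelfAdjoint.of_nonneg hq).star_eq, mul_assoc]

theorem conj_mono [NonUnitalCStarAlgebra A] [PartialOrder A] [StarOrderedRing A]
    {p q m : A} (hpq : p ≤ q) (hm : star m = m) :
    p - m * p - p * m + m * p * m ≤ q - m * q - q * m + m * q * m := by
  have h : 0 ≤ q - p := sub_nonneg.2 hpq
  have h2 := CFC.sqrt_mul_sqrt_self (q - p) h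
  set y := CFC.sqrt (q - p)
  have hy : star y = y := (IsSelfAdjoint.of_nonneg (CFC.sqrt_nonneg (q-p))).star_eq
  have h3 := star_mul_self_nonneg (y - y * m)
  rw [← sub_nonneg]
  convert h3 using 1
  simp only [star_sub, star_mul, hy, hm]
  have : (y - m * y) * (y - y * m) = y * y - m * (y * y) - y * y * m + m * (y * y) * m := by
    noncomm_ring
  rw [this, h2]
  noncomm_ring

theorem approx1 [NonUnitalCStarAlgebra A] [PartialOrder A] [StarOrderedRing A]
    {r q : A} (h : star r * r ≤ q) {η : ℝ} (hη : 0 < η) :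
    ‖r - r * Mq η q‖ * ‖r - r * Mq η q‖ ≤ η := by
  have hq : 0 ≤ q := (star_mul_self_nonneg r).trans h
  have hid : cfcₙ (fun t : ℝ => t) q = q := cfcₙ_id' ℝ q
  rw [← CStarRing.norm_star_mul_self]
  have hM := Mq_sa (η := η) q hq
  have e1 : star (r - r * Mq η q) * (r - r * Mq η q) =
      star r * r - Mq η q * (star r * r) - star r * r * Mq η q
        + Mq η q * (star r * r) * Mq η q := by
    simp only [star_sub, star_mul, hM]; noncomm_ring
  have h1 : star (r - r * Mq η q) * (r - r * Mq η q) ≤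
      q - Mq η q * q - q * Mq η q + Mq η q * q * Mq η q := by
    rw [e1]; exact conj_mono h hM
  refine (CStarAlgebra.norm_le_norm_of_nonneg_of_le (star_mul_self_nonneg _) h1).trans ?_
  have vM := vmul (vmul (vkf hη) vid) (vkf hη)
  have e2 : q - Mq η q * q - q * Mq η q + Mq η q * q * Mq η q =
    cfcₙ (fun t => t - (kf η t * t * kf η t) * t - t * (kf η t * t * kf η t) +
      (kf η t * t * kf η t) * t * (kf η t * t * kf η t)) q := by
    rw [Mq_eq hη q hq]
    conv_lhs =>
      rw [show ∀ m : A, q - m * q - q * m + m * q * m = cfcₙ (fun t : ℝ => t) q -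
        m * cfcₙ (fun t : ℝ => t) q - cfcₙ (fun t : ℝ => t) q * m +
        m * cfcₙ (fun t : ℝ => t) q * m from fun m => by rw [hid]]
    rw [fmul q vM vid, fmul q vid vM, fmul q (vmul vM vid) vM, fsub q vid (vmul vM vid),
      fsub q (vsub vid (vmul vM vid)) (vmul vid vM),
      fadd q (vsub (vsub vid (vmul vM vid)) (vmul vid vM)) (vmul (vmul vM vid) vM)]
  rw [e2]
  refine norm_cfcₙ_le fun t ht => ?_
  have ht0 : 0 ≤ t := quasispectrum_nonneg_of_nonneg q hq t ht
  simp only [tkk ht0]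
  have := bound1 hη ht0
  rw [show t - t ^ 2 / (t + η) ^ 2 * t - t * (t ^ 2 / (t + η) ^ 2) +
     t ^ 2 / (t + η) ^ 2 * t * (t ^ 2 / (t + η) ^ 2) = t * (1 - t ^ 2 / (t + η) ^ 2) ^ 2 by ring]
  rw [Real.norm_of_nonneg (by positivity)]
  exact this

theorem approx2 [NonUnitalCStarAlgebra A] [PartialOrder A] [StarOrderedRing A]
    {r s : A} (h : star r * r ≤ star s * s) {η θ : ℝ} (hη : 0 < η) (hθ : 0 < θ) :
    ‖r * cfcₙ (kf η) (star s * s) * star s - r * cfcₙ (kf θ) (star s * s) * star s‖ *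
    ‖r * cfcₙ (kf η) (star s * s) * star s - r * cfcₙ (kf θ) (star s * s) * star s‖ ≤ η + θ := by
  have hq : 0 ≤ star s * s := star_mul_self_nonneg s
  obtain ⟨q, hqd⟩ : ∃ q, q = star s * s := ⟨_, rfl⟩
  rw [← hqd] at h hq ⊢
  have hid : cfcₙ (fun t : ℝ => t) q = q := cfcₙ_id' ℝ q
  have vψ := vsub (vkf hη) (vkf hθ)
  obtain ⟨ψ, hψ⟩ : ∃ ψ, ψ = cfcₙ (fun t => kf η t - kf θ t) q := ⟨_, rfl⟩
  have hψs : star ψ = ψ := by rw [hψ, fsa]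
  have e0 : r * cfcₙ (kf η) q * star s - r * cfcₙ (kf θ) q * star s = r * ψ * star s := by
    rw [hψ, ← fsub q (vkf hη) (vkf hθ)]; noncomm_ring
  obtain ⟨y, hy⟩ : ∃ y, y = cfcₙ Real.sqrt q := ⟨_, rfl⟩
  have hys : star y = y := by rw [hy, fsa]
  have hyy : y * y = q := by
    rw [hy, fmul q vsqrt vsqrt]
    conv_rhs => rw [← hid]
    exact cfcₙ_congr fun t ht => Real.mul_self_sqrt (quasispectrum_nonneg_of_nonneg q hq t ht)
  rw [e0, ← CStarRing.norm_self_mul_star]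
  have e1 : r * ψ * star s * star (r * ψ * star s) = (r * ψ * y) * star (r * ψ * y) := by
    have : r * ψ * star s * star (r * ψ * star s) = r * ψ * (star s * s) * ψ * star r := by
      simp [hψs, mul_assoc]
    rw [this, ← hqd, ← hyy]; simp [hψs, hys, mul_assoc]
  rw [e1, CStarRing.norm_self_mul_star, ← CStarRing.norm_star_mul_self]
  have h1 : star (r * ψ * y) * (r * ψ * y) ≤ star (ψ * y) * q * (ψ * y) := by
    have := star_left_conjugate_le_conjugate h (ψ * y)
    simpa [mul_assoc] using this
  refine (CStarAlgebra.norm_le_norm_of_nonneg_of_le (star_mul_self_nonneg _) h1).trans ?_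
  rw [star_mul, hψs, hys, hψ, hy]
  conv_lhs => enter [1, 1, 2]; rw [← hid]
  rw [fmul q vsqrt vψ, fmul q vψ vsqrt, fmul q (vmul vsqrt vψ) vid,
    fmul q (vmul (vmul vsqrt vψ) vid) (vmul vψ vsqrt)]
  refine norm_cfcₙ_le fun t ht => ?_
  have ht0 : 0 ≤ t := quasispectrum_nonneg_of_nonneg q hq t ht
  have := bound2 hη hθ ht0
  rw [show √t * (kf η t - kf θ t) * t * ((kf η t - kf θ t) * √t) =
    (√t * √t) * t * (kf η t - kf θ t) ^ 2 by ring, Real.mul_self_sqrt ht0,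
    Real.norm_of_nonneg (by positivity)]
  linarith

/-- The sequence `1/(n+1)`. -/
def en (n : ℕ) : ℝ := 1 / ((n : ℝ) + 1)

theorem en_pos (n : ℕ) : 0 < en n := by unfold en; positivity

theorem en_tendsto : Tendsto en atTop (𝓝 0) := tendsto_one_div_add_atTop_nhds_zero_nat

theorem tendsto_of_normsq [NonUnitalCStarAlgebra A] {u : ℕ → A} {l : A}
    (h : ∀ n, ‖l - u n‖ * ‖l - u n‖ ≤ en n) : Tendsto u atTop (𝓝 l) := by
  rw [tendsto_iff_norm_sub_tendsto_zero]
  have h1 : Tendsto (fun n => Real.sqrt (en n)) atTop (𝓝 0) := by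
    have := (Real.continuous_sqrt.tendsto 0).comp en_tendsto
    rw [Real.sqrt_zero] at this
    exact this
  refine squeeze_zero (fun n => norm_nonneg _) (fun n => ?_) h1
  rw [norm_sub_rev]
  exact Real.le_sqrt_of_sq_le (by rw [sq]; exact h n)

theorem tendsto_M [NonUnitalCStarAlgebra A] [PartialOrder A] [StarOrderedRing A]
    {r q : A} (h : star r * r ≤ q) : Tendsto (fun n => r * Mq (en n) q) atTop (𝓝 r) :=
  tendsto_of_normsq fun n => approx1 h (en_pos n)

/-- `r r* ≾ q` if `r* r ≤ q`. -/
theorem tendsto_conj [NonUnitalCStarAlgebra A] [PartialOrder A] [StarOrderedRing A]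
    {r q : A} (h : star r * r ≤ q) :
    Tendsto (fun n => (r * cfcₙ (kf (en n)) q) * q * star (r * cfcₙ (kf (en n)) q)) atTop
      (𝓝 (r * star r)) := by
  refine ((tendsto_M h).mul_const (star r)).congr fun n => ?_
  simp [Mq, fsa, mul_assoc]

theorem exists_z [NonUnitalCStarAlgebra A] [PartialOrder A] [StarOrderedRing A]
    {p s : A} (hp : 0 ≤ p) (h : p ≤ star s * s) :
    ∃ (z : A) (y : ℕ → A), Tendsto (fun n => y n * star s) atTop (𝓝 z) ∧ z * star z = p := by
  have h2 := CFC.sqrt_mul_sqrt_self p hp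
  set r := CFC.sqrt p
  have hr : star r = r := (IsSelfAdjoint.of_nonneg (CFC.sqrt_nonneg p)).star_eq
  have h' : star r * r ≤ star s * s := by rw [hr, h2]; exact h
  have hc : CauchySeq (fun n => r * cfcₙ (kf (en n)) (star s * s) * star s) := by
    rw [Metric.cauchySeq_iff']
    intro ε hε
    have : ∀ᶠ n in atTop, en n < ε ^ 2 / 2 := en_tendsto.eventually_lt_const (by positivity)
    obtain ⟨N, hN⟩ := eventually_atTop.1 this
    refine ⟨N, fun n hn => ?_⟩
    rw [dist_eq_norm]
    have := approx2 h' (en_pos n) (en_pos N)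
    have h3 := hN n hn
    have h4 := hN N le_rfl
    by_contra hcon
    push Not at hcon
    nlinarith
  obtain ⟨z, hz⟩ := cauchySeq_tendsto_of_complete hc
  refine ⟨z, _, hz, ?_⟩
  have h5 := hz.mul hz.star
  refine (tendsto_nhds_unique h5 ((tendsto_conj h').congr fun n => ?_)).trans (by rw [hr, h2])
  simp [mul_assoc]

/-- Elements `x` on which the approximate unit of `b` acts from the right. -/
def TT [NonUnitalCStarAlgebra A] (b : A) : Set A :=
  {x | Tendsto (fun n => x * Mq (en n) b) atTop (𝓝 x)}

theorem norm_Mq [NonUnitalCStarAlgebra A] [PartialOrder A] [StarOrderedRing A]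
    {b : A} (hb : 0 ≤ b) {η : ℝ} (hη : 0 < η) : ‖Mq η b‖ ≤ 1 := by
  rw [Mq_eq hη b hb]
  refine norm_cfcₙ_le fun t ht => ?_
  have ht0 : 0 ≤ t := quasispectrum_nonneg_of_nonneg b hb t ht
  rw [tkk ht0, Real.norm_of_nonneg (by positivity), div_le_one (by positivity)]
  gcongr
  linarith

theorem TT_lim [NonUnitalCStarAlgebra A] [PartialOrder A] [StarOrderedRing A]
    {b : A} (hb : 0 ≤ b) {y : ℕ → A} {z : A} (hy : ∀ n, y n ∈ TT b)
    (h : Tendsto y atTop (𝓝 z)) : z ∈ TT b := by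
  show Tendsto _ _ _
  rw [Metric.tendsto_atTop] at h ⊢
  intro ε hε
  obtain ⟨N, hN⟩ := h (ε / 3) (by positivity)
  have h1 := hN N le_rfl
  obtain ⟨K, hK⟩ := (Metric.tendsto_atTop.1 (hy N)) (ε / 3) (by positivity)
  refine ⟨K, fun n hn => ?_⟩
  have h2 := hK n hn
  rw [dist_eq_norm] at h1 h2 ⊢
  have e : z * Mq (en n) b - z =
      (y N * Mq (en n) b - y N) + (y N - z) - (y N - z) * Mq (en n) b := by noncomm_ring
  have h3 : ‖(y N - z) * Mq (en n) b‖ ≤ ‖y N - z‖ := by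
    refine (norm_mul_le _ _).trans ?_
    exact mul_le_of_le_one_right (norm_nonneg _) (norm_Mq hb (en_pos n))
  rw [e]
  have h4 := norm_sub_le ((y N * Mq (en n) b - y N) + (y N - z)) ((y N - z) * Mq (en n) b)
  have h5 := norm_add_le (y N * Mq (en n) b - y N) (y N - z)
  linarith

theorem TT_mul [NonUnitalCStarAlgebra A] {b x : A} (y : A) (h : x ∈ TT b) : y * x ∈ TT b := by
  have h' : Tendsto _ _ _ := h
  exact (h'.const_mul y).congr fun n => by rw [mul_assoc]

theorem TT_sub [NonUnitalCStarAlgebra A] {b x y : A} (h : x ∈ TT b) (h2 : y ∈ TT b) :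
    x - y ∈ TT b := by
  have h' : Tendsto _ _ _ := h
  have h2' : Tendsto _ _ _ := h2
  exact (h'.sub h2').congr fun n => by rw [sub_mul]

theorem TT_sqrt [NonUnitalCStarAlgebra A] [PartialOrder A] [StarOrderedRing A]
    {b : A} (hb : 0 ≤ b) : CFC.sqrt b ∈ TT b := by
  refine tendsto_M ?_
  rw [(IsSelfAdjoint.of_nonneg (CFC.sqrt_nonneg b)).star_eq, CFC.sqrt_mul_sqrt_self b hb]

theorem TT_hered [NonUnitalCStarAlgebra A] [PartialOrder A] [StarOrderedRing A]
    {b x : A} (hb : 0 ≤ b) (h : x ∈ TT b) : star x * x ∈ Hered b := by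
  have h' : Tendsto _ _ _ := h
  have hid : cfcₙ (fun t : ℝ => t) b = b := cfcₙ_id' ℝ b
  refine mem_closure_of_tendsto (h'.star.mul h') (Eventually.of_forall fun n => ?_)
  have v := vkf (en_pos n)
  have hM : ∃ l : A, Mq (en n) b = b * l ∧ Mq (en n) b = l * b := by
    refine ⟨cfcₙ (fun t => kf (en n) t * kf (en n) t) b, ?_, ?_⟩
    · rw [Mq_eq (en_pos n) b hb]
      conv_rhs => enter [1]; rw [← hid]
      rw [fmul b vid (vmul v v)]
      exact congrArg (fun f => cfcₙ f b) (funext fun t => by ring)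
    · rw [Mq_eq (en_pos n) b hb]
      conv_rhs => enter [2]; rw [← hid]
      rw [fmul b (vmul v v) vid]
      exact congrArg (fun f => cfcₙ f b) (funext fun t => by ring)
  obtain ⟨l, h1, h2⟩ := hM
  refine ⟨l * star x * x * l, ?_⟩
  rw [star_mul, Mq_sa b hb]
  conv_lhs => enter [1, 1]; rw [h1]
  conv_lhs => enter [2, 2]; rw [h2]
  simp only [mul_assoc]

theorem cuntz_m1 [NonUnitalCStarAlgebra A] {a b : A} :
    CuntzLE (m1 a) (m1 b) ↔ ∃ x : ℕ → A, Tendsto (fun n => x n * b * star (x n)) atTop (𝓝 a) := by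
  constructor
  · rintro ⟨x, hx⟩
    refine ⟨fun n => x n 0 0, ?_⟩
    have h := (tendsto_pi_nhds.1 ((tendsto_pi_nhds.1 hx) 0)) 0
    simpa [Matrix.mul_apply, m1] using h
  · rintro ⟨x, hx⟩
    refine ⟨fun n => m1 (x n), ?_⟩
    refine tendsto_pi_nhds.2 fun i => tendsto_pi_nhds.2 fun j => ?_
    simpa [Matrix.mul_apply, m1] using hx

theorem cuntz_of_star [NonUnitalCStarAlgebra A] [PartialOrder A] [StarOrderedRing A]
    {r q : A} (h : star r * r ≤ q) : CuntzLE (m1 (r * star r)) (m1 q) :=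
  cuntz_m1.2 ⟨_, tendsto_conj h⟩

theorem cuntz_of_le [NonUnitalCStarAlgebra A] [PartialOrder A] [StarOrderedRing A]
    {p q : A} (hp : 0 ≤ p) (h : p ≤ q) : CuntzLE (m1 p) (m1 q) := by
  have h2 := CFC.sqrt_mul_sqrt_self p hp
  have hr : star (CFC.sqrt p) = CFC.sqrt p :=
    (IsSelfAdjoint.of_nonneg (CFC.sqrt_nonneg p)).star_eq
  have := cuntz_of_star (r := CFC.sqrt p) (q := q) (by rw [hr, h2]; exact h)
  rwa [hr, h2] at this

theorem vcut {ε : ℝ} (h : 0 ≤ ε) :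
    Continuous (fun t : ℝ => (t - ε) ⊔ 0) ∧ (fun t : ℝ => (t - ε) ⊔ 0) 0 = 0 :=
  ⟨by fun_prop, by simpa using h⟩

theorem cut_nonneg [NonUnitalCStarAlgebra A] [PartialOrder A] [StarOrderedRing A]
    (ε : ℝ) (a : A) : 0 ≤ cutPlusN ε a :=
  cfcₙ_nonneg fun _ _ => le_sup_right

theorem cut_anti [NonUnitalCStarAlgebra A] [PartialOrder A] [StarOrderedRing A]
    {ε ε' : ℝ} (h : 0 ≤ ε) (h' : ε ≤ ε') (a : A) : cutPlusN ε' a ≤ cutPlusN ε a :=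
  cfcₙ_mono (fun t _ => sup_le_sup_right (by linarith) _) (vcut (h.trans h')).1.continuousOn
    (vcut h).1.continuousOn (vcut (h.trans h')).2 (vcut h).2

theorem cut_zero [NonUnitalCStarAlgebra A] [PartialOrder A] [StarOrderedRing A]
    {a : A} (ha : 0 ≤ a) : cutPlusN 0 a = a := by
  conv_rhs => rw [← cfcₙ_id' ℝ a]
  refine cfcₙ_congr fun t ht => ?_
  have ht0 : 0 ≤ t := quasispectrum_nonneg_of_nonneg a ha t ht
  simpa using ht0

theorem cut_le [NonUnitalCStarAlgebra A] [PartialOrder A] [StarOrderedRing A]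
    {ε : ℝ} (h : 0 ≤ ε) {a : A} (ha : 0 ≤ a) : cutPlusN ε a ≤ a := by
  simpa [cut_zero ha] using cut_anti le_rfl h a

theorem cut_cut [NonUnitalCStarAlgebra A] [PartialOrder A] [StarOrderedRing A]
    {ε : ℝ} (h : 0 ≤ ε) {a : A} (ha : 0 ≤ a) :
    cutPlusN ε (cutPlusN ε a) = cutPlusN (2 * ε) a := by
  unfold cutPlusN
  rw [← cfcₙ_comp' (fun t : ℝ => (t - ε) ⊔ 0) (fun t : ℝ => (t - ε) ⊔ 0) a
    (vcut h).1.continuousOn (vcut h).2 (vcut h).1.continuousOn (vcut h).2]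
  refine cfcₙ_congr fun t ht => ?_
  show ((t - ε) ⊔ 0 - ε) ⊔ 0 = (t - 2 * ε) ⊔ 0
  rcases le_total t ε with h1 | h1
  · rw [sup_of_le_right (by linarith : t - ε ≤ 0), sup_of_le_right (by linarith),
      sup_of_le_right (by linarith)]
  · rw [sup_of_le_left (by linarith : 0 ≤ t - ε)]; congr 1; ring

theorem exists_key [NonUnitalCStarAlgebra A] [PartialOrder A] [StarOrderedRing A]
    {a b : A} (ha : 0 ≤ a) (hb : 0 ≤ b) (hab : CuntzLE (m1 a) (m1 b)) {ε : ℝ} (hε : 0 < ε) :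
    ∃ z ∈ TT b, z * star z = cutPlusN ε a := by
  obtain ⟨x, hx⟩ := cuntz_m1.1 hab
  obtain ⟨N, hN⟩ := Metric.tendsto_atTop.1 hx ε hε
  have h1 := hN N le_rfl
  generalize x N = x at h1
  rw [dist_eq_norm, norm_sub_rev] at h1
  obtain ⟨ρ, hρ⟩ : ∃ ρ, ρ = ‖a - x * b * star x‖ := ⟨_, rfl⟩
  rw [← hρ] at h1
  have hid : cfcₙ (fun t : ℝ => t) a = a := cfcₙ_id' ℝ a
  have hys : star (CFC.sqrt b) = CFC.sqrt b :=
    (IsSelfAdjoint.of_nonneg (CFC.sqrt_nonneg b)).star_eq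
  have hyy := CFC.sqrt_mul_sqrt_self b hb
  have hTs := TT_sqrt hb
  generalize CFC.sqrt b = y at hys hyy hTs
  let ef : ℝ → ℝ := fun t => Real.sqrt (((t - ε) ⊔ 0) / ((t - ρ) ⊔ (ε - ρ)))
  have vef : Continuous ef ∧ ef 0 = 0 := by
    refine ⟨Real.continuous_sqrt.comp (Continuous.div (by fun_prop) (by fun_prop) fun t => ?_), ?_⟩
    · exact (lt_sup_of_lt_right (by linarith)).ne'
    · simp [ef, hε.le]
  obtain ⟨e, he⟩ : ∃ e, e = cfcₙ ef a := ⟨_, rfl⟩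
  have hes : star e = e := by rw [he, fsa]
  have hsa : IsSelfAdjoint (a - x * b * star x) := by
    refine (IsSelfAdjoint.of_nonneg ha).sub ?_
    exact (IsSelfAdjoint.of_nonneg hb).conjugate x
  have h2 : e * (a - x * b * star x) * e ≤ ρ • (e * e) := by
    have := CStarAlgebra.star_left_conjugate_le_norm_smul (a := e) (b := a - x * b * star x) hsa
    rwa [hes, ← hρ] at this
  have h3 : e * a * e - ρ • (e * e) = cutPlusN ε a := by
    have : ρ • (e * e) = cfcₙ (fun t => ρ * (ef t * ef t)) a := by
      rw [cfcₙ_const_mul ρ (fun t => ef t * ef t) a (vmul vef vef).1.continuousOn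
        (vmul vef vef).2, he, fmul a vef vef]
    rw [this, he]
    conv_lhs => enter [1, 1, 2]; rw [← hid]
    rw [fmul a vef vid, fmul a (vmul vef vid) vef, fsub (f := fun t => ef t * t * ef t)
      (g := fun t => ρ * (ef t * ef t)) a (vmul (vmul vef vid) vef)
      ⟨continuous_const.mul (vmul vef vef).1, by simp [vef.2]⟩]
    refine congrArg (fun f => cfcₙ f a) (funext fun t => ?_)
    have h0 : 0 ≤ ((t - ε) ⊔ 0) / ((t - ρ) ⊔ (ε - ρ)) :=
      div_nonneg le_sup_right (le_sup_of_le_right (by linarith))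
    have h6 : ef t * ef t = ((t - ε) ⊔ 0) / ((t - ρ) ⊔ (ε - ρ)) := Real.mul_self_sqrt h0
    have h7 : ef t * t * ef t - ρ * (ef t * ef t) = (ef t * ef t) * (t - ρ) := by ring
    rw [h7, h6]
    rcases le_total t ε with h1 | h1
    · rw [sup_of_le_right (by linarith : t - ε ≤ 0)]; simp
    · rw [sup_of_le_left (by linarith : ε - ρ ≤ t - ρ)]
      rw [div_mul_cancel₀]; linarith
  have h4 : cutPlusN ε a ≤ star (y * star x * e) * (y * star x * e) := by
    have : star (y * star x * e) * (y * star x * e) = e * (x * b * star x) * e := by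
      rw [← hyy]; simp [hes, hys, mul_assoc]
    rw [this, ← h3]
    rw [mul_sub, sub_mul] at h2
    rw [sub_le_iff_le_add, add_comm] at h2 ⊢
    simpa [add_comm] using h2
  obtain ⟨z, w, hz, hzz⟩ := exists_z (cut_nonneg ε a) h4
  refine ⟨z, TT_lim hb (fun n => ?_) hz, hzz⟩
  have : w n * star (y * star x * e) = (w n * e * x) * y := by simp [hes, hys, mul_assoc]
  rw [this]
  exact TT_mul _ hTs

theorem isPos_m1 [NonUnitalCStarAlgebra A] [PartialOrder A] [StarOrderedRing A]
    {a : A} (ha : 0 ≤ a) : IsPos (m1 a) := by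
  refine ⟨m1 (CFC.sqrt a), ?_⟩
  ext i j
  have hr : star (CFC.sqrt a) = CFC.sqrt a :=
    (IsSelfAdjoint.of_nonneg (CFC.sqrt_nonneg a)).star_eq
  simp [m1, Matrix.mul_apply, hr, CFC.sqrt_mul_sqrt_self a ha]

theorem isPos_dsumF [NonUnitalCStarAlgebra A] {n m : ℕ} {a : Matrix (Fin n) (Fin n) A}
    {b : Matrix (Fin m) (Fin m) A} (ha : IsPos a) (hb : IsPos b) : IsPos (dsumF a b) := by
  obtain ⟨x, rfl⟩ := ha
  obtain ⟨y, rfl⟩ := hb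
  refine ⟨dsumF x y, ?_⟩
  unfold dsumF dsum
  simp only [Matrix.reindex_apply, Matrix.conjTranspose_submatrix, Matrix.submatrix_mul_equiv,
    Matrix.fromBlocks_conjTranspose, Matrix.fromBlocks_multiply]
  simp

theorem cuntz_reindex_right [NonUnitalCStarAlgebra A] {ι κ κ' : Type*} [Fintype ι] [Fintype κ]
    [Fintype κ'] (e : κ ≃ κ') {a : Matrix ι ι A} {b : Matrix κ κ A} (h : CuntzLE a b) :
    CuntzLE a (Matrix.reindex e e b) := by
  obtain ⟨x, hx⟩ := h
  refine ⟨fun n => (x n).submatrix id e.symm, hx.congr fun n => ?_⟩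
  simp only [Matrix.reindex_apply, Matrix.conjTranspose_submatrix, Matrix.submatrix_mul_equiv]
  simp

theorem cuntz_reindex_left [NonUnitalCStarAlgebra A] {ι ι' κ : Type*} [Fintype ι] [Fintype ι']
    [Fintype κ] (e : ι ≃ ι') {a : Matrix ι ι A} {b : Matrix κ κ A} (h : CuntzLE a b) :
    CuntzLE (Matrix.reindex e e a) b := by
  obtain ⟨x, hx⟩ := h
  refine ⟨fun n => (x n).submatrix e.symm id, ?_⟩
  refine tendsto_pi_nhds.2 fun i => tendsto_pi_nhds.2 fun j => ?_
  have h := (tendsto_pi_nhds.1 ((tendsto_pi_nhds.1 hx) (e.symm i))) (e.symm j)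
  refine h.congr fun n => ?_
  simp [Matrix.mul_apply]

theorem cuntz_row [NonUnitalCStarAlgebra A] {p c b : A}
    (h : b ∈ closure {x : A | ∃ u v : A, x = u * p * star u + v * c * star v}) :
    CuntzLE (m1 b) (dsum (m1 p) (m1 c)) := by
  obtain ⟨s, hs, hl⟩ := mem_closure_iff_seq_limit.1 h
  choose u v huv using hs
  refine ⟨fun n => Matrix.of fun _ => Sum.elim (fun _ => u n) (fun _ => v n), ?_⟩
  refine tendsto_pi_nhds.2 fun i => tendsto_pi_nhds.2 fun j => ?_
  refine hl.congr fun n => ?_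
  simp [Matrix.mul_apply, dsum, m1, huv]

theorem cuntz_col [NonUnitalCStarAlgebra A] {p c b : A} (u v : ℕ → A)
    (h1 : Tendsto (fun n => u n * b * star (u n)) atTop (𝓝 p))
    (h2 : Tendsto (fun n => u n * b * star (v n)) atTop (𝓝 0))
    (h3 : Tendsto (fun n => v n * b * star (u n)) atTop (𝓝 0))
    (h4 : Tendsto (fun n => v n * b * star (v n)) atTop (𝓝 c)) :
    CuntzLE (dsum (m1 p) (m1 c)) (m1 b) := by
  refine ⟨fun n => Matrix.of (Sum.elim (fun _ _ => u n) (fun _ _ => v n)), ?_⟩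
  refine tendsto_pi_nhds.2 fun i => tendsto_pi_nhds.2 fun j => ?_
  rcases i with i | i <;> rcases j with j | j <;>
    simpa [Matrix.mul_apply, dsum, m1]

theorem cut_tendsto [NonUnitalCStarAlgebra A] [PartialOrder A] [StarOrderedRing A]
    {a : A} (ha : 0 ≤ a) : Tendsto (fun n => cutPlusN (en n) a) atTop (𝓝 a) := by
  rw [tendsto_iff_norm_sub_tendsto_zero]
  refine squeeze_zero (fun n => norm_nonneg _) (fun n => ?_) en_tendsto
  rw [norm_sub_rev]
  conv_lhs => enter [1, 1]; rw [← cut_zero ha]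
  unfold cutPlusN
  have hn := en_pos n
  rw [fsub a (vcut le_rfl) (vcut hn.le)]
  refine norm_cfcₙ_le fun t ht => ?_
  have ht0 : 0 ≤ t := quasispectrum_nonneg_of_nonneg a ha t ht
  rw [sub_zero, sup_of_le_left ht0, Real.norm_eq_abs, abs_le]
  constructor <;> rcases le_total t (en n) with h1 | h1
  · rw [sup_of_le_right (by linarith : t - en n ≤ 0)]; linarith
  · rw [sup_of_le_left (by linarith : 0 ≤ t - en n)]; linarith
  · rw [sup_of_le_right (by linarith : t - en n ≤ 0)]; linarith
  · rw [sup_of_le_left (by linarith : 0 ≤ t - en n)]; linarith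

theorem en_anti (k : ℕ) : en (k + 1) ≤ en k := by
  unfold en; push_cast; gcongr; linarith

theorem dim_le [NonUnitalCStarAlgebra A] [PartialOrder A] [StarOrderedRing A]
    (D : DimensionFunction A) {p q : A} (hp : 0 ≤ p) (h : p ≤ q) :
    D.d 1 (m1 p) ≤ D.d 1 (m1 q) :=
  D.mono 1 1 _ _ (isPos_m1 hp) (isPos_m1 (hp.trans h)) (cuntz_of_le hp h)

theorem lsc_key [NonUnitalCStarAlgebra A] [PartialOrder A] [StarOrderedRing A]
    {a : A} (ha : 0 ≤ a) (D : DimensionFunction A) (hD : D.IsLSC) {δ : ℝ} (hδ : 0 < δ) :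
    ∃ η : ℝ, 0 < η ∧ D.d 1 (m1 a) - δ < D.d 1 (m1 (cutPlusN η a)) := by
  have h := hD 1 (fun k => m1 (cutPlusN (en k) a)) (m1 a) (fun k => isPos_m1 (cut_nonneg _ _))
    (fun k => ?_) ?_
  · obtain ⟨K, hK⟩ := (h.eventually_const_lt (by linarith :
      D.d 1 (m1 a) - δ < D.d 1 (m1 a))).exists
    exact ⟨en K, en_pos K, hK⟩
  · have : m1 (cutPlusN (en (k + 1)) a) - m1 (cutPlusN (en k) a) =
      m1 (cutPlusN (en (k + 1)) a - cutPlusN (en k) a) := rfl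
    rw [this]
    exact isPos_m1 (sub_nonneg.2 (cut_anti (en_pos _).le (en_anti k) a))
  · exact tendsto_pi_nhds.2 fun i => tendsto_pi_nhds.2 fun j => cut_tendsto ha

theorem closure_conj [NonUnitalCStarAlgebra A] {p c g : A} (x : A)
    (h : g ∈ closure {x : A | ∃ u v : A, x = u * p * star u + v * c * star v}) :
    x * g * star x ∈ closure {x : A | ∃ u v : A, x = u * p * star u + v * c * star v} := by
  refine map_mem_closure (f := fun y => x * y * star x) (by fun_prop) h ?_
  rintro _ ⟨u, v, rfl⟩
  exact ⟨x * u, x * v, by simp [mul_add, add_mul, mul_assoc]⟩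

theorem closure_add [NonUnitalCStarAlgebra A] {p c y w : A} (hc : c = star w * w) :
    w * star w + y * p * star y ∈
      closure {x : A | ∃ u v : A, x = u * p * star u + v * c * star v} := by
  letI : PartialOrder A := CStarAlgebra.spectralOrder A
  haveI : StarOrderedRing A := CStarAlgebra.spectralOrderedRing A
  have h := (tendsto_conj (r := w) (q := c) hc.ge).add_const (y * p * star y)
  exact mem_closure_of_tendsto h (Eventually.of_forall fun n => ⟨_, _, add_comm _ _⟩)

/-- If `b = (w+v)*(w+v)`-type decomposition of a positive square root, then `b` is
in the closure generated by the pieces. -/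
theorem closure_final [NonUnitalCStarAlgebra A] [PartialOrder A] [StarOrderedRing A]
    {p c y w β b : A} (hc : c = star w * w) (hβ : star β = β) (hb : β * β = b) (v : A)
    (hw : w + v = β) (hv : v * star v = y * p * star y) :
    b ∈ closure {x : A | ∃ u v : A, x = u * p * star u + v * c * star v} := by
  have h1 := closure_add (p := p) (y := y) hc
  rw [← hv] at h1
  have h2 : star β * β ≤ (2 : ℝ) • (w * star w + v * star v) := by
    have h3 : 0 ≤ (w - v) * star (w - v) := mul_star_self_nonneg _
    have h4 : star β * β = (w + v) * star (w + v) := by rw [hw, hβ]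
    rw [h4, ← sub_nonneg]
    convert h3 using 1
    rw [two_smul, star_add, star_sub]
    noncomm_ring
  have h5 := tendsto_conj h2
  rw [hβ, hb] at h5
  rw [← closure_closure]
  refine mem_closure_of_tendsto h5 (Eventually.of_forall fun n => ?_)
  have h6 := closure_conj ((Real.sqrt 2) • (β * cfcₙ (kf (en n))
    ((2 : ℝ) • (w * star w + v * star v)))) h1
  convert h6 using 1
  simp only [star_smul, smul_mul_assoc, mul_smul_comm, smul_smul]
  simp

end Helpers

/-- If `a ≾ b` in a C*-algebra `A`, `d` is a lower semicontinuous dimension function and `δ > 0`,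
then there is `ε₀ > 0` such that for all `0 < ε ≤ ε₀` there are orthogonal positive elements
`a₀, c` in the hereditary subalgebra generated by `b` with `a₀ ∼ (a - 2ε)₊`,
`b ≾ (a - ε)₊ ⊕ c` and `d(b) - d(a) ≤ d(c) ≤ d(b) - d(a) + δ`. -/
theorem exists_almost_complement_with_dimension_bound [NonUnitalCStarAlgebra A]
    [PartialOrder A] [StarOrderedRing A]
    (a b : A) (ha : 0 ≤ a) (hb : 0 ≤ b) (hab : CuntzLE (m1 a) (m1 b))
    (D : DimensionFunction A) (hD : D.IsLSC) (δ : ℝ) (hδ : 0 < δ) :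
    ∃ ε₀ : ℝ, 0 < ε₀ ∧ ∀ ε : ℝ, 0 < ε → ε ≤ ε₀ →
      ∃ a₀ c : A, 0 ≤ a₀ ∧ 0 ≤ c ∧ a₀ ∈ Hered b ∧ c ∈ Hered b ∧ a₀ * c = 0 ∧
        EquivPos a₀ (cutPlusN (2 * ε) a) ∧
        CuntzLE (m1 b) (dsum (m1 (cutPlusN ε a)) (m1 c)) ∧
        D.d 1 (m1 b) - D.d 1 (m1 a) ≤ D.d 1 (m1 c) ∧
        D.d 1 (m1 c) ≤ D.d 1 (m1 b) - D.d 1 (m1 a) + δ := by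
  obtain ⟨η, hη, hlsc⟩ := lsc_key ha D hD hδ
  refine ⟨η / 2, by positivity, fun ε hε hεη => ?_⟩
  obtain ⟨z, hzT, hzz⟩ := exists_key ha hb hab hε
  obtain ⟨p, hp⟩ : ∃ p, p = cutPlusN ε a := ⟨_, rfl⟩
  have hp0 : 0 ≤ p := hp ▸ cut_nonneg ε a
  rw [← hp] at hzz
  have hid : cfcₙ (fun t : ℝ => t) p = p := cfcₙ_id' ℝ p
  have hβs : star (CFC.sqrt b) = CFC.sqrt b :=
    (IsSelfAdjoint.of_nonneg (CFC.sqrt_nonneg b)).star_eq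
  have hββ := CFC.sqrt_mul_sqrt_self b hb
  have hTβ := TT_sqrt hb
  generalize CFC.sqrt b = β at hβs hββ hTβ
  -- the functions
  let gf : ℝ → ℝ := fun t => Real.sqrt (((t - ε) ⊔ 0) / (t ⊔ ε))
  let lf : ℝ → ℝ := fun t => t / (t ⊔ ε) ^ 2
  have hpos : ∀ t : ℝ, 0 < t ⊔ ε := fun t => lt_sup_of_lt_right hε
  have vg : Continuous gf ∧ gf 0 = 0 := by
    refine ⟨Real.continuous_sqrt.comp (Continuous.div (by fun_prop) (by fun_prop) fun t => ?_), ?_⟩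
    · exact (hpos t).ne'
    · simp [gf, hε.le]
  have vl : Continuous lf ∧ lf 0 = 0 := by
    refine ⟨Continuous.div (by fun_prop) (by fun_prop) fun t => ?_, by simp [lf]⟩
    exact (pow_pos (hpos t) 2).ne'
  obtain ⟨g, hg⟩ : ∃ g, g = cfcₙ gf p := ⟨_, rfl⟩
  obtain ⟨l, hl⟩ : ∃ l, l = cfcₙ lf p := ⟨_, rfl⟩
  have hgs : star g = g := by rw [hg, fsa]
  have hls : star l = l := by rw [hl, fsa]
  have hgpg : g * p * g = cutPlusN (2 * ε) a := by
    rw [← cut_cut hε.le ha, ← hp, hg]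
    conv_lhs => enter [1, 2]; rw [← hid]
    rw [fmul p vg vid, fmul p (vmul vg vid) vg]
    refine cfcₙ_congr fun t ht => ?_
    have h0 : 0 ≤ ((t - ε) ⊔ 0) / (t ⊔ ε) := div_nonneg le_sup_right (hpos t).le
    have h6 : gf t * gf t = ((t - ε) ⊔ 0) / (t ⊔ ε) := Real.mul_self_sqrt h0
    show gf t * t * gf t = (t - ε) ⊔ 0
    rw [mul_right_comm, h6]
    rcases le_total t ε with h1 | h1
    · rw [sup_of_le_right (by linarith : t - ε ≤ 0)]; simp
    · rw [sup_of_le_left h1, div_mul_cancel₀]; linarith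
  have hgpl : g * p * l = g := by
    rw [hg, hl]
    conv_lhs => enter [1, 2]; rw [← hid]
    rw [fmul p vg vid, fmul p (vmul vg vid) vl]
    refine cfcₙ_congr fun t ht => ?_
    show gf t * t * lf t = gf t
    rcases le_total t ε with h1 | h1
    · have : gf t = 0 := by
        simp only [gf]; rw [sup_of_le_right (by linarith : t - ε ≤ 0)]; simp
      rw [this]; simp
    · have ht : t ≠ 0 := by linarith
      simp only [lf]; rw [sup_of_le_left h1]; field_simp
  obtain ⟨v, hv⟩ : ∃ v, v = β * (star z * l * z) := ⟨_, rfl⟩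
  obtain ⟨w, hw⟩ : ∃ w, w = β - v := ⟨_, rfl⟩
  obtain ⟨x, hx⟩ : ∃ x, x = g * z := ⟨_, rfl⟩
  have hTx : x ∈ TT b := hx ▸ TT_mul _ hzT
  have hTw : w ∈ TT b := by
    rw [hw, hv, ← mul_assoc]
    exact TT_sub hTβ (TT_mul _ hzT)
  have hxw : x * star w = 0 := by
    have e : x * star w = g * z * β - g * (z * star z) * l * z * β := by
      rw [hx, hw, hv]
      simp only [star_sub, star_mul, star_star, hls, hβs, mul_sub, mul_assoc]
    rw [e, hzz, hgpl, sub_self]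
  have hwx : w * star x = 0 := by
    have := congrArg star hxw
    simpa using this
  have hxx : x * star x = cutPlusN (2 * ε) a := by
    rw [← hgpg, ← hzz, hx]; simp [hgs, mul_assoc]
  have hvv : v * star v = (β * star z * l) * p * star (β * star z * l) := by
    rw [← hzz, hv]; simp [hls, hβs, mul_assoc]
  have hcl := closure_final (c := star w * w) rfl hβs hββ v (by rw [hw]; abel) hvv
  have hrow := cuntz_row hcl
  have hc0 : 0 ≤ star w * w := star_mul_self_nonneg w
  have hd1 : D.d 1 (m1 b) ≤ D.d 1 (m1 p) + D.d 1 (m1 (star w * w)) := by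
    rw [← D.add 1 1 _ _ (isPos_m1 hp0) (isPos_m1 hc0)]
    exact D.mono 1 (1 + 1) _ _ (isPos_m1 hb) (isPos_dsumF (isPos_m1 hp0) (isPos_m1 hc0))
      (cuntz_reindex_right _ hrow)
  have hd2 : D.d 1 (m1 p) ≤ D.d 1 (m1 a) := dim_le D hp0 (hp ▸ cut_le hε.le ha)
  have hxx0 : 0 ≤ x * star x := mul_star_self_nonneg x
  have hww0 : 0 ≤ w * star w := mul_star_self_nonneg w
  have hcol : CuntzLE (dsum (m1 (x * star x)) (m1 (w * star w))) (m1 b) := by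
    have hTx' : Tendsto _ _ _ := hTx
    have hTw' : Tendsto _ _ _ := hTw
    refine cuntz_col (fun n => x * cfcₙ (kf (en n)) b) (fun n => w * cfcₙ (kf (en n)) b)
      ?_ ?_ ?_ ?_
    · refine (hTx'.mul_const (star x)).congr fun n => ?_
      simp [Mq, fsa, mul_assoc]
    · rw [← hxw]
      refine (hTx'.mul_const (star w)).congr fun n => ?_
      simp [Mq, fsa, mul_assoc]
    · rw [← hwx]
      refine (hTw'.mul_const (star x)).congr fun n => ?_
      simp [Mq, fsa, mul_assoc]
    · refine (hTw'.mul_const (star w)).congr fun n => ?_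
      simp [Mq, fsa, mul_assoc]
  have hd3 : D.d 1 (m1 (x * star x)) + D.d 1 (m1 (w * star w)) ≤ D.d 1 (m1 b) := by
    rw [← D.add 1 1 _ _ (isPos_m1 hxx0) (isPos_m1 hww0)]
    exact D.mono (1 + 1) 1 _ _ (isPos_dsumF (isPos_m1 hxx0) (isPos_m1 hww0)) (isPos_m1 hb)
      (cuntz_reindex_left _ hcol)
  have hd4 : D.d 1 (m1 (star w * w)) ≤ D.d 1 (m1 (w * star w)) := by
    refine D.mono 1 1 _ _ (isPos_m1 hc0) (isPos_m1 hww0) ?_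
    have := cuntz_of_star (r := star w) (q := w * star w) (by rw [star_star])
    rwa [star_star] at this
  have hd5 : D.d 1 (m1 (cutPlusN η a)) ≤ D.d 1 (m1 (x * star x)) := by
    rw [hxx]
    exact dim_le D (cut_nonneg _ _) (cut_anti (by linarith) (by linarith) a)
  refine ⟨star x * x, star w * w, star_mul_self_nonneg x, hc0, TT_hered hb hTx,
    TT_hered hb hTw, ?_, ⟨x, rfl, hxx.symm⟩, hp ▸ hrow, by linarith, by linarith⟩
  rw [mul_assoc, ← mul_assoc x, hxw, zero_mul, mul_zero]
end
end
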